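/- arXiv:2009.03153 — 5 statements merged into one kernel-verified Lean document; each statement's English description precedes it below -/
import Mathlib

section
/- Let q ≥ 2 be an integer and let Ψ(λ) = (q+1)√(4q − λ²) / (2((q+1)² − λ²)) on [−2√q, 2√q]. Then, as t → ∞, (1/π) ∫_{−2√q}^{2√q} e^{i t λ} Ψ(λ) dλ = (1/(√π · t^{3/2})) · sin(2√q t − π/4) · q^{1/4}(q+1)/(q−1)² + O(t^{−2}). -/
open MeasureTheory intervalIntegral Real

/-- `Ψ(λ) = (q+1)√(4q − λ²) / (2((q+1)² − λ²))`, the diagonal spectral density of the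
adjacency operator of the `(q+1)`-regular tree. -/
noncomputable def Psi (q : ℕ) (l : ℝ) : ℝ :=
  ((q:ℝ)+1) * Real.sqrt (4*q - l^2) / (2*(((q:ℝ)+1)^2 - l^2))

/-- Watson's lemma for a finite Laplace integral whose amplitude is `c √y + O(y)` at `0`. -/
theorem watson_sqrt {f : ℝ → ℂ} {c : ℂ} {C t : ℝ} (hf : ContinuousOn f (Set.Icc 0 1))
    (hb : ∀ y ∈ Set.Icc (0:ℝ) 1, ‖f y - c * (√y : ℝ)‖ ≤ C * y) (ht : 0 < t) :
    ‖(∫ y in (0:ℝ)..1, (Real.exp (-(t * y)) : ℂ) * f y)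
        - c * ((√π / 2 / t ^ ((3:ℝ)/2) : ℝ) : ℂ)‖ ≤ (C + ‖c‖) / t ^ 2 := by
  have hC : 0 ≤ C := by
    have := (norm_nonneg _).trans (hb 1 (by simp))
    simpa using this
  have gamma_three_halves : Real.Gamma (3/2) = √π / 2 := by
    rw [show (3/2:ℝ) = 1/2 + 1 by norm_num, Real.Gamma_add_one (by norm_num),
      Real.Gamma_one_half_eq]
    ring
  have int_rpow : ∀ s : ℝ, 0 < s →
      IntegrableOn (fun y : ℝ => y ^ s * Real.exp (-(t * y))) (Set.Ioi 0) := fun s hs => by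
    simpa using integrableOn_rpow_mul_exp_neg_mul_rpow (p := 1) (s := s) (b := t)
      (by linarith) one_pos ht
  have eq_sqrt : ∫ y in Set.Ioi (0:ℝ), √y * Real.exp (-(t * y)) = √π / 2 / t ^ ((3:ℝ)/2) := by
    have := Real.integral_rpow_mul_exp_neg_mul_Ioi (a := 3/2) (r := t) (by norm_num) ht
    norm_num [gamma_three_halves] at this
    simp only [Real.sqrt_eq_rpow] at this ⊢
    rw [this, Real.inv_rpow ht.le]
    ring
  have eq_id : ∫ y in Set.Ioi (0:ℝ), y * Real.exp (-(t * y)) = 1 / t ^ 2 := by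
    have := Real.integral_rpow_mul_exp_neg_mul_Ioi (a := 2) (r := t) (by norm_num) ht
    norm_num at this
    rw [this]; simp
  have int_sqrt : IntegrableOn (fun y : ℝ => √y * Real.exp (-(t * y))) (Set.Ioi 0) := by
    simpa only [Real.sqrt_eq_rpow] using int_rpow (1/2) (by norm_num)
  have int_id : IntegrableOn (fun y : ℝ => y * Real.exp (-(t * y))) (Set.Ioi 0) := by
    simpa using int_rpow 1 (by norm_num)
  set F : ℝ → ℂ := fun y => (Real.exp (-(t * y)) : ℂ) * f y with hF
  have hFc : ContinuousOn F (Set.Icc 0 1) := by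
    refine ContinuousOn.mul ?_ hf
    fun_prop
  have hFi : IntegrableOn F (Set.Ioc 0 1) :=
    (hFc.integrableOn_compact isCompact_Icc).mono_set Set.Ioc_subset_Icc_self
  have hGi : IntegrableOn ((Set.Ioc 0 1).indicator F) (Set.Ioi (0:ℝ)) :=
    (hFi.integrable_indicator measurableSet_Ioc).integrableOn
  have hG : ∫ y in (0:ℝ)..1, F y = ∫ y in Set.Ioi (0:ℝ), (Set.Ioc 0 1).indicator F y := by
    rw [intervalIntegral.integral_of_le zero_le_one, setIntegral_indicator measurableSet_Ioc,
      Set.inter_eq_self_of_subset_right Set.Ioc_subset_Ioi_self]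
  have hS : c * ((√π / 2 / t ^ ((3:ℝ)/2) : ℝ) : ℂ)
      = ∫ y in Set.Ioi (0:ℝ), c * ((√y * Real.exp (-(t * y)) : ℝ) : ℂ) := by
    rw [← eq_sqrt, MeasureTheory.integral_const_mul, integral_complex_ofReal]
  have hSi : IntegrableOn (fun y : ℝ => c * ((√y * Real.exp (-(t * y)) : ℝ) : ℂ))
      (Set.Ioi 0) := int_sqrt.ofReal.const_mul c
  rw [hG, hS, ← MeasureTheory.integral_sub hGi hSi]
  have hR : (C + ‖c‖) / t ^ 2
      = ∫ y in Set.Ioi (0:ℝ), (C + ‖c‖) * (y * Real.exp (-(t * y))) := by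
    rw [MeasureTheory.integral_const_mul, eq_id]; ring
  rw [hR]
  refine MeasureTheory.norm_integral_le_of_norm_le (int_id.const_mul _) ?_
  filter_upwards [ae_restrict_mem measurableSet_Ioi] with y hy
  have hy0 : 0 < y := hy
  by_cases h1 : y ≤ 1
  · rw [Set.indicator_of_mem (show y ∈ Set.Ioc (0:ℝ) 1 from ⟨hy0, h1⟩)]
    have : F y - c * ((√y * Real.exp (-(t * y)) : ℝ) : ℂ)
        = (Real.exp (-(t * y)) : ℂ) * (f y - c * (√y : ℝ)) := by
      simp only [hF]; push_cast; ring
    rw [this, norm_mul, Complex.norm_real, Real.norm_of_nonneg (Real.exp_pos _).le]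
    have h2 := mul_le_mul_of_nonneg_left (hb y ⟨hy0.le, h1⟩) (Real.exp_pos (-(t * y))).le
    have h3 : 0 ≤ ‖c‖ * (y * Real.exp (-(t * y))) := by positivity
    linarith
  · push Not at h1
    rw [Set.indicator_of_notMem (fun h => absurd h.2 (not_le.2 h1)), zero_sub, norm_neg, norm_mul,
      Complex.norm_real, Real.norm_of_nonneg (by positivity)]
    have h2 : √y ≤ y := Real.sqrt_le_iff.2 ⟨hy0.le, by nlinarith⟩
    have h3 : 0 ≤ C * (y * Real.exp (-(t * y))) := by positivity
    have h4 : ‖c‖ * (√y * Real.exp (-(t * y))) ≤ ‖c‖ * (y * Real.exp (-(t * y))) := by gcongr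
    linarith

/-- Fourier asymptotics on `[-a, a]` for a function that extends holomorphically to the half-strip
above the interval, with conjugate square-root singularities at the two endpoints. -/
theorem fourier_asymptotics_of_strip {a C : ℝ} {P : ℂ → ℂ} {c : ℂ} (ha : 0 < a)
    (hcont : ContinuousOn P (Set.Icc (-a) a ×ℂ Set.Icc 0 1))
    (hdiff : DifferentiableOn ℂ P (Set.Ioo (-a) a ×ℂ Set.Ioo 0 1))
    (hconj : ∀ y ∈ Set.Icc (0:ℝ) 1,
      P (((-a : ℝ) : ℂ) + y * Complex.I) = starRingEnd ℂ (P (a + y * Complex.I)))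
    (hb : ∀ y ∈ Set.Icc (0:ℝ) 1, ‖P (a + y * Complex.I) - c * (√y : ℝ)‖ ≤ C * y) :
    ∃ C' : ℝ, 0 < C' ∧ ∀ t : ℝ, 0 < t →
      ‖(∫ l in (-a)..a, Complex.exp (Complex.I * t * l) * P l)
        - ((2 * (Complex.exp (Complex.I * t * a) * c).im * (√π / 2 / t ^ ((3:ℝ)/2)) : ℝ) : ℂ)‖
        ≤ C' / t ^ 2 := by
  have hK : IsCompact (Set.Icc (-a) a ×ℂ Set.Icc (0:ℝ) 1) :=
    isCompact_Icc.reProdIm isCompact_Icc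
  obtain ⟨M, hM⟩ := hK.exists_bound_of_continuousOn hcont
  have hM0 : 0 ≤ M := (norm_nonneg _).trans
    (hM 0 (by simp [Complex.mem_reProdIm, ha.le]))
  have hC : 0 ≤ C := by
    have := (norm_nonneg _).trans (hb 1 (by simp))
    simpa using this
  have hright : ContinuousOn (fun y : ℝ => P (a + y * Complex.I)) (Set.Icc 0 1) := by
    refine hcont.comp (by fun_prop) fun y hy => ?_
    simp [Complex.mem_reProdIm, ha.le, hy.1, hy.2]
  refine ⟨2 * M * (2 * a) + 2 * (C + ‖c‖) + 1, by positivity, fun t ht => ?_⟩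
  set f : ℂ → ℂ := fun z => Complex.exp (Complex.I * t * z) * P z with hf
  have hrect := Complex.integral_boundary_rect_eq_zero_of_continuousOn_of_differentiableOn f
    ((-a : ℝ) : ℂ) (a + Complex.I) (by
      have h1 : Set.uIcc (-a) a = Set.Icc (-a) a := Set.uIcc_of_le (by linarith)
      have h2 : Set.uIcc (0:ℝ) 1 = Set.Icc 0 1 := Set.uIcc_of_le (by linarith)
      simp only [Complex.ofReal_re, Complex.add_re, Complex.I_re, Complex.ofReal_im,
        Complex.add_im, Complex.I_im, add_zero, zero_add, h1, h2]
      exact ContinuousOn.mul (by fun_prop) hcont) (by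
      have h1 : min (-a) a = -a := min_eq_left (by linarith)
      have h2 : max (-a) a = a := max_eq_right (by linarith)
      simp only [Complex.ofReal_re, Complex.add_re, Complex.I_re, Complex.ofReal_im,
        Complex.add_im, Complex.I_im, add_zero, zero_add, h1, h2, zero_le_one, inf_of_le_left,
        sup_of_le_right]
      exact DifferentiableOn.mul (by fun_prop) hdiff)
  simp only [Complex.ofReal_re, Complex.add_re, Complex.I_re, Complex.ofReal_im,
        Complex.add_im, Complex.I_im, add_zero, zero_add, Complex.ofReal_zero, zero_mul,
        Complex.ofReal_one, one_mul, smul_eq_mul] at hrect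
  set G : ℂ := ∫ y in (0:ℝ)..1, (Real.exp (-(t * y)) : ℂ) * P (a + y * Complex.I) with hG
  have hGr : ∫ y in (0:ℝ)..1, f (a + y * Complex.I) = Complex.exp (Complex.I * t * a) * G := by
    rw [hG, ← intervalIntegral.integral_const_mul]
    refine intervalIntegral.integral_congr fun y _ => ?_
    simp only [hf, Complex.ofReal_exp]
    rw [← mul_assoc, ← Complex.exp_add]
    congr 2
    push_cast
    linear_combination (t * y : ℂ) * Complex.I_mul_I
  have hGl : ∫ y in (0:ℝ)..1, f (((-a : ℝ) : ℂ) + y * Complex.I)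
      = starRingEnd ℂ (Complex.exp (Complex.I * t * a) * G) := by
    rw [← hGr, ← intervalIntegral_conj]
    refine intervalIntegral.integral_congr fun y hy => ?_
    rw [Set.uIcc_of_le zero_le_one] at hy
    simp only [hf, map_mul]
    rw [hconj y hy, ← Complex.exp_conj]
    congr 2
    simp
    ring
  have htop : ‖∫ x in (-a)..a, f (x + Complex.I)‖ ≤ 2 * M * (2 * a) / t ^ 2 := by
    have hexp : Real.exp (-t) ≤ 2 / t ^ 2 := by
      rw [Real.exp_neg, inv_eq_one_div, div_le_div_iff₀ (Real.exp_pos _) (by positivity)]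
      have := Real.quadratic_le_exp_of_nonneg ht.le
      linarith
    have h1 : ‖∫ x in (-a)..a, f (x + Complex.I)‖ ≤ 2 / t ^ 2 * M * |a - -a| := by
      refine intervalIntegral.norm_integral_le_of_norm_le_const fun x hx => ?_
      rw [Set.uIoc_of_le (by linarith)] at hx
      simp only [hf, norm_mul, Complex.norm_exp]
      refine mul_le_mul ?_ (hM _ ?_) (norm_nonneg _) (by positivity)
      · simpa using hexp
      · simp [Complex.mem_reProdIm, hx.1.le, hx.2]
    refine h1.trans (le_of_eq ?_)
    rw [abs_of_pos (by linarith)]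
    ring
  have hW := watson_sqrt hright hb ht
  rw [← hG] at hW
  rw [hGr, hGl] at hrect
  have key : (∫ l in (-a)..a, f l)
      - ((2 * (Complex.exp (Complex.I * t * a) * c).im * (√π / 2 / t ^ ((3:ℝ)/2)) : ℝ) : ℂ)
      = (∫ x in (-a)..a, f (x + Complex.I))
        + ((2 * (Complex.exp (Complex.I * t * a)
          * (G - c * ((√π / 2 / t ^ ((3:ℝ)/2) : ℝ) : ℂ))).im : ℝ) : ℂ) := by
    have him : ∀ X : ℂ, Complex.I * starRingEnd ℂ X - Complex.I * X = ((2 * X.im : ℝ) : ℂ) := by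
      intro X
      apply Complex.ext <;> simp
      ring
    have h2 := him (Complex.exp (Complex.I * t * a) * G)
    rw [mul_sub, Complex.sub_im, ← mul_assoc, Complex.im_mul_ofReal]
    push_cast at h2 ⊢
    linear_combination hrect + h2
  rw [key]
  refine (norm_add_le _ _).trans ?_
  rw [Complex.norm_real, norm_mul, Real.norm_ofNat]
  have h3 : ‖(Complex.exp (Complex.I * t * a)
          * (G - c * ((√π / 2 / t ^ ((3:ℝ)/2) : ℝ) : ℂ))).im‖ ≤ (C + ‖c‖) / t ^ 2 := by
    refine (Complex.abs_im_le_norm _).trans ?_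
    rw [norm_mul, Complex.norm_exp]
    simpa using hW
  have h4 : (2 * M * (2 * a) + 2 * (C + ‖c‖) + 1) / t ^ 2
      = 2 * M * (2 * a) / t ^ 2 + 2 * ((C + ‖c‖) / t ^ 2) + 1 / t ^ 2 := by ring
  have h5 : 0 < 1 / t ^ 2 := by positivity
  linarith

theorem ofReal_mul_cpow {r : ℝ} (hr : 0 < r) {w : ℂ} (hw : w ≠ 0) (s : ℂ) :
    ((r : ℂ) * w) ^ s = (r : ℂ) ^ s * w ^ s := by
  have hr' : (r : ℂ) ≠ 0 := by exact_mod_cast hr.ne'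
  rw [Complex.cpow_def_of_ne_zero (mul_ne_zero hr' hw), Complex.cpow_def_of_ne_zero hr',
    Complex.cpow_def_of_ne_zero hw, Complex.log_ofReal_mul hr hw, Complex.ofReal_log hr.le,
    ← Complex.exp_add, add_mul]

theorem ofReal_cpow_half {x : ℝ} (hx : 0 ≤ x) : (x : ℂ) ^ (1/2 : ℂ) = (√x : ℝ) := by
  rw [Real.sqrt_eq_rpow, Complex.ofReal_cpow hx]
  norm_num

/-- The holomorphic extension of `l ↦ K √(a² − l²) / (2 (K² − l²))` to the strip
`|Re z| < a`, `0 < Im z`. -/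
noncomputable def stripDensity (a K : ℝ) (z : ℂ) : ℂ :=
  K * ((a:ℂ)^2 - z^2) ^ (1/2 : ℂ) / (2 * ((K:ℂ)^2 - z^2))

theorem re_sq_sub_sq (a : ℝ) (z : ℂ) : ((a:ℂ)^2 - z^2).re = a^2 - z.re^2 + z.im^2 := by
  simp [pow_two]
  ring

theorem sq_sub_sq_ne_zero {a K : ℝ} (haK : a^2 < K^2) {z : ℂ} (hz : z.re ∈ Set.Icc (-a) a) :
    (K:ℂ)^2 - z^2 ≠ 0 := by
  intro h
  have h1 := re_sq_sub_sq K z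
  rw [h] at h1
  simp only [Complex.zero_re] at h1
  have := hz.1
  have := hz.2
  nlinarith [sq_nonneg z.im]

theorem continuousOn_stripDensity {a K : ℝ} (haK : a^2 < K^2) :
    ContinuousOn (stripDensity a K) (Set.Icc (-a) a ×ℂ Set.Icc 0 1) := by
  intro z hz
  rw [Complex.mem_reProdIm] at hz
  refine ContinuousAt.continuousWithinAt ?_
  have h0 : 0 ≤ ((a:ℂ)^2 - z^2).re := by
    rw [re_sq_sub_sq]
    nlinarith [hz.1.1, hz.1.2, sq_nonneg z.im]
  have h1 : ContinuousAt (fun w : ℂ => ((a:ℂ)^2 - w^2) ^ (1/2 : ℂ)) z :=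
    (Complex.continuousAt_cpow_const_of_re_pos (Or.inl h0) (by norm_num)).comp
      (f := fun w : ℂ => (a:ℂ)^2 - w^2) (by fun_prop)
  refine ContinuousAt.div (continuousAt_const.mul h1) (by fun_prop) ?_
  exact mul_ne_zero two_ne_zero (sq_sub_sq_ne_zero haK hz.1)

theorem differentiableOn_stripDensity {a K : ℝ} (haK : a^2 < K^2) :
    DifferentiableOn ℂ (stripDensity a K) (Set.Ioo (-a) a ×ℂ Set.Ioo 0 1) := by
  intro z hz
  rw [Complex.mem_reProdIm] at hz
  have h0 : 0 < ((a:ℂ)^2 - z^2).re := by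
    rw [re_sq_sub_sq]
    nlinarith [hz.1.1, hz.1.2, sq_nonneg z.im]
  have h1 : DifferentiableAt ℂ (fun w : ℂ => ((a:ℂ)^2 - w^2) ^ (1/2 : ℂ)) z :=
    DifferentiableAt.cpow_const (by fun_prop) (Or.inl h0)
  refine (DifferentiableAt.div (h1.const_mul _) (by fun_prop) ?_).differentiableWithinAt
  exact mul_ne_zero two_ne_zero (sq_sub_sq_ne_zero haK ⟨hz.1.1.le, hz.1.2.le⟩)

theorem stripDensity_neg_conj {a K : ℝ} {z : ℂ} (hz : z.re ∈ Set.Icc (-a) a) :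
    stripDensity a K (-starRingEnd ℂ z) = starRingEnd ℂ (stripDensity a K z) := by
  have h0 : 0 ≤ ((a:ℂ)^2 - z^2).re := by
    rw [re_sq_sub_sq]
    nlinarith [hz.1, hz.2, sq_nonneg z.im]
  have h1 : ((a:ℂ)^2 - z^2).arg ≠ π := by
    have := (abs_le.1 (Complex.abs_arg_le_pi_div_two_iff.2 h0)).2
    have := Real.pi_pos
    intro h
    linarith
  have h2 : starRingEnd ℂ 2 = 2 := map_ofNat _ 2
  have h3 : (a:ℂ)^2 - (-starRingEnd ℂ z)^2 = starRingEnd ℂ ((a:ℂ)^2 - z^2) := by simp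
  have h4 : ((starRingEnd ℂ) ((a:ℂ)^2 - z^2)) ^ (1/2 : ℂ)
      = starRingEnd ℂ (((a:ℂ)^2 - z^2) ^ (1/2 : ℂ)) := by
    rw [Complex.conj_cpow _ _ h1]
    simp [h2]
  simp only [stripDensity]
  rw [h3, h4]
  simp [h2]

theorem stripDensity_edge {a K : ℝ} (ha : 0 < a) (haK : a^2 < K^2) :
    ∃ C : ℝ, ∀ y ∈ Set.Icc (0:ℝ) 1,
      ‖stripDensity a K (a + y * Complex.I)
        - (K * √(2 * a) / (2 * (K^2 - a^2)) : ℝ) * Complex.exp (-(π / 4 * Complex.I))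
          * (√y : ℝ)‖ ≤ C * y := by
  set u : ℂ → ℂ := fun z => z - ((2 * a : ℝ) : ℂ) * Complex.I with hu
  set d : ℂ → ℂ := fun z => 2 * ((K:ℂ)^2 - (a + z * Complex.I)^2) with hd
  set φ : ℂ → ℂ := fun z => K * u z ^ (1/2 : ℂ) / d z with hφ
  have huc : Continuous u := by fun_prop
  have hdc : Continuous d := by fun_prop
  have hopen : IsOpen (u ⁻¹' Complex.slitPlane ∩ d ⁻¹' {0}ᶜ) :=
    (Complex.isOpen_slitPlane.preimage huc).inter (isOpen_compl_singleton.preimage hdc)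
  have hdiff : DifferentiableOn ℂ φ (u ⁻¹' Complex.slitPlane ∩ d ⁻¹' {0}ᶜ) := by
    intro z hz
    have h1 : DifferentiableAt ℂ (fun z => u z ^ (1/2 : ℂ)) z :=
      DifferentiableAt.cpow_const (by fun_prop) hz.1
    exact (DifferentiableAt.div (h1.const_mul _) (by fun_prop) hz.2).differentiableWithinAt
  have hmem : ∀ y : ℝ, (y : ℂ) ∈ u ⁻¹' Complex.slitPlane ∩ d ⁻¹' {0}ᶜ := fun y =>
    ⟨Or.inr (by simp [hu, ha.ne']), by
      simpa [hd] using sq_sub_sq_ne_zero haK (z := a + y * Complex.I) (by simp [ha.le])⟩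
  have hcd : ContDiffOn ℝ 1 (fun y : ℝ => φ y) (Set.Icc 0 1) :=
    ((hdiff.contDiffOn (n := 1) hopen).restrict_scalars ℝ).comp
      Complex.ofRealCLM.contDiff.contDiffOn fun y _ => hmem y
  obtain ⟨L, hL⟩ := hcd.exists_lipschitzOnWith one_ne_zero (convex_Icc 0 1) isCompact_Icc
  have hfac : ∀ y ∈ Set.Icc (0:ℝ) 1,
      stripDensity a K (a + y * Complex.I) = (√y : ℝ) * φ y := by
    intro y hy
    have h1 : (a:ℂ)^2 - (a + y * Complex.I)^2 = y * u y := by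
      simp only [hu]
      push_cast
      linear_combination (-(y:ℂ)^2) * Complex.I_sq
    simp only [stripDensity, hφ]
    rw [h1]
    rcases hy.1.eq_or_lt with rfl | h
    · simp
    · rw [ofReal_mul_cpow h (Complex.slitPlane_ne_zero (hmem y).1), ofReal_cpow_half h.le]
      ring
  have hφ0 : φ 0 = (K * √(2 * a) / (2 * (K^2 - a^2)) : ℝ) * Complex.exp (-(π / 4 * Complex.I)) := by
    have h1 : u 0 = ((2 * a : ℝ) : ℂ) * (-Complex.I) := by simp [hu]
    have h2 : (-Complex.I) ^ (1/2 : ℂ) = Complex.exp (-(π / 4 * Complex.I)) := by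
      rw [Complex.cpow_def_of_ne_zero (by simp), Complex.log_neg_I]
      congr 1
      ring
    simp only [hφ, hd]
    rw [h1, ofReal_mul_cpow (by positivity) (by simp), ofReal_cpow_half (by positivity), h2]
    push_cast
    simp only [zero_mul, add_zero]
    ring
  refine ⟨L, fun y hy => ?_⟩
  rw [hfac y hy, ← hφ0, mul_comm (φ 0), ← mul_sub, norm_mul, Complex.norm_real,
    Real.norm_of_nonneg (Real.sqrt_nonneg _)]
  have h1 := hL.dist_le_mul y hy 0 (by simp)
  rw [dist_eq_norm, dist_eq_norm, sub_zero, Real.norm_of_nonneg hy.1, Complex.ofReal_zero] at h1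
  calc √y * ‖φ y - φ 0‖ ≤ 1 * ‖φ y - φ 0‖ := by
        gcongr
        exact Real.sqrt_le_one.2 hy.2
    _ ≤ L * y := by rwa [one_mul]

/-- As `t → ∞`,
`(1/π) ∫_{−2√q}^{2√q} e^{itλ} Ψ(λ) dλ
  = (1/(√π t^{3/2})) sin(2√q t − π/4) · q^{1/4}(q+1)/(q−1)² + O(t^{−2})`. -/
theorem diagonal_kernel_asymptotics (q : ℕ) (hq : 2 ≤ q) :
    ∃ C t₀ : ℝ, 0 < C ∧ 0 < t₀ ∧ ∀ t ≥ t₀,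
      ‖(1/Real.pi : ℂ) * (∫ l in (-(2*Real.sqrt q))..(2*Real.sqrt q),
          Complex.exp (Complex.I * t * l) * (Psi q l : ℂ))
        - ((1/(Real.sqrt Real.pi * t ^ ((3:ℝ)/2)) *
            Real.sin (2*Real.sqrt q * t - Real.pi/4) *
            ((q:ℝ) ^ ((1:ℝ)/4) * ((q:ℝ)+1) / ((q:ℝ)-1)^2) : ℝ) : ℂ)‖
        ≤ C / t^2 := by
  have hq1 : (2:ℝ) ≤ q := by exact_mod_cast hq
  have hq0 : (0:ℝ) < q := by linarith
  set a : ℝ := 2 * √q with ha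
  set K : ℝ := (q:ℝ) + 1 with hK
  have ha0 : 0 < a := by positivity
  have ha2 : a^2 = 4 * q := by
    rw [ha, mul_pow, Real.sq_sqrt hq0.le]
    norm_num
  have hD : K^2 - a^2 = ((q:ℝ) - 1)^2 := by
    rw [ha2, hK]
    ring
  have haK : a^2 < K^2 := by nlinarith
  obtain ⟨C, hC⟩ := stripDensity_edge ha0 haK
  obtain ⟨C', hC'0, hC'⟩ := fourier_asymptotics_of_strip ha0 (continuousOn_stripDensity haK)
    (differentiableOn_stripDensity haK) (fun y _ => by
      rw [← stripDensity_neg_conj (by simp [ha0.le])]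
      congr 1
      simp [add_comm]) hC
  refine ⟨C' / π, 1, by positivity, one_pos, fun t ht => ?_⟩
  have ht0 : 0 < t := by linarith
  have hint : (∫ l in (-a)..a, Complex.exp (Complex.I * t * l) * (Psi q l : ℂ))
      = ∫ l in (-a)..a, Complex.exp (Complex.I * t * l) * stripDensity a K l := by
    refine intervalIntegral.integral_congr fun l hl => ?_
    rw [Set.uIcc_of_le (by linarith)] at hl
    have h0 : 0 ≤ a^2 - l^2 := by nlinarith [hl.1, hl.2]
    have h1 : (a:ℂ)^2 - (l:ℂ)^2 = ((a^2 - l^2 : ℝ) : ℂ) := by push_cast; rfl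
    simp only [stripDensity]
    rw [h1, ofReal_cpow_half h0, Psi, ← ha2]
    push_cast [hK]
    rfl
  have hroot : √(2 * a) = 2 * (q:ℝ) ^ ((1:ℝ)/4) := by
    have h1 : ((q:ℝ) ^ ((1:ℝ)/4))^2 = √q := by
      rw [Real.sqrt_eq_rpow, ← Real.rpow_natCast, ← Real.rpow_mul hq0.le]
      norm_num
    rw [Real.sqrt_eq_iff_mul_self_eq (by positivity) (by positivity), ha]
    linear_combination -4 * h1
  have him : (Complex.exp (Complex.I * t * a) * ((K * √(2 * a) / (2 * (K^2 - a^2)) : ℝ)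
      * Complex.exp (-(π / 4 * Complex.I)))).im
      = K * √(2 * a) / (2 * (K^2 - a^2)) * Real.sin (a * t - π / 4) := by
    rw [mul_left_comm, ← Complex.exp_add, Complex.im_ofReal_mul,
      show Complex.I * t * a + -(π / 4 * Complex.I) = ((a * t - π / 4 : ℝ) : ℂ) * Complex.I by
        push_cast; ring, Complex.exp_ofReal_mul_I_im]
  have key := hC' t ht0
  rw [him] at key
  rw [hint]
  have hmain : 1/(√π * t ^ ((3:ℝ)/2)) * Real.sin (a * t - π/4)
        * ((q:ℝ) ^ ((1:ℝ)/4) * K / ((q:ℝ)-1)^2)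
      = 1 / π * (2 * (K * √(2 * a) / (2 * (K^2 - a^2)) * Real.sin (a * t - π / 4))
        * (√π / 2 / t ^ ((3:ℝ)/2))) := by
    have h1 : 1 / √π = √π / π := by
      rw [div_eq_div_iff (by positivity) (by positivity), one_mul,
        Real.mul_self_sqrt Real.pi_pos.le]
    rw [hroot, hD, ← one_div_mul_one_div, h1]
    generalize ((q:ℝ) - 1)^2 = D
    ring
  rw [hmain, Complex.ofReal_mul, show ((1 / π : ℝ) : ℂ) = 1 / (π : ℂ) by push_cast; rfl,
    ← mul_sub, norm_mul]
  have h2 : ‖(1 / (π : ℂ))‖ = 1 / π := by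
    rw [norm_div, Complex.norm_real, norm_one, Real.norm_of_nonneg Real.pi_pos.le]
  rw [h2]
  calc _ ≤ 1 / π * (C' / t^2) := by gcongr
    _ = C' / π / t^2 := by ring
end

section
/- Let q ≥ 2 be an integer, Ψ(λ) = (q+1)√(4q − λ²)/(2((q+1)² − λ²)) on [−2√q, 2√q], and let Φ_n be the spherical function. There exist constants C > 0 and t₀ > 0, depending only on q, such that for every integer n ≥ 0 and every t ≥ t₀: if n is even, then |(1/π)∫_{−2√q}^{2√q} e^{itλ} Ψ(λ) Φ_n(λ) dλ − (1/(√π t^{3/2})) sin(2√q t − π/4) · q^{−n/2+1/4}(2+(n+1)(q−1))/(q−1)²| ≤ C t^{−2}, and if n is odd, then |(1/π)∫_{−2√q}^{2√q} e^{itλ} Ψ(λ) Φ_n(λ) dλ − (−i/(√π t^{3/2})) sin(2√q t + π/4) · q^{−n/2+1/4}(2+(n+1)(q−1))/(q−1)²| ≤ C t^{−2}. -/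
open MeasureTheory intervalIntegral Real

/-- The spherical function of the `(q+1)`-regular tree:
`Φ_n(λ) = q^{−n/2}( (2/(q+1)) T_n(λ/(2√q)) + ((q−1)/(q+1)) U_n(λ/(2√q)) )`,
`T_n, U_n` being the Chebyshev polynomials of the first and second kinds. -/
noncomputable def Phi (q n : ℕ) (l : ℝ) : ℝ :=
  (q:ℝ) ^ (-(n:ℝ)/2) *
    ((2/((q:ℝ)+1)) * (Polynomial.Chebyshev.T ℝ (n:ℤ)).eval (l/(2*Real.sqrt q))
      + (((q:ℝ)-1)/((q:ℝ)+1)) * (Polynomial.Chebyshev.U ℝ (n:ℤ)).eval (l/(2*Real.sqrt q)))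

open Filter Topology Set

/-- The tail of a complex Gaussian integral is bounded uniformly up to the imaginary axis. -/
lemma norm_integral_Ioi_one_gaussian_le {b : ℂ} (hb : 0 < b.re) :
    ‖∫ x : ℝ in Ioi 1, Complex.exp (-b * (x : ℂ) ^ 2)‖ ≤ 1 / ‖b‖ := by
  have hb0 : b ≠ 0 := by rintro rfl; simp at hb
  have hbn : 0 < ‖b‖ := norm_pos_iff.2 hb0
  have hexp : ∀ x : ℝ, ‖Complex.exp (-b * (x : ℂ) ^ 2)‖ ≤ 1 := fun x => by
    rw [norm_cexp_neg_mul_sq]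
    exact Real.exp_le_one_iff.2 (by nlinarith [sq_nonneg x])
  have hdom : IntegrableOn (fun x : ℝ => 1 / (2 * ‖b‖) * x ^ (-2 : ℝ)) (Ioi 1) :=
    (integrableOn_Ioi_rpow_of_lt (by norm_num) one_pos).const_mul _
  have hbound : ∀ x ∈ Ioi (1 : ℝ),
      ‖Complex.exp (-b * (x : ℂ) ^ 2) / (2 * b * (x : ℂ) ^ 2)‖
        ≤ 1 / (2 * ‖b‖) * x ^ (-2 : ℝ) := fun x hx => by
    have hx0 : 0 < x := one_pos.trans hx
    rw [norm_div, norm_mul, norm_mul, norm_pow, Complex.norm_real, Real.norm_eq_abs, abs_of_pos hx0,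
      Complex.norm_ofNat, Real.rpow_neg hx0.le, Real.rpow_two, ← one_div, div_mul_div_comm,
      one_mul]
    gcongr
    exact hexp x
  have hmeas : IntegrableOn (fun x : ℝ => Complex.exp (-b * (x : ℂ) ^ 2) / (2 * b * (x : ℂ) ^ 2))
      (Ioi 1) := by
    refine hdom.mono' ?_ ((ae_restrict_mem measurableSet_Ioi).mono hbound)
    exact (by fun_prop : Measurable _).aestronglyMeasurable
  have hgauss : IntegrableOn (fun x : ℝ => Complex.exp (-b * (x : ℂ) ^ 2)) (Ioi 1) :=
    (integrable_cexp_neg_mul_sq hb).integrableOn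
  have hderiv : ∀ x ∈ Ici (1 : ℝ), HasDerivAt
      (fun x : ℝ => -Complex.exp (-b * (x : ℂ) ^ 2) / (2 * b * (x : ℂ)))
      (Complex.exp (-b * (x : ℂ) ^ 2) + Complex.exp (-b * (x : ℂ) ^ 2) / (2 * b * (x : ℂ) ^ 2))
      x := fun x hx => by
    have hx0 : (x : ℂ) ≠ 0 := by
      exact_mod_cast (one_pos.trans_le (show (1 : ℝ) ≤ x from hx)).ne'
    have h1 : HasDerivAt (fun z : ℂ => -Complex.exp (-b * z ^ 2) / (2 * b * z))
        (Complex.exp (-b * (x : ℂ) ^ 2) + Complex.exp (-b * (x : ℂ) ^ 2) / (2 * b * (x : ℂ) ^ 2))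
        (x : ℂ) := by
      have h2 := ((((hasDerivAt_id (x : ℂ)).pow 2).const_mul (-b)).cexp.neg).div
        ((hasDerivAt_id (x : ℂ)).const_mul (2 * b)) (by simp [hb0, hx0])
      refine h2.congr_deriv ?_
      simp
      field_simp
    exact h1.comp_ofReal
  have hlim : Tendsto (fun x : ℝ => -Complex.exp (-b * (x : ℂ) ^ 2) / (2 * b * (x : ℂ))) atTop
      (𝓝 0) := by
    rw [tendsto_zero_iff_norm_tendsto_zero]
    refine squeeze_zero' (Eventually.of_forall fun _ => norm_nonneg _)
      ((eventually_gt_atTop 0).mono fun x hx => ?_)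
      (by simpa only [mul_zero] using
        (tendsto_inv_atTop_zero (𝕜 := ℝ)).const_mul (1 / (2 * ‖b‖)))
    rw [norm_div, norm_neg, norm_mul, norm_mul, Complex.norm_real, Real.norm_eq_abs, abs_of_pos hx,
      Complex.norm_ofNat, ← one_div, div_mul_div_comm, one_mul]
    gcongr
    exact hexp x
  have key := integral_Ioi_of_hasDerivAt_of_tendsto' hderiv (hgauss.add hmeas) hlim
  rw [integral_add hgauss hmeas] at key
  rw [eq_sub_of_add_eq key]
  refine (norm_sub_le _ _).trans ?_
  have h1 : ‖(0 : ℂ) - -Complex.exp (-b * ((1 : ℝ) : ℂ) ^ 2) / (2 * b * ((1 : ℝ) : ℂ))‖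
      ≤ 1 / (2 * ‖b‖) := by
    rw [zero_sub, norm_neg, norm_div, norm_neg, norm_mul, norm_mul, Complex.norm_ofNat]
    simp only [Complex.ofReal_one, norm_one, mul_one]
    gcongr
    simpa using hexp 1
  have h2 : ‖∫ x : ℝ in Ioi 1, Complex.exp (-b * (x : ℂ) ^ 2) / (2 * b * (x : ℂ) ^ 2)‖
      ≤ 1 / (2 * ‖b‖) := by
    refine (norm_integral_le_of_norm_le hdom
      ((ae_restrict_mem measurableSet_Ioi).mono hbound)).trans ?_
    rw [MeasureTheory.integral_const_mul, integral_Ioi_rpow_of_lt (by norm_num) one_pos]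
    norm_num
  calc _ ≤ 1 / (2 * ‖b‖) + 1 / (2 * ‖b‖) := add_le_add h1 h2
    _ = 1 / ‖b‖ := by field_simp; norm_num

lemma norm_integral_gaussian_sub_le {b : ℂ} (hb : 0 < b.re) :
    ‖(∫ x : ℝ in (0 : ℝ)..1, Complex.exp (-b * (x : ℂ) ^ 2)) - (π / b) ^ (1 / 2 : ℂ) / 2‖
      ≤ 1 / ‖b‖ := by
  have hint := integrable_cexp_neg_mul_sq hb
  rw [← integral_gaussian_complex_Ioi hb,
    ← intervalIntegral.integral_interval_add_Ioi (a := 0) (b := 1) hint.integrableOn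
      hint.integrableOn, sub_add_cancel_left, norm_neg]
  exact norm_integral_Ioi_one_gaussian_le hb

/-- Truncated Fresnel integral. -/
lemma norm_fresnel_sub_le {s : ℝ} (hs : 0 < s) :
    ‖(∫ x : ℝ in (0 : ℝ)..1, Complex.exp (-(2 * s * Complex.I) * (x : ℂ) ^ 2))
      - √(π / (2 * s)) * Complex.exp (-(π / 4 * Complex.I)) / 2‖ ≤ 1 / (2 * s) := by
  set b₀ : ℂ := 2 * s * Complex.I with hb₀
  have hval : ((√(π / (2 * s)) : ℝ) : ℂ) * Complex.exp (-(π / 4 * Complex.I))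
      = (π / b₀) ^ (1 / 2 : ℂ) := by
    have hpos : 0 < π / (2 * s) := by positivity
    have h1 : (π / b₀ : ℂ) =
        ((π / (2 * s) : ℝ) : ℂ) * Complex.exp (((-(π / 2) : ℝ) : ℂ) * Complex.I) := by
      have : Complex.exp (((-(π / 2) : ℝ) : ℂ) * Complex.I) = -Complex.I := by
        rw [Complex.exp_mul_I, ← Complex.ofReal_cos, ← Complex.ofReal_sin]
        simp
      rw [this, hb₀]
      push_cast
      rw [← div_div, div_eq_mul_inv _ Complex.I, Complex.inv_I]
    have h2 : Complex.log (π / b₀) =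
        (Real.log (π / (2 * s)) : ℝ) + ((-(π / 2) : ℝ) : ℂ) * Complex.I := by
      rw [h1, ← Complex.exp_log (x := ((π / (2 * s) : ℝ) : ℂ)) (by exact_mod_cast hpos.ne'),
        ← Complex.exp_add, ← Complex.ofReal_log hpos.le, Complex.log_exp]
      · simp; linarith [pi_pos]
      · simp; linarith [pi_pos]
    rw [Complex.cpow_def_of_ne_zero, h2, add_mul, Complex.exp_add]
    · congr 1
      · rw [Real.sqrt_eq_rpow, Real.rpow_def_of_pos hpos]
        push_cast
        rfl
      · congr 1
        push_cast
        ring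
    · rw [h1]
      exact mul_ne_zero (by exact_mod_cast hpos.ne') (Complex.exp_ne_zero _)
  have hb₀n : ‖b₀‖ = 2 * s := by
    rw [hb₀]; simp [abs_of_pos hs]
  have hb₀0 : b₀ ≠ 0 := by
    rw [← norm_pos_iff, hb₀n]; positivity
  rw [hval, ← hb₀n]
  have hslit : (π / b₀ : ℂ) ∈ Complex.slitPlane := by
    rw [Complex.mem_slitPlane_iff]
    right
    have : (π / b₀ : ℂ) = ((-(π / (2 * s)) : ℝ) : ℂ) * Complex.I := by
      rw [hb₀]
      push_cast
      rw [← div_div, div_eq_mul_inv _ Complex.I, Complex.inv_I]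
      ring
    rw [this, Complex.im_ofReal_mul, Complex.I_im, mul_one]
    exact (neg_neg_of_pos (by positivity)).ne
  have hpath : Tendsto (fun ε : ℝ => b₀ + ε) (𝓝[>] 0) (𝓝 b₀) := by
    have : ContinuousAt (fun ε : ℝ => b₀ + (ε : ℂ)) 0 := by fun_prop
    simpa using this.tendsto.mono_left nhdsWithin_le_nhds
  have hlhs : ContinuousAt (fun b : ℂ =>
      ‖(∫ x : ℝ in (0 : ℝ)..1, Complex.exp (-b * (x : ℂ) ^ 2)) - (π / b) ^ (1 / 2 : ℂ) / 2‖) b₀ := by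
    have h1 : Continuous fun b : ℂ => ∫ x : ℝ in (0 : ℝ)..1, Complex.exp (-b * (x : ℂ) ^ 2) :=
      intervalIntegral.continuous_parametric_intervalIntegral_of_continuous' (by fun_prop) 0 1
    have h2 : ContinuousAt (fun b : ℂ => (π / b : ℂ) ^ (1 / 2 : ℂ)) b₀ :=
      (continuousAt_const.div continuousAt_id hb₀0).cpow continuousAt_const hslit
    exact (h1.continuousAt.sub (h2.div_const 2)).norm
  have hrhs : ContinuousAt (fun b : ℂ => 1 / ‖b‖) b₀ :=
    continuousAt_const.div continuous_norm.continuousAt (norm_ne_zero_iff.2 hb₀0)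
  refine le_of_tendsto_of_tendsto (hlhs.tendsto.comp hpath) (hrhs.tendsto.comp hpath)
    (eventually_mem_nhdsWithin.mono fun ε hε => norm_integral_gaussian_sub_le ?_)
  simpa [hb₀] using hε

/-- Integration by parts against the phase `exp (i s cos θ)`. -/
lemma integral_phase_mul_sin {V V' : ℝ → ℝ} {s : ℝ} (hs : s ≠ 0)
    (hV : ∀ x ∈ Icc 0 π, HasDerivAt V (V' x) x) (hV' : ContinuousOn V' (Icc 0 π)) :
    ∫ x in (0 : ℝ)..π, Complex.exp (Complex.I * s * Real.cos x) * ((Real.sin x * V x : ℝ) : ℂ)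
      = 1 / (Complex.I * s) * (Complex.exp (Complex.I * s) * V 0
        - Complex.exp (-(Complex.I * s)) * V π
        + ∫ x in (0 : ℝ)..π, Complex.exp (Complex.I * s * Real.cos x) * (V' x : ℂ)) := by
  have hI : Complex.I * (s : ℂ) ≠ 0 := mul_ne_zero Complex.I_ne_zero (by exact_mod_cast hs)
  have hu : uIcc 0 π = Icc 0 π := uIcc_of_le pi_pos.le
  have hVc : ContinuousOn V (Icc 0 π) := fun x hx => (hV x hx).continuousAt.continuousWithinAt
  have hphase : Continuous fun x : ℝ => Complex.exp (Complex.I * s * Real.cos x) := by fun_prop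
  have hi1 : IntervalIntegrable (fun x => Complex.exp (Complex.I * s * Real.cos x) * (V' x : ℂ))
      volume 0 π :=
    (hphase.continuousOn.mul (Complex.continuous_ofReal.comp_continuousOn
      (hu ▸ hV'))).intervalIntegrable
  have hi2 : IntervalIntegrable
      (fun x => Complex.exp (Complex.I * s * Real.cos x) * ((Real.sin x * V x : ℝ) : ℂ))
      volume 0 π :=
    (hphase.continuousOn.mul (Complex.continuous_ofReal.comp_continuousOn
      (Real.continuous_sin.continuousOn.mul (hu ▸ hVc)))).intervalIntegrable
  have hd : ∀ x ∈ uIcc 0 π, HasDerivAt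
      (fun x => Complex.exp (Complex.I * s * Real.cos x) * (V x : ℂ))
      (Complex.exp (Complex.I * s * Real.cos x) * (V' x : ℂ)
        - Complex.I * s *
          (Complex.exp (Complex.I * s * Real.cos x) * ((Real.sin x * V x : ℝ) : ℂ))) x := by
    intro x hx
    rw [hu] at hx
    have h1 := ((((Real.hasDerivAt_cos x).ofReal_comp).const_mul (Complex.I * s)).cexp).mul
      (hV x hx).ofReal_comp
    refine h1.congr_deriv ?_
    push_cast
    ring
  have key := intervalIntegral.integral_eq_sub_of_hasDerivAt hd (hi1.sub (hi2.const_mul _))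
  rw [intervalIntegral.integral_sub hi1 (hi2.const_mul _),
    intervalIntegral.integral_const_mul] at key
  simp only [Real.cos_zero, Real.cos_pi, Complex.ofReal_one, Complex.ofReal_neg, mul_one,
    mul_neg] at key
  rw [one_div, eq_inv_mul_iff_mul_eq₀ hI]
  linear_combination -key

lemma norm_phase (s x : ℝ) : ‖Complex.exp (Complex.I * s * x)‖ = 1 := by
  rw [show Complex.I * s * x = ((s * x : ℝ) : ℂ) * Complex.I by push_cast; ring]
  exact Complex.norm_exp_ofReal_mul_I _

lemma norm_integral_phase_mul_sin_le {V V' : ℝ → ℝ} {s B : ℝ} (hs : 0 < s)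
    (hV : ∀ x ∈ Icc 0 π, HasDerivAt V (V' x) x) (hV' : ContinuousOn V' (Icc 0 π))
    (hB : ∀ x ∈ Icc 0 π, |V x| ≤ B) (hB' : ∀ x ∈ Icc 0 π, |V' x| ≤ B) :
    ‖∫ x in (0 : ℝ)..π,
      Complex.exp (Complex.I * s * Real.cos x) * ((Real.sin x * V x : ℝ) : ℂ)‖ ≤ 6 * B / s := by
  have h0 : (0 : ℝ) ∈ Icc 0 π := ⟨le_rfl, pi_pos.le⟩
  have hB0 : 0 ≤ B := (abs_nonneg _).trans (hB 0 h0)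
  have h1 : ‖Complex.exp (Complex.I * s) * (V 0 : ℂ)‖ ≤ B := by
    have := norm_phase s 1
    rw [Complex.ofReal_one, mul_one] at this
    rw [norm_mul, this, one_mul, Complex.norm_real]
    exact hB 0 h0
  have h2 : ‖Complex.exp (-(Complex.I * s)) * (V π : ℂ)‖ ≤ B := by
    have := norm_phase s (-1)
    rw [Complex.ofReal_neg, Complex.ofReal_one, mul_neg_one] at this
    rw [norm_mul, this, one_mul, Complex.norm_real]
    exact hB π ⟨pi_pos.le, le_rfl⟩
  have h3 : ‖∫ x in (0 : ℝ)..π, Complex.exp (Complex.I * s * Real.cos x) * (V' x : ℂ)‖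
      ≤ B * π := by
    have := intervalIntegral.norm_integral_le_of_norm_le_const (a := 0) (b := π) (C := B)
      (f := fun x : ℝ => Complex.exp (Complex.I * s * Real.cos x) * (V' x : ℂ)) fun x hx => by
        rw [uIoc_of_le pi_pos.le] at hx
        rw [norm_mul, norm_phase, one_mul, Complex.norm_real]
        exact hB' x ⟨hx.1.le, hx.2⟩
    rwa [sub_zero, abs_of_pos pi_pos] at this
  rw [integral_phase_mul_sin hs.ne' hV hV', norm_mul, norm_div, norm_one, norm_mul, Complex.norm_I,
    one_mul, Complex.norm_real, Real.norm_eq_abs, abs_of_pos hs, div_mul_eq_mul_div, one_mul]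
  gcongr
  refine (norm_add_le _ _).trans ?_
  have := norm_sub_le (Complex.exp (Complex.I * s) * (V 0 : ℂ))
    (Complex.exp (-(Complex.I * s)) * (V π : ℂ))
  nlinarith [pi_lt_four]

lemma integral_phase_mul_cos_half (s : ℝ) :
    ∫ x in (0 : ℝ)..π, Complex.exp (Complex.I * s * Real.cos x) * (Real.cos (x / 2) : ℂ)
      = 2 * Complex.exp (Complex.I * s) *
        ∫ x : ℝ in (0 : ℝ)..1, Complex.exp (-(2 * s * Complex.I) * (x : ℂ) ^ 2) := by
  have h := intervalIntegral.integral_deriv_smul_comp (a := 0) (b := π)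
    (f := fun x => Real.sin (x / 2)) (f' := fun x => Real.cos (x / 2) * (1 / 2))
    (g := fun x : ℝ => Complex.exp (-(2 * s * Complex.I) * (x : ℂ) ^ 2))
    (fun x _ => ((hasDerivAt_id x).div_const 2).sin) (by fun_prop) (by fun_prop)
  simp only [zero_div, Real.sin_zero, Real.sin_pi_div_two] at h
  rw [← h, ← intervalIntegral.integral_const_mul]
  refine intervalIntegral.integral_congr fun x _ => ?_
  have hc : Real.cos x = 1 - 2 * Real.sin (x / 2) ^ 2 := by
    have := Real.cos_two_mul (x / 2)
    rw [mul_div_cancel₀ x two_ne_zero] at this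
    linarith [Real.sin_sq_add_cos_sq (x / 2)]
  have he : Complex.exp (Complex.I * s * Real.cos x) = Complex.exp (Complex.I * s) *
      Complex.exp (-(2 * s * Complex.I) * (Real.sin (x / 2) : ℂ) ^ 2) := by
    rw [← Complex.exp_add, hc]
    push_cast
    ring_nf
  simp only [Function.comp_apply, Complex.real_smul, he]
  push_cast
  ring

lemma integral_phase_mul_sin_half (s : ℝ) :
    ∫ x in (0 : ℝ)..π, Complex.exp (Complex.I * s * Real.cos x) * (Real.sin (x / 2) : ℂ)
      = (starRingEnd ℂ) (∫ x in (0 : ℝ)..π,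
        Complex.exp (Complex.I * s * Real.cos x) * (Real.cos (x / 2) : ℂ)) := by
  rw [← intervalIntegral_conj]
  have := intervalIntegral.integral_comp_sub_left (a := 0) (b := π) (fun x : ℝ =>
    Complex.exp (Complex.I * s * Real.cos x) * (Real.sin (x / 2) : ℂ)) π
  rw [sub_self, sub_zero] at this
  rw [← this]
  refine intervalIntegral.integral_congr fun x _ => ?_
  simp only [Real.cos_pi_sub, sub_div, Real.sin_pi_div_two_sub, map_mul, ← Complex.exp_conj,
    Complex.conj_I, Complex.conj_ofReal, Complex.ofReal_neg, mul_neg, neg_mul]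

lemma norm_integral_phase_mul_cos_half_sub_le {s : ℝ} (hs : 0 < s) :
    ‖(∫ x in (0 : ℝ)..π, Complex.exp (Complex.I * s * Real.cos x) * (Real.cos (x / 2) : ℂ))
      - √(π / (2 * s)) * Complex.exp ((s - π / 4 : ℝ) * Complex.I)‖ ≤ 1 / s := by
  have h : Complex.exp ((s - π / 4 : ℝ) * Complex.I)
      = Complex.exp (Complex.I * s) * Complex.exp (-(π / 4 * Complex.I)) := by
    rw [← Complex.exp_add]
    push_cast
    ring_nf
  rw [integral_phase_mul_cos_half, h, show ∀ A B c E : ℂ, 2 * E * A - c * (E * B)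
    = 2 * E * (A - c * B / 2) from fun A B c E => by ring, norm_mul, norm_mul]
  have := norm_phase s 1
  rw [Complex.ofReal_one, mul_one] at this
  rw [this, Complex.norm_ofNat, mul_one]
  calc _ ≤ 2 * (1 / (2 * s)) := by gcongr; exact norm_fresnel_sub_le hs
    _ = 1 / s := by field_simp

lemma one_le_one_add_cos_half_add_sin_half {x : ℝ} (hx : x ∈ Icc 0 π) :
    1 ≤ 1 + Real.cos (x / 2) + Real.sin (x / 2) := by
  have h1 : 0 ≤ Real.cos (x / 2) :=
    Real.cos_nonneg_of_mem_Icc ⟨by linarith [hx.1, pi_pos], by linarith [hx.2]⟩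
  have h2 : 0 ≤ Real.sin (x / 2) :=
    Real.sin_nonneg_of_nonneg_of_le_pi (by linarith [hx.1]) (by linarith [hx.2, pi_pos])
  linarith

/-- Stationary phase for a function `f` equal to `1` at `0` and to `b` at `π`, in the form of an
explicit factorisation of `f (θ) - (cos (θ/2) + b sin (θ/2))`. -/
lemma exists_norm_integral_phase_sub_le {f V V' : ℝ → ℝ} {b : ℝ} (hf : Continuous f)
    (hV : ∀ x, HasDerivAt V (V' x) x) (hV' : Continuous V')
    (hfV : ∀ x, (f x - (Real.cos (x / 2) + b * Real.sin (x / 2)))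
      * (1 + Real.cos (x / 2) + Real.sin (x / 2)) = Real.sin x * V x) :
    ∃ C : ℝ, ∀ s : ℝ, 0 < s →
      ‖(∫ x in (0 : ℝ)..π, Complex.exp (Complex.I * s * Real.cos x) * (f x : ℂ))
        - √(π / (2 * s)) * (Complex.exp ((s - π / 4 : ℝ) * Complex.I)
          + b * (starRingEnd ℂ) (Complex.exp ((s - π / 4 : ℝ) * Complex.I)))‖ ≤ C / s := by
  set D : ℝ → ℝ := fun x => 1 + Real.cos (x / 2) + Real.sin (x / 2) with hD
  set D' : ℝ → ℝ := fun x => -Real.sin (x / 2) * (1 / 2) + Real.cos (x / 2) * (1 / 2) with hD'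
  have hDd : ∀ x, HasDerivAt D (D' x) x := fun x =>
    ((((hasDerivAt_id x).div_const 2).cos).const_add 1).add ((hasDerivAt_id x).div_const 2).sin
  have hD0 : ∀ x ∈ Icc 0 π, D x ≠ 0 := fun x hx =>
    (one_pos.trans_le (one_le_one_add_cos_half_add_sin_half hx)).ne'
  have hVc : Continuous V := continuous_iff_continuousAt.2 fun x => (hV x).continuousAt
  have hDc : Continuous D := by fun_prop
  have hRd : ∀ x ∈ Icc 0 π, HasDerivAt (fun x => V x / D x)
      ((V' x * D x - V x * D' x) / D x ^ 2) x := fun x hx => (hV x).div (hDd x) (hD0 x hx)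
  have hRc : ContinuousOn (fun x => V x / D x) (Icc 0 π) :=
    hVc.continuousOn.div hDc.continuousOn hD0
  have hRc' : ContinuousOn (fun x => (V' x * D x - V x * D' x) / D x ^ 2) (Icc 0 π) :=
    (by fun_prop : Continuous fun x => V' x * D x - V x * D' x).continuousOn.div
      (hDc.pow 2).continuousOn fun x hx => pow_ne_zero 2 (hD0 x hx)
  obtain ⟨B₁, hB₁⟩ := isCompact_Icc.exists_bound_of_continuousOn hRc
  obtain ⟨B₂, hB₂⟩ := isCompact_Icc.exists_bound_of_continuousOn hRc'
  refine ⟨6 * max B₁ B₂ + (1 + |b|), fun s hs => ?_⟩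
  have hphase : Continuous fun x : ℝ => Complex.exp (Complex.I * s * Real.cos x) := by fun_prop
  have h1 := norm_integral_phase_mul_sin_le hs hRd hRc'
    (fun x hx => (hB₁ x hx).trans (le_max_left _ _))
    (fun x hx => (hB₂ x hx).trans (le_max_right _ _))
  have h2 := norm_integral_phase_mul_cos_half_sub_le hs
  have h3 := integral_phase_mul_sin_half s
  set A := ∫ x in (0 : ℝ)..π, Complex.exp (Complex.I * s * Real.cos x) * (Real.cos (x / 2) : ℂ)
  set M : ℂ := √(π / (2 * s)) * Complex.exp ((s - π / 4 : ℝ) * Complex.I) with hM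
  have h4 : ‖(starRingEnd ℂ) A - (starRingEnd ℂ) M‖ ≤ 1 / s := by
    rwa [← map_sub, RCLike.norm_conj]
  have hsplit : ∫ x in (0 : ℝ)..π, Complex.exp (Complex.I * s * Real.cos x) *
        ((Real.sin x * (V x / D x) : ℝ) : ℂ)
      = (∫ x in (0 : ℝ)..π, Complex.exp (Complex.I * s * Real.cos x) * (f x : ℂ))
        - (A + b * (starRingEnd ℂ) A) := by
    rw [← h3, ← intervalIntegral.integral_const_mul, ← intervalIntegral.integral_add,
      ← intervalIntegral.integral_sub]
    · refine intervalIntegral.integral_congr fun x hx => ?_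
      rw [uIcc_of_le pi_pos.le] at hx
      have : Real.sin x * (V x / D x) = f x - (Real.cos (x / 2) + b * Real.sin (x / 2)) := by
        rw [← mul_div_assoc, ← hfV x]
        exact mul_div_cancel_right₀ _ (hD0 x hx)
      simp only [this]
      push_cast
      ring
    all_goals exact Continuous.intervalIntegrable (by fun_prop) _ _
  rw [hsplit] at h1
  have hfin : √(π / (2 * s)) * (Complex.exp ((s - π / 4 : ℝ) * Complex.I)
      + b * (starRingEnd ℂ) (Complex.exp ((s - π / 4 : ℝ) * Complex.I)))
      = M + b * (starRingEnd ℂ) M := by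
    rw [hM, map_mul, Complex.conj_ofReal]
    ring
  rw [hfin]
  set J := ∫ x in (0 : ℝ)..π, Complex.exp (Complex.I * s * Real.cos x) * (f x : ℂ)
  calc ‖J - (M + b * (starRingEnd ℂ) M)‖
      = ‖(J - (A + b * (starRingEnd ℂ) A)) + ((A - M)
        + b * ((starRingEnd ℂ) A - (starRingEnd ℂ) M))‖ := by congr 1; ring
    _ ≤ 6 * max B₁ B₂ / s + (1 / s + |b| * (1 / s)) := by
      refine (norm_add_le _ _).trans (add_le_add h1 ((norm_add_le _ _).trans (add_le_add h2 ?_)))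
      rw [norm_mul, Complex.norm_real, Real.norm_eq_abs]
      gcongr
    _ = _ := by ring

/-- Asymptotics of `π J₀(s)`. -/
lemma exists_norm_integral_phase_sub_cos_le : ∃ C : ℝ, ∀ s : ℝ, 0 < s →
    ‖(∫ x in (0 : ℝ)..π, Complex.exp (Complex.I * s * Real.cos x))
      - ((2 * √(π / (2 * s)) * Real.cos (s - π / 4) : ℝ) : ℂ)‖ ≤ C / s := by
  obtain ⟨C, hC⟩ := exists_norm_integral_phase_sub_le (f := fun _ => 1) (V := fun _ => -1)
    (V' := fun _ => 0) (b := 1) continuous_const (fun x => hasDerivAt_const x _) continuous_const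
    fun x => by
      have := Real.sin_two_mul (x / 2)
      rw [mul_div_cancel₀ x two_ne_zero] at this
      linear_combination -Real.sin_sq_add_cos_sq (x / 2) + this
  refine ⟨C, fun s hs => ?_⟩
  have h := hC s hs
  simp only [Complex.ofReal_one, mul_one, one_mul] at h
  rw [Complex.add_conj, Complex.exp_ofReal_mul_I_re] at h
  convert h using 3
  push_cast
  ring

/-- Asymptotics of `i π J₁(s)`. -/
lemma exists_norm_integral_phase_mul_cos_sub_le : ∃ C : ℝ, ∀ s : ℝ, 0 < s →
    ‖(∫ x in (0 : ℝ)..π, Complex.exp (Complex.I * s * Real.cos x) * (Real.cos x : ℂ))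
      - Complex.I * ((2 * √(π / (2 * s)) * Real.sin (s - π / 4) : ℝ) : ℂ)‖ ≤ C / s := by
  obtain ⟨C, hC⟩ := exists_norm_integral_phase_sub_le (f := Real.cos)
    (V := fun x => Real.cos (x / 2) - Real.sin (x / 2))
    (V' := fun x => -Real.sin (x / 2) * (1 / 2) - Real.cos (x / 2) * (1 / 2)) (b := -1)
    Real.continuous_cos
    (fun x => (((hasDerivAt_id x).div_const 2).cos).sub ((hasDerivAt_id x).div_const 2).sin)
    (by fun_prop) fun x => by
      have h1 := Real.sin_two_mul (x / 2)
      have h2 := Real.cos_two_mul' (x / 2)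
      rw [mul_div_cancel₀ x two_ne_zero] at h1 h2
      have h3 := Real.sin_sq_add_cos_sq (x / 2)
      rw [h1, h2]
      linear_combination (Real.cos (x / 2) - Real.sin (x / 2)) * h3
  refine ⟨C, fun s hs => ?_⟩
  have h := hC s hs
  simp only [Complex.ofReal_one, Complex.ofReal_neg, neg_mul, one_mul, ← sub_eq_add_neg] at h
  rw [Complex.sub_conj, Complex.exp_ofReal_mul_I_im] at h
  convert h using 3
  push_cast
  ring

/-- A sequence of `C¹` functions which, together with their derivatives, are bounded on `ℝ` by a
polynomial in the index. -/
def C1PolyBounded (f : ℕ → ℝ → ℝ) : Prop :=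
  ∃ (f' : ℕ → ℝ → ℝ) (C : ℝ) (k : ℕ), 0 ≤ C ∧ ∀ n, Continuous (f' n) ∧
    ∀ x, HasDerivAt (f n) (f' n x) x ∧ |f n x| ≤ C * ((n : ℝ) + 1) ^ k ∧
      |f' n x| ≤ C * ((n : ℝ) + 1) ^ k

namespace C1PolyBounded

lemma add {f g : ℕ → ℝ → ℝ} (hf : C1PolyBounded f) (hg : C1PolyBounded g) :
    C1PolyBounded fun n x => f n x + g n x := by
  obtain ⟨f', C, k, hC, hf⟩ := hf
  obtain ⟨g', D, l, hD, hg⟩ := hg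
  refine ⟨fun n x => f' n x + g' n x, C + D, k + l, add_nonneg hC hD, fun n =>
    ⟨(hf n).1.add (hg n).1, fun x => ?_⟩⟩
  obtain ⟨hf1, hf2, hf3⟩ := (hf n).2 x
  obtain ⟨hg1, hg2, hg3⟩ := (hg n).2 x
  have h1 : (1 : ℝ) ≤ (n : ℝ) + 1 := by linarith [n.cast_nonneg (α := ℝ)]
  have hk : C * ((n : ℝ) + 1) ^ k ≤ C * ((n : ℝ) + 1) ^ (k + l) := by gcongr; omega
  have hl : D * ((n : ℝ) + 1) ^ l ≤ D * ((n : ℝ) + 1) ^ (k + l) := by gcongr; omega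
  exact ⟨hf1.add hg1, (abs_add_le _ _).trans (by linarith), (abs_add_le _ _).trans (by linarith)⟩

lemma mul {f g : ℕ → ℝ → ℝ} (hf : C1PolyBounded f) (hg : C1PolyBounded g) :
    C1PolyBounded fun n x => f n x * g n x := by
  obtain ⟨f', C, k, hC, hf⟩ := hf
  obtain ⟨g', D, l, hD, hg⟩ := hg
  have hfc : ∀ n, Continuous (f n) := fun n =>
    continuous_iff_continuousAt.2 fun x => ((hf n).2 x).1.continuousAt
  have hgc : ∀ n, Continuous (g n) := fun n =>
    continuous_iff_continuousAt.2 fun x => ((hg n).2 x).1.continuousAt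
  refine ⟨fun n x => f' n x * g n x + f n x * g' n x, 2 * (C * D), k + l, by positivity, fun n =>
    ⟨((hf n).1.mul (hgc n)).add ((hfc n).mul (hg n).1), fun x => ?_⟩⟩
  obtain ⟨hf1, hf2, hf3⟩ := (hf n).2 x
  obtain ⟨hg1, hg2, hg3⟩ := (hg n).2 x
  have hpos : 0 ≤ C * ((n : ℝ) + 1) ^ k := by positivity
  have hpos' : 0 ≤ C * D * ((n : ℝ) + 1) ^ (k + l) := by positivity
  have hprod : C * ((n : ℝ) + 1) ^ k * (D * ((n : ℝ) + 1) ^ l)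
      = C * D * ((n : ℝ) + 1) ^ (k + l) := by ring
  have h0 := mul_le_mul hf2 hg2 (abs_nonneg _) hpos
  have h1 := mul_le_mul hf3 hg2 (abs_nonneg _) hpos
  have h2 := mul_le_mul hf2 hg3 (abs_nonneg _) hpos
  rw [hprod] at h0 h1 h2
  refine ⟨hf1.mul hg1, ?_, (abs_add_le _ _).trans ?_⟩
  · rw [abs_mul]; linarith
  · rw [abs_mul, abs_mul]; linarith

lemma of_const {c : ℕ → ℝ} {A : ℝ} (hc : ∀ n, |c n| ≤ A * ((n : ℝ) + 1)) :
    C1PolyBounded fun n _ => c n := by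
  have hA : 0 ≤ A := by simpa using (abs_nonneg _).trans (hc 0)
  refine ⟨fun _ _ => 0, A, 1, hA, fun n => ⟨continuous_const, fun x =>
    ⟨hasDerivAt_const x _, by simpa using hc n, ?_⟩⟩⟩
  rw [abs_zero]
  positivity

lemma const (c : ℝ) : C1PolyBounded fun _ _ => c :=
  of_const (A := |c|) fun n =>
    le_mul_of_one_le_right (abs_nonneg c) (by linarith [n.cast_nonneg (α := ℝ)])

lemma cos_mul {c : ℕ → ℝ} {A : ℝ} (hc : ∀ n, |c n| ≤ A * ((n : ℝ) + 1)) :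
    C1PolyBounded fun n x => Real.cos (c n * x) := by
  have hA : 0 ≤ A := by simpa using (abs_nonneg _).trans (hc 0)
  refine ⟨fun n x => -Real.sin (c n * x) * (c n * 1), A + 1, 1, by positivity, fun n =>
    ⟨by fun_prop, fun x => ⟨((hasDerivAt_id x).const_mul (c n)).cos, ?_, ?_⟩⟩⟩
  · nlinarith [Real.abs_cos_le_one (c n * x), n.cast_nonneg (α := ℝ)]
  · rw [abs_mul, abs_neg, mul_one, pow_one]
    nlinarith [Real.abs_sin_le_one (c n * x), n.cast_nonneg (α := ℝ), hc n, abs_nonneg (c n),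
      abs_nonneg (Real.sin (c n * x))]

lemma sin_mul {c : ℕ → ℝ} {A : ℝ} (hc : ∀ n, |c n| ≤ A * ((n : ℝ) + 1)) :
    C1PolyBounded fun n x => Real.sin (c n * x) := by
  have hA : 0 ≤ A := by simpa using (abs_nonneg _).trans (hc 0)
  refine ⟨fun n x => Real.cos (c n * x) * (c n * 1), A + 1, 1, by positivity, fun n =>
    ⟨by fun_prop, fun x => ⟨((hasDerivAt_id x).const_mul (c n)).sin, ?_, ?_⟩⟩⟩
  · nlinarith [Real.abs_sin_le_one (c n * x), n.cast_nonneg (α := ℝ)]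
  · rw [abs_mul, mul_one, pow_one]
    nlinarith [Real.abs_cos_le_one (c n * x), n.cast_nonneg (α := ℝ), hc n, abs_nonneg (c n),
      abs_nonneg (Real.cos (c n * x))]

end C1PolyBounded

/-- `cos (m θ)` differs from `1` or `cos θ`, according to the parity of `m`, by a multiple of
`sin θ`. -/
lemma exists_cos_mul_eq_add_sin_mul : ∀ m : ℕ, ∃ Q Q' : ℝ → ℝ, Continuous Q' ∧ ∀ x : ℝ,
    HasDerivAt Q (Q' x) x ∧ |Q x| ≤ 2 * (m : ℝ) ^ 2 ∧ |Q' x| ≤ 2 * (m : ℝ) ^ 2 ∧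
      Real.cos (m * x) = (if Even m then 1 else Real.cos x) + Real.sin x * Q x
  | 0 => ⟨fun _ => 0, fun _ => 0, continuous_const, fun x => by simp [hasDerivAt_const]⟩
  | 1 => ⟨fun _ => 0, fun _ => 0, continuous_const, fun x => by simp [hasDerivAt_const]⟩
  | m + 2 => by
    obtain ⟨Q, Q', hQ', h⟩ := exists_cos_mul_eq_add_sin_mul m
    refine ⟨fun x => Q x - 2 * Real.sin (((m : ℝ) + 1) * x),
      fun x => Q' x - 2 * (Real.cos (((m : ℝ) + 1) * x) * (((m : ℝ) + 1) * 1)),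
      by fun_prop, fun x => ?_⟩
    obtain ⟨h1, h2, h3, h4⟩ := h x
    have hm : (0 : ℝ) ≤ m := m.cast_nonneg
    refine ⟨h1.sub ((((hasDerivAt_id x).const_mul ((m : ℝ) + 1)).sin).const_mul 2), ?_, ?_, ?_⟩
    · refine (abs_sub _ _).trans ?_
      rw [abs_mul, abs_two]
      push_cast
      nlinarith [Real.abs_sin_le_one (((m : ℝ) + 1) * x)]
    · refine (abs_sub _ _).trans ?_
      rw [abs_mul, abs_two, abs_mul, mul_one, abs_of_pos (by positivity : (0 : ℝ) < m + 1)]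
      push_cast
      nlinarith [Real.abs_cos_le_one (((m : ℝ) + 1) * x)]
    · have hpar : Even (m + 2) ↔ Even m := by simp [Nat.even_add]
      have e1 : ((m + 2 : ℕ) : ℝ) * x = ((m : ℝ) + 1) * x + x := by push_cast; ring
      have e2 : (m : ℝ) * x = ((m : ℝ) + 1) * x - x := by ring
      rw [e2, Real.cos_sub] at h4
      simp only [hpar]
      rw [e1, Real.cos_add]
      linear_combination h4

/-- `1 / ((q + 1)² − λ²)` at `λ = 2√q cos θ`. -/
noncomputable def specWeight (q : ℕ) (x : ℝ) : ℝ :=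
  1 / (((q : ℝ) - 1) ^ 2 + 4 * q * Real.sin x ^ 2)

/-- `(q + 1) q ^ (n/2) Φ_n(2√q cos θ) sin θ`. -/
noncomputable def sphericalSin (q n : ℕ) (x : ℝ) : ℝ :=
  2 * Real.cos (n * x) * Real.sin x + ((q : ℝ) - 1) * Real.sin (((n : ℝ) + 1) * x)

/-- The derivative of `specWeight`. -/
noncomputable def specWeightDeriv (q : ℕ) (x : ℝ) : ℝ :=
  -(8 * q * Real.sin x * Real.cos x) * specWeight q x ^ 2

/-- The derivative of `sphericalSin`. -/
noncomputable def sphericalSinDeriv (q n : ℕ) (x : ℝ) : ℝ :=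
  (2 + ((n : ℝ) + 1) * ((q : ℝ) - 1)) * Real.cos (((n : ℝ) + 1) * x)
    + (2 - 2 * (n : ℝ)) * (Real.sin (n * x) * Real.sin x)

lemma specWeight_den_pos {q : ℕ} (hq : 2 ≤ q) (x : ℝ) :
    1 ≤ ((q : ℝ) - 1) ^ 2 + 4 * q * Real.sin x ^ 2 := by
  have : (2 : ℝ) ≤ q := by exact_mod_cast hq
  have : 0 ≤ 4 * (q : ℝ) * Real.sin x ^ 2 := by positivity
  nlinarith

lemma hasDerivAt_specWeight {q : ℕ} (hq : 2 ≤ q) (x : ℝ) :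
    HasDerivAt (specWeight q) (specWeightDeriv q x) x := by
  have hD := (one_pos.trans_le (specWeight_den_pos hq x)).ne'
  have h := (hasDerivAt_const x (1 : ℝ)).div
    ((((Real.hasDerivAt_sin x).pow 2).const_mul (4 * (q : ℝ))).const_add (((q : ℝ) - 1) ^ 2)) hD
  refine h.congr_deriv ?_
  rw [specWeightDeriv, specWeight, div_pow, mul_div_assoc']
  congr 1
  ring

lemma hasDerivAt_sphericalSin (q n : ℕ) (x : ℝ) :
    HasDerivAt (sphericalSin q n) (sphericalSinDeriv q n x) x := by
  have h := (((((hasDerivAt_id x).const_mul (n : ℝ)).cos).const_mul 2).mul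
    (Real.hasDerivAt_sin x)).add
    ((((hasDerivAt_id x).const_mul ((n : ℝ) + 1)).sin).const_mul ((q : ℝ) - 1))
  refine h.congr_deriv ?_
  have e : ((n : ℝ) + 1) * x = n * x + x := by ring
  simp only [sphericalSinDeriv, id, e, Real.cos_add]
  ring

lemma continuous_specWeight {q : ℕ} (hq : 2 ≤ q) : Continuous (specWeight q) :=
  continuous_iff_continuousAt.2 fun x => (hasDerivAt_specWeight hq x).continuousAt

lemma c1PolyBounded_specWeight {q : ℕ} (hq : 2 ≤ q) :
    C1PolyBounded fun _ => specWeight q := by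
  have hc := continuous_specWeight hq
  have hW : ∀ x, |specWeight q x| ≤ 1 := fun x => by
    rw [specWeight, abs_of_nonneg (by positivity)]
    exact div_le_one_of_le₀ (specWeight_den_pos hq x) (by positivity)
  refine ⟨fun _ => specWeightDeriv q, 8 * q + 1, 0, by positivity, fun n =>
    ⟨by unfold specWeightDeriv; fun_prop, fun x => ⟨hasDerivAt_specWeight hq x, ?_, ?_⟩⟩⟩
  · have : (0 : ℝ) ≤ 8 * q := by positivity
    linarith [hW x]
  · change |specWeightDeriv q x| ≤ _
    rw [specWeightDeriv, abs_mul, abs_neg, abs_mul, abs_mul, abs_pow,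
      abs_of_nonneg (by positivity : (0 : ℝ) ≤ 8 * q), pow_zero, mul_one]
    calc _ ≤ 8 * (q : ℝ) * 1 * 1 * 1 ^ 2 := by
          gcongr
          exacts [Real.abs_sin_le_one x, Real.abs_cos_le_one x, hW x]
      _ ≤ _ := by linarith

lemma exists_deriv_eq_add_sin_mul {q : ℕ} (hq : 2 ≤ q) :
    ∃ R : ℕ → ℝ → ℝ, C1PolyBounded R ∧ ∀ n x,
      specWeightDeriv q x * sphericalSin q n x + specWeight q x * sphericalSinDeriv q n x
        = (2 + ((n : ℝ) + 1) * ((q : ℝ) - 1)) / ((q : ℝ) - 1) ^ 2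
            * (if Even (n + 1) then 1 else Real.cos x) + Real.sin x * R n x := by
  choose Q Q' hQ' hQ using exists_cos_mul_eq_add_sin_mul
  have hq2 : (2 : ℝ) ≤ q := by exact_mod_cast hq
  have hQb : C1PolyBounded fun n => Q (n + 1) := by
    refine ⟨fun n => Q' (n + 1), 2, 2, by norm_num, fun n => ⟨hQ' _, fun x => ?_⟩⟩
    obtain ⟨h1, h2, h3, -⟩ := hQ (n + 1) x
    push_cast at h2 h3
    exact ⟨h1, h2, h3⟩
  have hn0 : ∀ n : ℕ, (0 : ℝ) ≤ n := fun n => n.cast_nonneg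
  have hn : ∀ n : ℕ, |(n : ℝ)| ≤ 1 * ((n : ℝ) + 1) := fun n => by
    rw [abs_of_nonneg (hn0 n)]; linarith
  have hn1 : ∀ n : ℕ, |(n : ℝ) + 1| ≤ 1 * ((n : ℝ) + 1) := fun n => by
    rw [abs_of_nonneg (by linarith [hn0 n])]; linarith
  have hN : C1PolyBounded fun n _ => 2 + ((n : ℝ) + 1) * ((q : ℝ) - 1) :=
    C1PolyBounded.of_const (A := q + 1) fun n => by
      rw [abs_of_nonneg (by nlinarith [hn0 n])]
      nlinarith [hn0 n]
  have hM : C1PolyBounded fun n _ => 2 - 2 * (n : ℝ) :=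
    C1PolyBounded.of_const (A := 2) fun n => by
      rw [abs_le]
      constructor <;> linarith [hn0 n]
  have hW := c1PolyBounded_specWeight hq
  have hsin : C1PolyBounded fun _ x => Real.sin x := by
    simpa using C1PolyBounded.sin_mul (c := fun _ => 1) (A := 1) fun n => by simp [hn0 n]
  have hcos : C1PolyBounded fun _ x => Real.cos x := by
    simpa using C1PolyBounded.cos_mul (c := fun _ => 1) (A := 1) fun n => by simp [hn0 n]
  have hP : C1PolyBounded (sphericalSin q) :=
    (((C1PolyBounded.const 2).mul (C1PolyBounded.cos_mul hn)).mul hsin).add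
      ((C1PolyBounded.const ((q : ℝ) - 1)).mul (C1PolyBounded.sin_mul hn1))
  have hP' : C1PolyBounded (sphericalSinDeriv q) :=
    (hN.mul (C1PolyBounded.cos_mul hn1)).add
      (hM.mul ((C1PolyBounded.sin_mul hn).mul hsin))
  refine ⟨_, (((((C1PolyBounded.const (-(8 * (q : ℝ)))).mul hcos).mul (hW.mul hW)).mul hP).add
      ((((C1PolyBounded.const (-(4 * (q : ℝ) / ((q : ℝ) - 1) ^ 2))).mul hsin).mul hW).mul hP')).add
      ((C1PolyBounded.const (1 / ((q : ℝ) - 1) ^ 2)).mul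
        ((hM.mul (C1PolyBounded.sin_mul hn)).add (hN.mul hQb))), fun n x => ?_⟩
  obtain ⟨-, -, -, h⟩ := hQ (n + 1) x
  push_cast at h
  have hD := (one_pos.trans_le (specWeight_den_pos hq x)).ne'
  have hq1 : ((q : ℝ) - 1) ≠ 0 := by linarith
  have hWsub : specWeight q x = 1 / ((q : ℝ) - 1) ^ 2
      - 4 * q / ((q : ℝ) - 1) ^ 2 * Real.sin x ^ 2 * specWeight q x := by
    rw [specWeight]
    field_simp
    ring
  have hP'sub : sphericalSinDeriv q n x = (2 + ((n : ℝ) + 1) * ((q : ℝ) - 1))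
      * ((if Even (n + 1) then 1 else Real.cos x) + Real.sin x * Q (n + 1) x)
      + (2 - 2 * (n : ℝ)) * (Real.sin (n * x) * Real.sin x) := by
    rw [sphericalSinDeriv, h]
  rw [specWeightDeriv]
  linear_combination sphericalSinDeriv q n x * hWsub + 1 / ((q : ℝ) - 1) ^ 2 * hP'sub

lemma exists_pow_mul_rpow_le {q : ℕ} (hq : 2 ≤ q) (k : ℕ) :
    ∃ C : ℝ, ∀ n : ℕ, ((n : ℝ) + 1) ^ k * (q : ℝ) ^ (-(n : ℝ) / 2) ≤ C := by
  have hq2 : (2 : ℝ) ≤ q := by exact_mod_cast hq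
  have hq0 : (0 : ℝ) < q := by linarith
  set r : ℝ := (q : ℝ) ^ (-(1 : ℝ) / 2) with hr
  have hr0 : 0 < r := Real.rpow_pos_of_pos hq0 _
  have hr1 : r < 1 := Real.rpow_lt_one_of_one_lt_of_neg (by linarith) (by norm_num)
  obtain ⟨C, hC⟩ := (tendsto_pow_const_mul_const_pow_of_abs_lt_one k
    (by rwa [abs_of_pos hr0] : |r| < 1)).bddAbove_range
  refine ⟨C / r, fun n => ?_⟩
  have hn : (q : ℝ) ^ (-(n : ℝ) / 2) = r ^ n := by
    rw [hr, ← Real.rpow_natCast, ← Real.rpow_mul hq0.le]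
    congr 1
    ring
  rw [hn, le_div_iff₀ hr0, mul_assoc, ← pow_succ]
  simpa using hC ⟨n + 1, rfl⟩

lemma sq_sub_two_mul_sqrt_mul_cos (q : ℕ) (x : ℝ) :
    ((q : ℝ) + 1) ^ 2 - (2 * √q * Real.cos x) ^ 2
      = ((q : ℝ) - 1) ^ 2 + 4 * q * Real.sin x ^ 2 := by
  rw [mul_pow, mul_pow, Real.sq_sqrt (Nat.cast_nonneg q), Real.cos_sq']
  ring

lemma Psi_mul_Phi_mul_sin {q : ℕ} (hq : 2 ≤ q) (n : ℕ) {x : ℝ} (hx : x ∈ Icc 0 π) :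
    Psi q (2 * √q * Real.cos x) * Phi q n (2 * √q * Real.cos x) * (2 * √q * Real.sin x)
      = 2 * q * (q : ℝ) ^ (-(n : ℝ) / 2)
        * (Real.sin x * (specWeight q x * sphericalSin q n x)) := by
  have hq2 : (2 : ℝ) ≤ q := by exact_mod_cast hq
  have hr : 0 < √(q : ℝ) := Real.sqrt_pos.2 (by linarith)
  have hrr : √(q : ℝ) ^ 2 = q := Real.sq_sqrt (by linarith)
  have hs0 : 0 ≤ Real.sin x := Real.sin_nonneg_of_mem_Icc hx
  have hroot : √(4 * (q : ℝ) - (2 * √q * Real.cos x) ^ 2) = 2 * √q * Real.sin x := by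
    rw [← Real.sqrt_sq (by positivity : 0 ≤ 2 * √(q : ℝ) * Real.sin x)]
    congr 1
    rw [mul_pow, mul_pow, mul_pow, mul_pow, hrr, Real.cos_sq']
    ring
  have hU := Polynomial.Chebyshev.U_real_cos x (n : ℤ)
  have hD := (one_pos.trans_le (specWeight_den_pos hq x)).ne'
  have hq1 : (q : ℝ) + 1 ≠ 0 := by linarith
  rw [Psi, Phi, hroot, sq_sub_two_mul_sqrt_mul_cos,
    mul_div_cancel_left₀ _ (by positivity : 2 * √(q : ℝ) ≠ 0), Polynomial.Chebyshev.T_real_cos,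
    specWeight, sphericalSin]
  push_cast at hU ⊢
  rw [← hU]
  field_simp
  rw [hrr]

lemma integral_Psi_mul_Phi {q : ℕ} (hq : 2 ≤ q) (n : ℕ) (t : ℝ) :
    ∫ l in (-(2 * √(q : ℝ)))..(2 * √q),
        Complex.exp (Complex.I * t * l) * (Psi q l * Phi q n l : ℂ)
      = ((2 * q * (q : ℝ) ^ (-(n : ℝ) / 2) : ℝ) : ℂ) * ∫ x in (0 : ℝ)..π,
        Complex.exp (Complex.I * ((2 * √q * t : ℝ) : ℂ) * Real.cos x)
          * ((Real.sin x * (specWeight q x * sphericalSin q n x) : ℝ) : ℂ) := by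
  have hq2 : (2 : ℝ) ≤ q := by exact_mod_cast hq
  have hcont : ContinuousOn
      (fun l : ℝ => Complex.exp (Complex.I * t * l) * (Psi q l * Phi q n l : ℂ))
      ((fun x => 2 * √q * Real.cos x) '' uIcc 0 π) := by
    have hPsi : ContinuousOn (Psi q) ((fun x => 2 * √q * Real.cos x) '' uIcc 0 π) := by
      refine ContinuousOn.div (by fun_prop) (by fun_prop) ?_
      rintro _ ⟨x, -, rfl⟩
      have := specWeight_den_pos hq x
      simp only [sq_sub_two_mul_sqrt_mul_cos]
      linarith
    have hPhi : Continuous (Phi q n) := by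
      unfold Phi
      fun_prop
    exact (by fun_prop : Continuous fun l : ℝ => Complex.exp (Complex.I * t * l)).continuousOn.mul
      ((Complex.continuous_ofReal.comp_continuousOn hPsi).mul
        (Complex.continuous_ofReal.comp hPhi).continuousOn)
  have h := intervalIntegral.integral_deriv_smul_comp' (a := 0) (b := π)
    (fun x _ => (Real.hasDerivAt_cos x).const_mul (2 * √q)) (by fun_prop) hcont
  rw [Real.cos_zero, Real.cos_pi, mul_one, mul_neg_one] at h
  rw [intervalIntegral.integral_symm, ← h, ← intervalIntegral.integral_neg,
    ← intervalIntegral.integral_const_mul]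
  refine intervalIntegral.integral_congr fun x hx => ?_
  rw [uIcc_of_le pi_pos.le] at hx
  have key := congrArg (fun r : ℝ => (r : ℂ)) (Psi_mul_Phi_mul_sin hq n hx)
  have hexp : Complex.exp (Complex.I * t * ((2 * √q * Real.cos x : ℝ) : ℂ))
      = Complex.exp (Complex.I * ((2 * √q * t : ℝ) : ℂ) * Real.cos x) := by
    congr 1
    push_cast
    ring
  simp only [Function.comp_apply, Complex.real_smul, hexp]
  push_cast at key ⊢
  linear_combination Complex.exp (Complex.I * (2 * √q * t) * Complex.cos x) * key

/-- Reduction of the kernel to the Bessel-type integrals of `1` and `cos θ`. -/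
lemma exists_norm_kernel_sub_le {q : ℕ} (hq : 2 ≤ q) : ∃ C : ℝ, 0 ≤ C ∧ ∀ (n : ℕ) (t : ℝ), 0 < t →
    ∀ M : ℂ, ∀ E : ℝ,
      ‖(∫ x in (0 : ℝ)..π, Complex.exp (Complex.I * ((2 * √q * t : ℝ) : ℂ) * Real.cos x)
        * ((if Even (n + 1) then 1 else Real.cos x : ℝ) : ℂ)) - M‖ ≤ E / (2 * √q * t) →
      ‖(1 / π : ℂ) * (∫ l in (-(2 * √(q : ℝ)))..(2 * √q),
          Complex.exp (Complex.I * t * l) * (Psi q l * Phi q n l : ℂ))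
        - ((1 / π * (2 * q * (q : ℝ) ^ (-(n : ℝ) / 2)) * (1 / (2 * √q * t))
          * ((2 + ((n : ℝ) + 1) * ((q : ℝ) - 1)) / ((q : ℝ) - 1) ^ 2) : ℝ) : ℂ)
          * (-Complex.I * M)‖ ≤ C * (1 + |E|) / t ^ 2 := by
  obtain ⟨R, ⟨R', B, k, hB0, hR⟩, hG⟩ := exists_deriv_eq_add_sin_mul hq
  obtain ⟨C₁, hC₁⟩ := exists_pow_mul_rpow_le hq k
  obtain ⟨C₂, hC₂⟩ := exists_pow_mul_rpow_le hq 1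
  have hq2 : (2 : ℝ) ≤ q := by exact_mod_cast hq
  have hr : 0 < √(q : ℝ) := Real.sqrt_pos.2 (by linarith)
  have hrr : √(q : ℝ) * √q = q := Real.mul_self_sqrt (by linarith)
  have hC₁0 : 0 ≤ C₁ := le_trans (by positivity) (hC₁ 0)
  have hC₂0 : 0 ≤ C₂ := le_trans (by positivity) (hC₂ 0)
  refine ⟨6 * B * C₁ + (q + 1) * C₂, by positivity, fun n t ht M E hE => ?_⟩
  set s : ℝ := 2 * √q * t with hs
  have hs0 : 0 < s := by positivity
  set N : ℝ := (2 + ((n : ℝ) + 1) * ((q : ℝ) - 1)) / ((q : ℝ) - 1) ^ 2 with hN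
  set p : ℝ := (q : ℝ) ^ (-(n : ℝ) / 2) with hp
  have hp0 : 0 ≤ p := by positivity
  have hN0 : 0 ≤ N := div_nonneg (by nlinarith [n.cast_nonneg (α := ℝ)]) (sq_nonneg _)
  have hNle : N ≤ (q + 1) * ((n : ℝ) + 1) := by
    have : (1 : ℝ) ≤ ((q : ℝ) - 1) ^ 2 := by nlinarith
    refine (div_le_self (by nlinarith [n.cast_nonneg (α := ℝ)]) this).trans ?_
    nlinarith [n.cast_nonneg (α := ℝ)]
  have hPc : Continuous (sphericalSin q n) :=
    continuous_iff_continuousAt.2 fun x => (hasDerivAt_sphericalSin q n x).continuousAt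
  have hWc := continuous_specWeight hq
  have hibp := integral_phase_mul_sin hs0.ne'
    (fun x _ => (hasDerivAt_specWeight hq x).mul (hasDerivAt_sphericalSin q n x))
    (by unfold specWeightDeriv sphericalSinDeriv; fun_prop)
  have hP0 : sphericalSin q n 0 = 0 := by simp [sphericalSin]
  have hPpi : sphericalSin q n π = 0 := by
    have := Real.sin_nat_mul_pi (n + 1)
    push_cast at this
    simp [sphericalSin, this]
  have hRc : Continuous (R n) :=
    continuous_iff_continuousAt.2 fun x => ((hR n).2 x).1.continuousAt
  have hRi := norm_integral_phase_mul_sin_le hs0 (fun x _ => ((hR n).2 x).1)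
    (hR n).1.continuousOn (fun x _ => ((hR n).2 x).2.1) (fun x _ => ((hR n).2 x).2.2)
  set J := ∫ x in (0 : ℝ)..π, Complex.exp (Complex.I * s * Real.cos x)
    * ((if Even (n + 1) then 1 else Real.cos x : ℝ) : ℂ)
  set K := ∫ x in (0 : ℝ)..π, Complex.exp (Complex.I * s * Real.cos x)
    * ((Real.sin x * R n x : ℝ) : ℂ)
  have hsplit : (∫ x in (0 : ℝ)..π, Complex.exp (Complex.I * s * Real.cos x)
      * ((specWeightDeriv q x * sphericalSin q n x + specWeight q x * sphericalSinDeriv q n x : ℝ)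
        : ℂ)) = N * J + K := by
    rw [← intervalIntegral.integral_const_mul, ← intervalIntegral.integral_add]
    · refine intervalIntegral.integral_congr fun x _ => ?_
      simp only [hG, ← hN]
      push_cast
      ring
    · refine Continuous.intervalIntegrable ?_ _ _
      split_ifs <;> fun_prop
    · exact Continuous.intervalIntegrable (by fun_prop) _ _
  simp only [Pi.mul_apply, hP0, hPpi, mul_zero, Complex.ofReal_zero, sub_zero, zero_add] at hibp
  rw [integral_Psi_mul_Phi hq, hibp, hsplit]
  have hfac : (1 / π : ℂ) * (((2 * q * p : ℝ) : ℂ) * (1 / (Complex.I * s) * (N * J + K)))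
      - ((1 / π * (2 * q * p) * (1 / s) * N : ℝ) : ℂ) * (-Complex.I * M)
      = ((1 / π * (2 * q * p) * (1 / s) : ℝ) : ℂ) * (-Complex.I * (N * (J - M) + K)) := by
    rw [one_div (Complex.I * (s : ℂ)), mul_inv, Complex.inv_I]
    push_cast
    ring
  have hE0 : 0 ≤ |E| := abs_nonneg E
  have hE' : ‖J - M‖ ≤ |E| / s := hE.trans (by gcongr; exact le_abs_self E)
  rw [hfac, norm_mul, norm_mul, norm_neg, Complex.norm_I, one_mul, Complex.norm_real,
    Real.norm_eq_abs, abs_of_nonneg (by positivity)]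
  have hbound : ‖(N : ℂ) * (J - M) + K‖ ≤ (N * |E| + 6 * (B * ((n : ℝ) + 1) ^ k)) / s := by
    refine (norm_add_le _ _).trans ?_
    rw [norm_mul, Complex.norm_real, Real.norm_eq_abs, abs_of_nonneg hN0, add_div, mul_div_assoc]
    gcongr
  have hpi : 1 / π ≤ 1 := (div_le_one pi_pos).2 (by linarith [pi_gt_three])
  calc 1 / π * (2 * q * p) * (1 / s) * ‖(N : ℂ) * (J - M) + K‖
      ≤ 1 * (2 * q * p) * (1 / s) * (((q + 1) * ((n : ℝ) + 1) * |E|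
          + 6 * (B * ((n : ℝ) + 1) ^ k)) / s) := by
        gcongr
        exact hbound.trans (by gcongr)
    _ = ((q + 1) * ((((n : ℝ) + 1) ^ 1 * p) * |E|) + 6 * B * (((n : ℝ) + 1) ^ k * p)) / 2
          / t ^ 2 := by
        have : s * s = 4 * q * t ^ 2 := by rw [hs]; linear_combination 4 * t ^ 2 * hrr
        field_simp
        rw [show s ^ 2 = 4 * q * t ^ 2 by rw [sq, this]]
        field_simp
        ring
    _ ≤ (6 * B * C₁ + (q + 1) * C₂) * (1 + |E|) / t ^ 2 := by
        gcongr
        have h1 : (q + 1) * ((((n : ℝ) + 1) ^ 1 * p) * |E|) ≤ (q + 1) * (C₂ * |E|) := by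
          gcongr; exact hC₂ n
        have h2 : 6 * B * (((n : ℝ) + 1) ^ k * p) ≤ 6 * B * C₁ := by gcongr; exact hC₁ n
        have h3 : 0 ≤ (q + 1) * (C₂ * |E|) := by positivity
        have h4 : 0 ≤ 6 * B * C₁ := by positivity
        have h5 : 0 ≤ 6 * B * C₁ * |E| := by positivity
        have h6 : 0 ≤ (q + 1) * C₂ := by positivity
        linarith

lemma leading_coefficient_eq {q : ℕ} (hq : 2 ≤ q) (n : ℕ) {t : ℝ} (ht : 0 < t) (N d S : ℝ) :
    1 / π * (2 * q * (q : ℝ) ^ (-(n : ℝ) / 2)) * (1 / (2 * √q * t)) * (N / d)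
        * (2 * √(π / (2 * (2 * √q * t))) * S)
      = 1 / (√π * t ^ ((3 : ℝ) / 2)) * S * ((q : ℝ) ^ (-(n : ℝ) / 2 + (1 : ℝ) / 4) * N / d) := by
  have hq0 : (0 : ℝ) < q := by exact_mod_cast (by omega : 0 < q)
  set r : ℝ := (q : ℝ) ^ ((1 : ℝ) / 4) with hr
  have hr0 : 0 < r := Real.rpow_pos_of_pos hq0 _
  have hsq : √(q : ℝ) = r ^ 2 := by
    rw [Real.sqrt_eq_rpow, hr, ← Real.rpow_natCast, ← Real.rpow_mul hq0.le]
    norm_num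
  have hq4 : (q : ℝ) = r ^ 4 := by
    rw [← Real.sq_sqrt hq0.le, hsq]
    ring
  have ht32 : t ^ ((3 : ℝ) / 2) = √t ^ 3 := by
    rw [Real.sqrt_eq_rpow, ← Real.rpow_natCast, ← Real.rpow_mul ht.le]
    norm_num
  have hroot : √(π / (2 * (2 * √q * t))) = √π / (2 * r * √t) := by
    rw [Real.sqrt_div pi_pos.le, hsq, show 2 * (2 * r ^ 2 * t) = (2 * r) ^ 2 * t by ring,
      Real.sqrt_mul (sq_nonneg _), Real.sqrt_sq (by positivity)]
  rw [Real.rpow_add hq0, hroot, ht32, ← hr, hsq]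
  set p : ℝ := (q : ℝ) ^ (-(n : ℝ) / 2)
  rw [hq4]
  have hst : 0 < √t := Real.sqrt_pos.2 ht
  have ht2 : t = √t ^ 2 := (Real.sq_sqrt ht.le).symm
  have hspi : 0 < √π := Real.sqrt_pos.2 pi_pos
  have hpi2 : π = √π ^ 2 := (Real.sq_sqrt pi_pos.le).symm
  rw [show 1 / π = 1 / √π ^ 2 by rw [← hpi2], show 2 * r ^ 2 * t = 2 * r ^ 2 * √t ^ 2 by rw [← ht2]]
  field_simp

/-- Uniform (in `n`) asymptotics for the off-diagonal kernel
`(1/π)∫_{−2√q}^{2√q} e^{itλ} Ψ(λ)Φ_n(λ) dλ` of the adjacency operator of the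
`(q+1)`-regular tree at distance `n`, with error `O(t^{−2})` uniform in `n`. -/
theorem offdiagonal_kernel_asymptotics (q : ℕ) (hq : 2 ≤ q) :
    ∃ C t₀ : ℝ, 0 < C ∧ 0 < t₀ ∧ ∀ n : ℕ, ∀ t ≥ t₀,
      (Even n →
        ‖(1/Real.pi : ℂ) * (∫ l in (-(2*Real.sqrt q))..(2*Real.sqrt q),
            Complex.exp (Complex.I * t * l) * (Psi q l * Phi q n l : ℂ))
          - ((1/(Real.sqrt Real.pi * t ^ ((3:ℝ)/2)) *
              Real.sin (2*Real.sqrt q * t - Real.pi/4) *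
              ((q:ℝ) ^ (-(n:ℝ)/2 + (1:ℝ)/4) * (2 + ((n:ℝ)+1)*((q:ℝ)-1)) / ((q:ℝ)-1)^2) : ℝ) : ℂ)‖
          ≤ C / t^2) ∧
      (Odd n →
        ‖(1/Real.pi : ℂ) * (∫ l in (-(2*Real.sqrt q))..(2*Real.sqrt q),
            Complex.exp (Complex.I * t * l) * (Psi q l * Phi q n l : ℂ))
          - (-Complex.I) * ((1/(Real.sqrt Real.pi * t ^ ((3:ℝ)/2)) *
              Real.sin (2*Real.sqrt q * t + Real.pi/4) *
              ((q:ℝ) ^ (-(n:ℝ)/2 + (1:ℝ)/4) * (2 + ((n:ℝ)+1)*((q:ℝ)-1)) / ((q:ℝ)-1)^2) : ℝ) : ℂ)‖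
          ≤ C / t^2) := by
  obtain ⟨C, hC0, hC⟩ := exists_norm_kernel_sub_le hq
  obtain ⟨E₀, hE₀⟩ := exists_norm_integral_phase_sub_cos_le
  obtain ⟨E₁, hE₁⟩ := exists_norm_integral_phase_mul_cos_sub_le
  have hr : 0 < √(q : ℝ) := Real.sqrt_pos.2 (by exact_mod_cast (by omega : 0 < q))
  refine ⟨C * (1 + |E₀|) + C * (1 + |E₁|) + 1, 1, by positivity, one_pos, fun n t ht => ?_⟩
  have ht0 : 0 < t := one_pos.trans_le ht
  have hs : 0 < 2 * √(q : ℝ) * t := by positivity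
  have hp₀ : 0 ≤ C * (1 + |E₀|) := by positivity
  have hp₁ : 0 ≤ C * (1 + |E₁|) := by positivity
  refine ⟨fun hn => ?_, fun hn => ?_⟩
  · have hn1 : ¬ Even (n + 1) := Nat.not_even_iff_odd.2 hn.add_one
    have h := hC n t ht0 _ E₁ (by simpa only [hn1, if_false] using hE₁ _ hs)
    rw [← leading_coefficient_eq hq n ht0]
    have hI : ∀ z : ℂ, -Complex.I * (Complex.I * z) = z := fun z => by
      rw [neg_mul, ← mul_assoc, Complex.I_mul_I, neg_one_mul, neg_neg]
    rw [hI, ← Complex.ofReal_mul] at h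
    exact h.trans (by gcongr; linarith)
  · have hn1 : Even (n + 1) := hn.add_one
    have h := hC n t ht0 _ E₀ (by
      simpa only [hn1, if_true, Complex.ofReal_one, mul_one] using hE₀ _ hs)
    have hsin : Real.sin (2 * √q * t + π / 4) = Real.cos (2 * √q * t - π / 4) := by
      rw [← Real.sin_add_pi_div_two]
      congr 1
      ring
    rw [← leading_coefficient_eq hq n ht0, hsin]
    refine (le_of_eq_of_le ?_ h).trans (by gcongr; linarith)
    congr 2
    push_cast
    ring
end

section
/- Let q ≥ 2 be an integer, Ψ(λ) = (q+1)√(4q − λ²)/(2((q+1)² − λ²)) on [−2√q, 2√q], and let Φ_n be the spherical function. There exist constants C_q > 0 and t₀ > 0 such that for all t ≥ t₀ and all integers n ≥ 0, |(1/π) ∫_{−2√q}^{2√q} e^{i t λ} Ψ(λ) Φ_n(λ) dλ| ≤ C_q t^{−3/2}. -/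
open MeasureTheory intervalIntegral Real

theorem hasDerivAt_exp_I_mul_cos (s x : ℝ) :
    HasDerivAt (fun θ : ℝ ↦ Complex.exp (Complex.I * s * (cos θ : ℝ)))
      (Complex.exp (Complex.I * s * (cos x : ℝ)) * (Complex.I * s * (-sin x : ℝ))) x :=
  (((hasDerivAt_cos x).ofReal_comp).const_mul (Complex.I * s)).cexp

theorem norm_exp_I_mul_cos (s x : ℝ) : ‖Complex.exp (Complex.I * s * (cos x : ℝ))‖ = 1 := by
  rw [show Complex.I * s * (cos x : ℝ) = ((s * cos x : ℝ) : ℂ) * Complex.I by push_cast; ring]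
  exact Complex.norm_exp_ofReal_mul_I _

theorem continuous_exp_I_mul_cos (s : ℝ) :
    Continuous fun θ : ℝ ↦ Complex.exp (Complex.I * s * (cos θ : ℝ)) := by
  fun_prop

/-- Integration by parts against the phase `s cos θ`. -/
theorem mul_norm_integral_exp_I_mul_cos_mul_sin_le {s a b : ℝ} (hs : 0 ≤ s) {u u' : ℝ → ℝ}
    (hu : ∀ x ∈ Set.uIcc a b, HasDerivAt u (u' x) x) (hu' : ContinuousOn u' (Set.uIcc a b)) :
    s * ‖∫ θ in a..b, Complex.exp (Complex.I * s * (cos θ : ℝ)) * (sin θ * u θ : ℝ)‖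
      ≤ |u a| + |u b|
        + ‖∫ θ in a..b, Complex.exp (Complex.I * s * (cos θ : ℝ)) * (u' θ : ℝ)‖ := by
  have h := integral_mul_deriv_eq_deriv_mul (a := a) (b := b)
    (fun x hx ↦ (hu x hx).ofReal_comp) (fun x _ ↦ hasDerivAt_exp_I_mul_cos s x)
    (ContinuousOn.intervalIntegrable (Complex.continuous_ofReal.comp_continuousOn hu'))
    (Continuous.intervalIntegrable (by fun_prop) _ _)
  have h1 : (∫ θ in a..b, (u θ : ℂ) *
        (Complex.exp (Complex.I * s * (cos θ : ℝ)) * (Complex.I * s * (-sin θ : ℝ))))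
      = -(Complex.I * s) *
        ∫ θ in a..b, Complex.exp (Complex.I * s * (cos θ : ℝ)) * (sin θ * u θ : ℝ) := by
    rw [← intervalIntegral.integral_const_mul]
    refine integral_congr fun x _ ↦ ?_
    push_cast
    ring
  have h2 : (∫ θ in a..b, (u' θ : ℂ) * Complex.exp (Complex.I * s * (cos θ : ℝ)))
      = ∫ θ in a..b, Complex.exp (Complex.I * s * (cos θ : ℝ)) * (u' θ : ℝ) :=
    integral_congr fun x _ ↦ mul_comm _ _
  rw [h1, h2] at h
  have h3 := congrArg norm h
  rw [norm_mul, norm_neg, norm_mul, Complex.norm_I, one_mul, Complex.norm_real,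
    Real.norm_of_nonneg hs] at h3
  rw [h3]
  refine (norm_sub_le _ _).trans (add_le_add_left ((norm_sub_le _ _).trans ?_) _)
  rw [norm_mul, norm_mul, norm_exp_I_mul_cos, norm_exp_I_mul_cos, Complex.norm_real,
    Complex.norm_real, Real.norm_eq_abs, Real.norm_eq_abs]
  linarith

/-- Van der Corput estimate for the phase `s cos θ` on `[0, π]`. -/
theorem norm_integral_exp_I_mul_cos_le {s M : ℝ} (hs : 1 ≤ s) {k k' : ℝ → ℝ}
    (hk : ∀ x, HasDerivAt k (k' x) x) (hk' : Continuous k')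
    (hM : ∀ x ∈ Set.Icc 0 π, |k x| ≤ M) (hM' : ∀ x ∈ Set.Icc 0 π, |k' x| ≤ M) :
    ‖∫ θ in 0..π, Complex.exp (Complex.I * s * (cos θ : ℝ)) * (k θ : ℝ)‖
      ≤ 14 * M * s ^ (-(1 : ℝ) / 2) := by
  have hs0 : 0 < s := by linarith
  have hM0 : 0 ≤ M := (abs_nonneg _).trans (hM 0 ⟨le_rfl, pi_pos.le⟩)
  set ε := s ^ (-(1 : ℝ) / 2) with hε
  have hε0 : 0 < ε := rpow_pos_of_pos hs0 _
  have hε1 : ε ≤ 1 := rpow_le_one_of_one_le_of_nonpos hs (by norm_num)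
  have hsε : s * ε * ε = 1 := by
    rw [mul_assoc, hε, ← rpow_add hs0]
    norm_num
    rw [rpow_neg_one, mul_inv_cancel₀ hs0.ne']
  have hpi := pi_gt_three
  have hpi4 := pi_lt_four
  have hsin : ε / 2 ≤ sin ε := by
    refine le_trans ?_ (mul_le_sin hε0.le (by linarith))
    rw [div_eq_inv_mul]
    gcongr
    rw [inv_eq_one_div, div_le_div_iff₀ (by norm_num) pi_pos]
    linarith
  have hsin0 : 0 < sin ε := by linarith
  have hinv : 1 / sin ε ≤ 2 / ε := by
    rw [div_le_div_iff₀ hsin0 hε0]; linarith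
  have hkc : Continuous k := continuous_iff_continuousAt.2 fun x ↦ (hk x).continuousAt
  have hint : ∀ a b : ℝ, IntervalIntegrable
      (fun θ : ℝ ↦ Complex.exp (Complex.I * s * (cos θ : ℝ)) * (k θ : ℝ)) volume a b :=
    fun a b ↦ Continuous.intervalIntegrable (by fun_prop) _ _
  have hend : ∀ a b : ℝ, 0 ≤ a → a ≤ b → b ≤ π →
      ‖∫ θ in a..b, Complex.exp (Complex.I * s * (cos θ : ℝ)) * (k θ : ℝ)‖ ≤ M * (b - a) := by
    intro a b ha hab hb
    rw [← abs_of_nonneg (sub_nonneg.2 hab)]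
    refine norm_integral_le_of_norm_le_const fun x hx ↦ ?_
    rw [Set.uIoc_of_le hab] at hx
    rw [norm_mul, norm_exp_I_mul_cos, one_mul, Complex.norm_real, Real.norm_eq_abs]
    exact hM x ⟨by linarith [hx.1], by linarith [hx.2]⟩
  have hle : ε ≤ π - ε := by linarith
  have hspos : ∀ x ∈ Set.Icc ε (π - ε), 0 < sin x := fun x hx ↦
    sin_pos_of_pos_of_lt_pi (by linarith [hx.1]) (by linarith [hx.2])
  have hcsc : ContinuousOn (fun x ↦ 1 / sin x ^ 2) (Set.uIcc ε (π - ε)) := by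
    rw [Set.uIcc_of_le hle]
    exact continuousOn_const.div (by fun_prop) fun x hx ↦ (pow_pos (hspos x hx) 2).ne'
  have hcot : ∫ x in ε..(π - ε), 1 / sin x ^ 2 = 2 * (cos ε / sin ε) := by
    rw [integral_eq_sub_of_hasDerivAt (f := fun x ↦ -(cos x / sin x)) _ hcsc.intervalIntegrable]
    · simp only [cos_pi_sub, sin_pi_sub]
      ring
    · intro x hx
      rw [Set.uIcc_of_le hle] at hx
      have := (hspos x hx).ne'
      convert! ((hasDerivAt_cos x).div (hasDerivAt_sin x) this).neg using 1
      rw [← sin_sq_add_cos_sq x]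
      field_simp
      ring
  have hmid : s * ‖∫ θ in ε..(π - ε), Complex.exp (Complex.I * s * (cos θ : ℝ)) * (k θ : ℝ)‖
      ≤ 12 * M / ε := by
    have hd : ∀ x ∈ Set.uIcc ε (π - ε), HasDerivAt (fun x ↦ k x / sin x)
        ((k' x * sin x - k x * cos x) / sin x ^ 2) x := by
      intro x hx
      rw [Set.uIcc_of_le hle] at hx
      exact (hk x).div (hasDerivAt_sin x) (hspos x hx).ne'
    have h := mul_norm_integral_exp_I_mul_cos_mul_sin_le hs0.le hd (by
      rw [Set.uIcc_of_le hle]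
      exact ContinuousOn.div (by fun_prop) (by fun_prop)
        fun x hx ↦ (pow_pos (hspos x hx) 2).ne')
    have hcongr : (∫ θ in ε..(π - ε),
          Complex.exp (Complex.I * s * (cos θ : ℝ)) * (sin θ * (k θ / sin θ) : ℝ))
        = ∫ θ in ε..(π - ε), Complex.exp (Complex.I * s * (cos θ : ℝ)) * (k θ : ℝ) := by
      refine integral_congr fun x hx ↦ ?_
      rw [Set.uIcc_of_le hle] at hx
      rw [mul_div_cancel₀ _ (hspos x hx).ne']
    rw [hcongr] at h
    have hb : ∀ x, x ∈ Set.Icc 0 π → sin x = sin ε → |k x / sin x| ≤ M * (2 / ε) := by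
      intro x hx hxs
      rw [abs_div, hxs, abs_of_pos hsin0, div_eq_mul_one_div]
      exact mul_le_mul (hM x hx) hinv (by positivity) hM0
    have h1 := hb ε ⟨hε0.le, by linarith⟩ rfl
    have h2 := hb (π - ε) ⟨by linarith, by linarith⟩ (sin_pi_sub ε)
    have h3 : ‖∫ θ in ε..(π - ε), Complex.exp (Complex.I * s * (cos θ : ℝ)) *
        ((k' θ * sin θ - k θ * cos θ) / sin θ ^ 2 : ℝ)‖
        ≤ ∫ θ in ε..(π - ε), 2 * M * (1 / sin θ ^ 2) := by
      refine norm_integral_le_of_norm_le hle (Filter.Eventually.of_forall fun x hx ↦ ?_)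
        (hcsc.const_smul (2 * M)).intervalIntegrable
      have hx0 : x ∈ Set.Icc 0 π := ⟨by linarith [hx.1], by linarith [hx.2]⟩
      have hp := hspos x ⟨hx.1.le, hx.2⟩
      rw [norm_mul, norm_exp_I_mul_cos, one_mul, Complex.norm_real, Real.norm_eq_abs, abs_div,
        abs_of_pos (pow_pos hp 2), div_eq_mul_one_div]
      gcongr
      refine (abs_sub _ _).trans ?_
      rw [abs_mul, abs_mul]
      have e1 := mul_le_mul (hM' x hx0) (abs_sin_le_one x) (abs_nonneg _) hM0
      have e2 := mul_le_mul (hM x hx0) (abs_cos_le_one x) (abs_nonneg _) hM0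
      linarith
    rw [intervalIntegral.integral_const_mul, hcot] at h3
    have h4 : cos ε / sin ε ≤ 2 / ε :=
      le_trans (by gcongr; exact cos_le_one ε) hinv
    have h5 : 2 * M * (2 * (cos ε / sin ε)) ≤ 2 * M * (2 * (2 / ε)) := by gcongr
    calc _ ≤ M * (2 / ε) + M * (2 / ε) + 2 * M * (2 * (2 / ε)) := by linarith
      _ = 12 * M / ε := by ring
  have hmid' : ‖∫ θ in ε..(π - ε), Complex.exp (Complex.I * s * (cos θ : ℝ)) * (k θ : ℝ)‖
      ≤ 12 * M * ε := by
    refine le_of_mul_le_mul_left (hmid.trans_eq ?_) hs0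
    rw [div_eq_iff hε0.ne']
    linear_combination (-12 * M) * hsε
  rw [← integral_add_adjacent_intervals (hint 0 (π - ε)) (hint _ _),
    ← integral_add_adjacent_intervals (hint 0 ε) (hint _ _)]
  have e1 := hend 0 ε le_rfl hε0.le (by linarith)
  have e2 := hend (π - ε) π (by linarith) (by linarith) le_rfl
  refine (norm_add_le _ _).trans ((add_le_add_left (norm_add_le _ _) _).trans ?_)
  linarith

/-- An amplitude `sin θ * H θ` with `H` vanishing at the critical points `0`, `π` of the phase
`s cos θ` gives decay `s ^ (-3 / 2)`. -/
theorem norm_integral_exp_I_mul_cos_mul_sin_le {s M : ℝ} (hs : 1 ≤ s) {H H' H'' : ℝ → ℝ}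
    (hH : ∀ x, HasDerivAt H (H' x) x) (hH' : ∀ x, HasDerivAt H' (H'' x) x)
    (hH'' : Continuous H'') (h0 : H 0 = 0) (hpi : H π = 0)
    (hM : ∀ x ∈ Set.Icc 0 π, |H' x| ≤ M) (hM' : ∀ x ∈ Set.Icc 0 π, |H'' x| ≤ M) :
    ‖∫ θ in 0..π, Complex.exp (Complex.I * s * (cos θ : ℝ)) * (sin θ * H θ : ℝ)‖
      ≤ 14 * M * s ^ (-(3 : ℝ) / 2) := by
  have hs0 : 0 < s := by linarith
  have hc : Continuous H' := continuous_iff_continuousAt.2 fun x ↦ (hH' x).continuousAt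
  have h := mul_norm_integral_exp_I_mul_cos_mul_sin_le hs0.le (a := 0) (b := π)
    (fun x _ ↦ hH x) hc.continuousOn
  rw [h0, hpi, abs_zero, zero_add, zero_add] at h
  have h2 := h.trans (norm_integral_exp_I_mul_cos_le hs hH' hH'' hM hM')
  refine le_of_mul_le_mul_left (h2.trans_eq ?_) hs0
  rw [show -(1 : ℝ) / 2 = 1 + -(3 : ℝ) / 2 by norm_num, rpow_add hs0, rpow_one]
  ring

theorem exists_pow_two_mul_pow_le {r : ℝ} (hr0 : 0 < r) (hr : r < 1) :
    ∃ K, ∀ n : ℕ, r ^ n * ((n : ℝ) + 1) ^ 2 ≤ K := by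
  obtain ⟨B, hB⟩ := (tendsto_pow_const_mul_const_pow_of_abs_lt_one 2
    (abs_lt.2 ⟨by linarith, hr⟩)).bddAbove_range
  refine ⟨B / r, fun n ↦ ?_⟩
  have := hB ⟨n + 1, rfl⟩
  rw [le_div_iff₀ hr0]
  refine le_of_eq_of_le ?_ this
  push_cast
  ring

/-- The density of `Psi` in the angular variable `l = 2 √q cos θ`, without its sine factors. -/
noncomputable def angularWeight (q : ℕ) (θ : ℝ) : ℝ :=
  ((q : ℝ) + 1) * (4 * q) / (2 * (((q : ℝ) + 1) ^ 2 - 4 * q * cos θ ^ 2))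

/-- `sin θ * Phi q n (2 √q cos θ)`, up to the factor `q ^ (-n / 2)`. -/
noncomputable def angularPhi (q n : ℕ) (θ : ℝ) : ℝ :=
  2 / ((q : ℝ) + 1) * (sin θ * cos (n * θ))
    + ((q : ℝ) - 1) / ((q : ℝ) + 1) * sin ((n + 1) * θ)

theorem angularWeight_denom_pos {q : ℕ} (hq : 2 ≤ q) {x : ℝ} (hx : x ^ 2 ≤ 1) :
    0 < 2 * (((q : ℝ) + 1) ^ 2 - 4 * q * x ^ 2) := by
  have : (2 : ℝ) ≤ q := by exact_mod_cast hq
  nlinarith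

theorem contDiff_angularWeight {q : ℕ} (hq : 2 ≤ q) : ContDiff ℝ 2 (angularWeight q) :=
  contDiff_const.div (by fun_prop) fun θ ↦ (angularWeight_denom_pos hq (cos_sq_le_one θ)).ne'

theorem exists_angularWeight_bounds {q : ℕ} (hq : 2 ≤ q) :
    ∃ (w' w'' : ℝ → ℝ) (W : ℝ), 0 < W ∧ (∀ x, HasDerivAt (angularWeight q) (w' x) x) ∧
      (∀ x, HasDerivAt w' (w'' x) x) ∧ Continuous w'' ∧
      ∀ x ∈ Set.Icc 0 π, |angularWeight q x| ≤ W ∧ |w' x| ≤ W ∧ |w'' x| ≤ W := by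
  have h := contDiff_angularWeight hq
  have h1 : ContDiff ℝ 1 (deriv (angularWeight q)) := by
    rw [show (2 : WithTop ℕ∞) = 1 + 1 by norm_num] at h
    exact (contDiff_succ_iff_deriv.1 h).2.2
  have hc : Continuous (deriv (deriv (angularWeight q))) := h1.continuous_deriv le_rfl
  obtain ⟨A, hA⟩ := isCompact_Icc.exists_bound_of_continuousOn (s := Set.Icc 0 π)
    h.continuous.continuousOn
  obtain ⟨B, hB⟩ := isCompact_Icc.exists_bound_of_continuousOn (s := Set.Icc 0 π)
    h1.continuous.continuousOn
  obtain ⟨D, hD⟩ := isCompact_Icc.exists_bound_of_continuousOn (s := Set.Icc 0 π)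
    hc.continuousOn
  refine ⟨_, _, |A| + |B| + |D| + 1, by positivity,
    fun x ↦ (h.differentiable (by norm_num) x).hasDerivAt,
    fun x ↦ (h1.differentiable (by norm_num) x).hasDerivAt, hc, fun x hx ↦ ?_⟩
  have ha := (hA x hx).trans (le_abs_self A)
  have hb := (hB x hx).trans (le_abs_self B)
  have hd := (hD x hx).trans (le_abs_self D)
  rw [Real.norm_eq_abs] at ha hb hd
  have := abs_nonneg A
  have := abs_nonneg B
  have := abs_nonneg D
  exact ⟨by linarith, by linarith, by linarith⟩

theorem exists_angularPhi_bounds {q : ℕ} (hq : 2 ≤ q) (n : ℕ) :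
    ∃ B' B'' : ℝ → ℝ, (∀ x, HasDerivAt (angularPhi q n) (B' x) x) ∧
      (∀ x, HasDerivAt B' (B'' x) x) ∧ Continuous B'' ∧
      ∀ x, |angularPhi q n x| ≤ 2 ∧ |B' x| ≤ 2 * ((n : ℝ) + 1) ∧
        |B'' x| ≤ 2 * ((n : ℝ) + 1) ^ 2 := by
  have hq' : (2 : ℝ) ≤ q := by exact_mod_cast hq
  have hα0 : 0 ≤ 2 / ((q : ℝ) + 1) := by positivity
  have hα1 : 2 / ((q : ℝ) + 1) ≤ 1 := by rw [div_le_one (by linarith)]; linarith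
  have hβ0 : 0 ≤ ((q : ℝ) - 1) / ((q : ℝ) + 1) := div_nonneg (by linarith) (by linarith)
  have hβ1 : ((q : ℝ) - 1) / ((q : ℝ) + 1) ≤ 1 := by rw [div_le_one (by linarith)]; linarith
  unfold angularPhi
  set α := 2 / ((q : ℝ) + 1)
  set β := ((q : ℝ) - 1) / ((q : ℝ) + 1)
  have hn : (0 : ℝ) ≤ n := n.cast_nonneg
  have hcomb : ∀ {u v U V : ℝ}, |u| ≤ U → |v| ≤ V → |α * u + β * v| ≤ U + V := by
    intro u v U V hu hv
    refine (abs_add_le _ _).trans (add_le_add ?_ ?_)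
    · rw [abs_mul, abs_of_nonneg hα0]
      exact (mul_le_of_le_one_left (abs_nonneg _) hα1).trans hu
    · rw [abs_mul, abs_of_nonneg hβ0]
      exact (mul_le_of_le_one_left (abs_nonneg _) hβ1).trans hv
  have hprod : ∀ {u v : ℝ}, |u| ≤ 1 → |v| ≤ 1 → |u * v| ≤ 1 := fun hu hv ↦ by
    rw [abs_mul]; exact mul_le_one₀ hu (abs_nonneg _) hv
  have hlin : ∀ (c x : ℝ), HasDerivAt (fun y : ℝ ↦ c * y) c x := fun c x ↦ by
    simpa using (hasDerivAt_id x).const_mul c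
  refine ⟨fun x ↦ α * (cos x * cos (n * x) - n * (sin x * sin (n * x)))
      + β * ((n + 1) * cos ((n + 1) * x)),
    fun x ↦ α * (-((1 + n ^ 2) * (sin x * cos (n * x))) - 2 * n * (cos x * sin (n * x)))
      + β * (-((n + 1) ^ 2 * sin ((n + 1) * x))), fun x ↦ ?_, fun x ↦ ?_, by fun_prop,
    fun x ↦ ⟨?_, ?_, ?_⟩⟩
  · convert! (((hasDerivAt_sin x).mul (hlin n x).cos).const_mul α).add
      ((hlin (n + 1) x).sin.const_mul β) using 1
    ring
  · convert! ((((hasDerivAt_cos x).mul (hlin n x).cos).sub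
      (((hasDerivAt_sin x).mul (hlin n x).sin).const_mul (n : ℝ))).const_mul α).add
      (((hlin (n + 1) x).cos.const_mul ((n : ℝ) + 1)).const_mul β) using 1
    ring
  · refine (hcomb (hprod (abs_sin_le_one x) (abs_cos_le_one _)) (abs_sin_le_one _)).trans ?_
    norm_num
  · refine (hcomb (U := 1 + n) (V := n + 1) ?_ ?_).trans (by linarith)
    · refine (abs_sub _ _).trans (add_le_add
        (hprod (abs_cos_le_one x) (abs_cos_le_one _)) ?_)
      rw [abs_mul, abs_of_nonneg hn]
      exact mul_le_of_le_one_right hn (hprod (abs_sin_le_one x) (abs_sin_le_one _))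
    · rw [abs_mul, abs_of_nonneg (by linarith)]
      exact mul_le_of_le_one_right (by linarith) (abs_cos_le_one _)
  · refine (hcomb (U := (1 + n ^ 2) + 2 * n) (V := (n + 1) ^ 2) ?_ ?_).trans (by linarith)
    · refine (abs_sub _ _).trans (add_le_add ?_ ?_)
      · rw [abs_neg, abs_mul, abs_of_nonneg (by positivity)]
        exact mul_le_of_le_one_right (by positivity)
          (hprod (abs_sin_le_one x) (abs_cos_le_one _))
      · rw [abs_mul, abs_of_nonneg (by positivity)]
        exact mul_le_of_le_one_right (by positivity)
          (hprod (abs_cos_le_one x) (abs_sin_le_one _))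
    · rw [abs_neg, abs_mul, abs_of_nonneg (by positivity)]
      exact mul_le_of_le_one_right (by positivity) (abs_sin_le_one _)

theorem angularPhi_zero (q n : ℕ) : angularPhi q n 0 = 0 := by
  simp [angularPhi]

theorem angularPhi_pi (q n : ℕ) : angularPhi q n π = 0 := by
  have : sin (((n : ℝ) + 1) * π) = 0 := by exact_mod_cast sin_nat_mul_pi (n + 1)
  simp [angularPhi, this]

theorem Psi_mul_Phi_comp_cos {q : ℕ} (hq : 2 ≤ q) (n : ℕ) {θ : ℝ} (hθ : θ ∈ Set.Icc 0 π) :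
    2 * √q * sin θ * (Psi q (2 * √q * cos θ) * Phi q n (2 * √q * cos θ))
      = sin θ * ((q : ℝ) ^ (-(n : ℝ) / 2) * (angularWeight q θ * angularPhi q n θ)) := by
  have hq0 : (0 : ℝ) < q := by exact_mod_cast (by omega : 0 < q)
  have hr : √(q : ℝ) ^ 2 = q := sq_sqrt hq0.le
  have hr0 : 0 < √(q : ℝ) := sqrt_pos.2 hq0
  have h1 : √(4 * q - (2 * √q * cos θ) ^ 2) = 2 * √q * sin θ := by
    have : 4 * (q : ℝ) - (2 * √q * cos θ) ^ 2 = (2 * √q * sin θ) ^ 2 := by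
      linear_combination (-4 * (cos θ ^ 2 + sin θ ^ 2)) * hr - 4 * q * sin_sq_add_cos_sq θ
    rw [this, sqrt_sq (mul_nonneg (by positivity) (sin_nonneg_of_mem_Icc hθ))]
  have h2 : (2 * √(q : ℝ) * cos θ) ^ 2 = 4 * q * cos θ ^ 2 := by
    linear_combination (4 * cos θ ^ 2) * hr
  have h3 : 2 * √(q : ℝ) * cos θ / (2 * √q) = cos θ := mul_div_cancel_left₀ _ (by positivity)
  have hT := Polynomial.Chebyshev.T_real_cos θ (n : ℤ)
  have hU := Polynomial.Chebyshev.U_real_cos θ (n : ℤ)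
  rw [Int.cast_natCast] at hT hU
  have hD := (angularWeight_denom_pos hq (cos_sq_le_one θ)).ne'
  unfold Psi Phi angularWeight angularPhi
  rw [h1, h2, h3, hT, ← hU]
  generalize 2 * (((q : ℝ) + 1) ^ 2 - 4 * q * cos θ ^ 2) = D at hD ⊢
  field_simp
  rw [hr]
  ring

theorem integral_Psi_mul_Phi_eq {q : ℕ} (hq : 2 ≤ q) (n : ℕ) (t : ℝ) :
    (∫ l in (-(2 * √q))..(2 * √q),
        Complex.exp (Complex.I * t * l) * (Psi q l * Phi q n l : ℂ))
      = ∫ θ in 0..π, Complex.exp (Complex.I * (2 * √q * t : ℝ) * (cos θ : ℝ)) *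
          (sin θ * ((q : ℝ) ^ (-(n : ℝ) / 2) * (angularWeight q θ * angularPhi q n θ)) : ℝ) := by
  have hr0 : 0 ≤ √(q : ℝ) := sqrt_nonneg _
  have hr : √(q : ℝ) ^ 2 = q := sq_sqrt q.cast_nonneg
  have hcont : ContinuousOn
      (fun l : ℝ ↦ Complex.exp (Complex.I * t * l) * (Psi q l * Phi q n l : ℂ))
      ((fun θ ↦ 2 * √q * cos θ) '' Set.uIcc 0 π) := by
    have hPsi : ContinuousOn (Psi q) ((fun θ ↦ 2 * √q * cos θ) '' Set.uIcc 0 π) := by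
      refine ContinuousOn.div (by fun_prop) (by fun_prop) ?_
      rintro _ ⟨θ, -, rfl⟩
      have := (angularWeight_denom_pos hq (cos_sq_le_one θ)).ne'
      simp only [mul_pow, hr]
      convert! this using 4
      norm_num
    have hPhi : Continuous (Phi q n) := by
      unfold Phi
      fun_prop
    exact ContinuousOn.mul (by fun_prop)
      ((Complex.continuous_ofReal.comp_continuousOn hPsi).mul (by fun_prop))
  have h := integral_deriv_smul_comp'' (a := 0) (b := π) (f := fun θ ↦ 2 * √q * cos θ)
    (f' := fun θ ↦ 2 * √q * -sin θ) (by fun_prop)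
    (fun x _ ↦ ((hasDerivAt_cos x).const_mul (2 * √(q : ℝ))).hasDerivWithinAt)
    (by fun_prop) hcont
  simp only [cos_zero, cos_pi, mul_one, mul_neg_one] at h
  rw [integral_symm, ← h, ← intervalIntegral.integral_neg]
  refine integral_congr fun θ hθ ↦ ?_
  rw [Set.uIcc_of_le pi_pos.le] at hθ
  simp only [Function.comp]
  rw [← Psi_mul_Phi_comp_cos hq n hθ, Complex.real_smul]
  push_cast
  rw [show Complex.I * t * (2 * (√q : ℝ) * Complex.cos θ)
    = Complex.I * (2 * (√q : ℝ) * t) * Complex.cos θ by ring]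
  ring

/-- The sharp dispersive estimate: there are `C_q > 0` and `t₀ > 0` such that for all
`t ≥ t₀` and all `n`,
`|(1/π)∫_{−2√q}^{2√q} e^{itλ} Ψ(λ)Φ_n(λ) dλ| ≤ C_q t^{−3/2}`. -/
theorem dispersive_estimate (q : ℕ) (hq : 2 ≤ q) :
    ∃ C t₀ : ℝ, 0 < C ∧ 0 < t₀ ∧ ∀ t ≥ t₀, ∀ n : ℕ,
      ‖(1/Real.pi : ℂ) * (∫ l in (-(2*Real.sqrt q))..(2*Real.sqrt q),
          Complex.exp (Complex.I * t * l) * (Psi q l * Phi q n l : ℂ))‖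
        ≤ C * t ^ (-(3:ℝ)/2) := by
  have hq' : (2 : ℝ) ≤ q := by exact_mod_cast hq
  have hq0 : (0 : ℝ) < q := by linarith
  obtain ⟨w', w'', W, hW, hw, hw', hw'', hWb⟩ := exists_angularWeight_bounds hq
  obtain ⟨K, hK⟩ := exists_pow_two_mul_pow_le (r := (q : ℝ) ^ (-(1 : ℝ) / 2))
    (rpow_pos_of_pos hq0 _) (rpow_lt_one_of_one_lt_of_neg (by linarith) (by norm_num))
  have hKpos : 0 < K := lt_of_lt_of_le (by simp) (hK 0)
  refine ⟨14 * (8 * W * K), 1, by positivity, one_pos, fun t ht n ↦ ?_⟩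
  obtain ⟨B', B'', hB, hB', hB'', hBb⟩ := exists_angularPhi_bounds hq n
  have ht0 : 0 < t := by linarith
  have hts : t ≤ 2 * √q * t := by
    have : 1 ≤ √(q : ℝ) := one_le_sqrt.2 (by linarith)
    nlinarith
  set c := (q : ℝ) ^ (-(n : ℝ) / 2) with hc
  have hc0 : 0 ≤ c := rpow_nonneg hq0.le _
  have hcK : c * ((n : ℝ) + 1) ^ 2 ≤ K := by
    refine le_of_eq_of_le ?_ (hK n)
    rw [← rpow_natCast _ n, ← rpow_mul hq0.le, hc]
    congr 2
    ring
  have hn : (0 : ℝ) ≤ n := n.cast_nonneg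
  have hmul : ∀ {u v U V : ℝ}, |u| ≤ U → |v| ≤ V → |u * v| ≤ U * V := fun hu hv ↦ by
    rw [abs_mul]
    exact mul_le_mul hu hv (abs_nonneg _) ((abs_nonneg _).trans hu)
  have hfin : ∀ {y : ℝ}, |y| ≤ 8 * W * ((n : ℝ) + 1) ^ 2 → |c * y| ≤ 8 * W * K := by
    intro y hy
    rw [abs_mul, abs_of_nonneg hc0]
    calc c * |y| ≤ c * (8 * W * ((n : ℝ) + 1) ^ 2) := by gcongr
      _ = 8 * W * (c * ((n : ℝ) + 1) ^ 2) := by ring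
      _ ≤ 8 * W * K := by gcongr
  have key := norm_integral_exp_I_mul_cos_mul_sin_le (s := 2 * √q * t) (M := 8 * W * K)
    (ht.trans hts)
    (H := fun θ ↦ c * (angularWeight q θ * angularPhi q n θ))
    (H' := fun θ ↦ c * (w' θ * angularPhi q n θ + angularWeight q θ * B' θ))
    (H'' := fun θ ↦ c * ((w'' θ * angularPhi q n θ + w' θ * B' θ)
      + (w' θ * B' θ + angularWeight q θ * B'' θ)))
    (fun x ↦ ((hw x).mul (hB x)).const_mul c)
    (fun x ↦ (((hw' x).mul (hB x)).add ((hw x).mul (hB' x))).const_mul c)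
    (by
      have c1 : Continuous (angularWeight q) := (contDiff_angularWeight hq).continuous
      have c2 : Continuous w' := continuous_iff_continuousAt.2 fun x ↦ (hw' x).continuousAt
      have c3 : Continuous (angularPhi q n) :=
        continuous_iff_continuousAt.2 fun x ↦ (hB x).continuousAt
      have c4 : Continuous B' := continuous_iff_continuousAt.2 fun x ↦ (hB' x).continuousAt
      fun_prop)
    (by simp [angularPhi_zero]) (by simp [angularPhi_pi])
    (fun x hx ↦ by
      obtain ⟨a0, a1, -⟩ := hWb x hx
      obtain ⟨b0, b1, -⟩ := hBb x
      refine hfin ((abs_add_le _ _).trans ((add_le_add (hmul a1 b0) (hmul a0 b1)).trans ?_))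
      nlinarith [mul_nonneg hW.le hn, mul_nonneg hW.le (mul_nonneg hn hn)])
    (fun x hx ↦ by
      obtain ⟨a0, a1, a2⟩ := hWb x hx
      obtain ⟨b0, b1, b2⟩ := hBb x
      refine hfin ((abs_add_le _ _).trans ((add_le_add
        ((abs_add_le _ _).trans (add_le_add (hmul a2 b0) (hmul a1 b1)))
        ((abs_add_le _ _).trans (add_le_add (hmul a1 b1) (hmul a0 b2)))).trans ?_))
      nlinarith [mul_nonneg hW.le hn, mul_nonneg hW.le (mul_nonneg hn hn)])
  rw [integral_Psi_mul_Phi_eq hq, norm_mul]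
  have hpi : ‖(1 / π : ℂ)‖ ≤ 1 := by
    rw [norm_div, norm_one, Complex.norm_real, Real.norm_of_nonneg pi_pos.le,
      div_le_one pi_pos]
    linarith [pi_gt_three]
  refine (mul_le_of_le_one_left (norm_nonneg _) hpi).trans (key.trans ?_)
  gcongr 14 * (8 * W * K) * ?_
  exact rpow_le_rpow_of_nonpos ht0 hts (by norm_num)
end

section
/- Let q ≥ 2 be an integer and Ψ(λ) = (q+1)√(4q − λ²)/(2((q+1)² − λ²)) on [−2√q, 2√q]. Then, as t → ∞, ∫_{−2√q}^{2√q} e^{itλ} Ψ'(λ) dλ = i (π/(√q · t))^{1/2} · sin(2√q t − π/4) · (−√q (q+1)/(q−1)²) + O(t^{−1}). -/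
open MeasureTheory intervalIntegral Real

lemma integrableOn_Ioi_rpow_mul_exp {z : ℂ} (hz : 0 < z.re) :
    IntegrableOn (fun u : ℝ ↦ ((u ^ (-1 / 2 : ℝ) : ℝ) : ℂ) * Complex.exp (-(z * u)))
      (Set.Ioi 0) := by
  have h := integrableOn_rpow_mul_exp_neg_mul_rpow (s := -1 / 2) (p := 1) (by norm_num)
    one_pos hz
  refine h.mono' (by measurability) ?_
  filter_upwards [ae_restrict_mem measurableSet_Ioi] with u hu
  have hu : 0 < u := hu
  simp [Complex.norm_exp, abs_of_pos (rpow_pos_of_pos hu _)]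

/-- The tail of the Laplace transform of `u ^ (-1/2)`, uniformly in the half plane. -/
lemma norm_integral_Ioi_rpow_mul_exp_le {z : ℂ} (hz : 0 < z.re) {x : ℝ} (hx : 0 < x) :
    ‖∫ u in Set.Ioi x, ((u ^ (-1 / 2 : ℝ) : ℝ) : ℂ) * Complex.exp (-(z * u))‖
      ≤ 2 * x ^ (-1 / 2 : ℝ) / ‖z‖ := by
  have hz0 : z ≠ 0 := by rintro rfl; simp at hz
  have hzn : 0 < ‖z‖ := norm_pos_iff.2 hz0
  have hexp : ∀ u : ℝ, 0 < u → ‖Complex.exp (-(z * u))‖ ≤ 1 := by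
    intro u hu
    rw [Complex.norm_exp]
    simp
    positivity
  have hint1 := (integrableOn_Ioi_rpow_mul_exp hz).mono_set (Set.Ioi_subset_Ioi hx.le)
  have hb := (integrableOn_Ioi_rpow_of_lt (a := -3 / 2) (by norm_num) hx)
  have hle : ∀ u ∈ Set.Ioi x,
      ‖((u ^ (-3 / 2 : ℝ) : ℝ) : ℂ) * Complex.exp (-(z * u))‖ ≤ u ^ (-3 / 2 : ℝ) := by
    intro u hu
    have hu : 0 < u := hx.trans hu
    have h0 := rpow_pos_of_pos hu (-3 / 2 : ℝ)
    rw [norm_mul, Complex.norm_real, Real.norm_of_nonneg h0.le]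
    exact mul_le_of_le_one_right h0.le (hexp u hu)
  have hint2 : IntegrableOn
      (fun u : ℝ ↦ ((u ^ (-3 / 2 : ℝ) : ℝ) : ℂ) * Complex.exp (-(z * u))) (Set.Ioi x) := by
    refine hb.mono' (by measurability) ?_
    filter_upwards [ae_restrict_mem measurableSet_Ioi] with u hu using hle u hu
  have hder : ∀ u ∈ Set.Ici x, HasDerivAt
      (fun u : ℝ ↦ ((u ^ (-1 / 2 : ℝ) : ℝ) : ℂ) * Complex.exp (-(z * u)))
      (-(1 / 2) * (((u ^ (-3 / 2 : ℝ) : ℝ) : ℂ) * Complex.exp (-(z * u)))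
        - z * (((u ^ (-1 / 2 : ℝ) : ℝ) : ℂ) * Complex.exp (-(z * u)))) u := by
    intro u hu
    have hu : 0 < u := hx.trans_le hu
    have h1 := (hasDerivAt_rpow_const (x := u) (p := -1 / 2) (Or.inl hu.ne')).ofReal_comp
    have h2 : HasDerivAt (fun u : ℝ ↦ Complex.exp (-(z * u)))
        (Complex.exp (-(z * u)) * -(z * 1)) u :=
      (((hasDerivAt_id u).ofReal_comp.const_mul z).neg).cexp
    convert! h1.mul h2 using 1
    rw [show (-1 / 2 - 1 : ℝ) = -3 / 2 by norm_num]
    push_cast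
    ring
  have hlim : Filter.Tendsto
      (fun u : ℝ ↦ ((u ^ (-1 / 2 : ℝ) : ℝ) : ℂ) * Complex.exp (-(z * u)))
      Filter.atTop (nhds 0) := by
    rw [tendsto_zero_iff_norm_tendsto_zero]
    have h0 := tendsto_rpow_neg_atTop (y := 1 / 2) (by norm_num)
    refine squeeze_zero' (Filter.Eventually.of_forall fun _ ↦ norm_nonneg _) ?_ h0
    filter_upwards [Filter.eventually_gt_atTop 0] with u hu
    have h0 := rpow_pos_of_pos hu (-1 / 2 : ℝ)
    rw [norm_mul, Complex.norm_real, Real.norm_of_nonneg h0.le, ← neg_div]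
    exact mul_le_of_le_one_right h0.le (hexp u hu)
  have key := integral_Ioi_of_hasDerivAt_of_tendsto' hder
    ((hint2.const_mul _).sub (hint1.const_mul _)) hlim
  rw [MeasureTheory.integral_sub (hint2.const_mul _) (hint1.const_mul _),
    MeasureTheory.integral_const_mul,
    MeasureTheory.integral_const_mul] at key
  have hn2 : ‖∫ u in Set.Ioi x, ((u ^ (-3 / 2 : ℝ) : ℝ) : ℂ) * Complex.exp (-(z * u))‖
      ≤ 2 * x ^ (-1 / 2 : ℝ) := by
    refine (norm_integral_le_of_norm_le hb
      ((ae_restrict_mem measurableSet_Ioi).mono hle)).trans_eq ?_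
    rw [integral_Ioi_rpow_of_lt (by norm_num) hx]
    norm_num
    ring
  set A := ∫ u in Set.Ioi x, ((u ^ (-3 / 2 : ℝ) : ℝ) : ℂ) * Complex.exp (-(z * u))
  set B := ∫ u in Set.Ioi x, ((u ^ (-1 / 2 : ℝ) : ℝ) : ℂ) * Complex.exp (-(z * u))
  set w := ((x ^ (-1 / 2 : ℝ) : ℝ) : ℂ) * Complex.exp (-(z * x))
  have hw : ‖w‖ ≤ x ^ (-1 / 2 : ℝ) := by
    have h0 := rpow_pos_of_pos hx (-1 / 2 : ℝ)
    rw [norm_mul, Complex.norm_real, Real.norm_of_nonneg h0.le]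
    exact mul_le_of_le_one_right h0.le (hexp x hx)
  have hzB : z * B = w - (1 / 2) * A := by linear_combination -key
  have : ‖z‖ * ‖B‖ ≤ 2 * x ^ (-1 / 2 : ℝ) := by
    rw [← norm_mul, hzB]
    refine (norm_sub_le _ _).trans ?_
    have hA : ‖1 / 2 * A‖ = 1 / 2 * ‖A‖ := by rw [norm_mul]; norm_num
    linarith
  rw [le_div_iff₀ hzn]
  linarith


lemma integral_Ioi_rpow_mul_exp {z : ℂ} (hz : 0 < z.re) :
    ∫ u in Set.Ioi (0 : ℝ), ((u ^ (-1 / 2 : ℝ) : ℝ) : ℂ) * Complex.exp (-(z * u))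
      = (π / z : ℂ) ^ (1 / 2 : ℂ) := by
  have h := integral_comp_rpow_Ioi (fun y : ℝ ↦ Complex.exp (-z * (y : ℂ) ^ 2))
    (p := 1 / 2) (by norm_num)
  rw [integral_gaussian_complex_Ioi hz] at h
  have h2 : ∫ u in Set.Ioi (0 : ℝ), ((u ^ (-1 / 2 : ℝ) : ℝ) : ℂ) * Complex.exp (-(z * u))
      = ∫ u in Set.Ioi (0 : ℝ), 2 * ((|1 / 2| * u ^ (1 / 2 - 1 : ℝ)) •
          Complex.exp (-z * ((u ^ (1 / 2 : ℝ) : ℝ) : ℂ) ^ 2)) := by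
    refine setIntegral_congr_fun measurableSet_Ioi fun u hu ↦ ?_
    have hu : 0 < u := hu
    have hs : (((u ^ (1 / 2 : ℝ) : ℝ) : ℂ)) ^ 2 = u := by
      rw [← Complex.ofReal_pow, ← sqrt_eq_rpow, sq_sqrt hu.le]
    simp only [hs, Complex.real_smul, show (1 / 2 - 1 : ℝ) = -1 / 2 by norm_num]
    rw [abs_of_pos (by norm_num)]
    push_cast
    ring_nf
  rw [h2, MeasureTheory.integral_const_mul, h]
  ring

lemma intervalIntegrable_rpow_mul_exp (z : ℂ) (x y : ℝ) :
    IntervalIntegrable (fun u : ℝ ↦ ((u ^ (-1 / 2 : ℝ) : ℝ) : ℂ) * Complex.exp (-(z * u)))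
      volume x y := by
  have h : IntervalIntegrable (fun u : ℝ ↦ u ^ (-1 / 2 : ℝ)) volume x y :=
    intervalIntegrable_rpow' (by norm_num)
  have h' : IntervalIntegrable (fun u : ℝ ↦ ((u ^ (-1 / 2 : ℝ) : ℝ) : ℂ)) volume x y :=
    ⟨h.1.ofReal, h.2.ofReal⟩
  exact h'.mul_continuousOn (by fun_prop)

lemma norm_integral_rpow_mul_exp_sub_le_of_re_pos {z : ℂ} (hz : 0 < z.re) {x : ℝ} (hx : 0 < x) :
    ‖(∫ u in (0 : ℝ)..x, ((u ^ (-1 / 2 : ℝ) : ℝ) : ℂ) * Complex.exp (-(z * u)))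
      - (π / z : ℂ) ^ (1 / 2 : ℂ)‖ ≤ 2 * x ^ (-1 / 2 : ℝ) / ‖z‖ := by
  have hi := integrableOn_Ioi_rpow_mul_exp hz
  rw [← integral_Ioi_rpow_mul_exp hz,
    ← integral_interval_add_Ioi hi (hi.mono_set (Set.Ioi_subset_Ioi hx.le)),
    sub_add_cancel_left, norm_neg]
  exact norm_integral_Ioi_rpow_mul_exp_le hz hx

lemma pi_div_I_mul (t : ℝ) : (π / (Complex.I * t) : ℂ) = ((π / t : ℝ) : ℂ) * (-Complex.I) := by
  push_cast
  field_simp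
  simp
  ring

lemma pi_div_I_mul_cpow_half {t : ℝ} (ht : 0 < t) :
    (π / (Complex.I * t) : ℂ) ^ (1 / 2 : ℂ)
      = ((√(π / t) : ℝ) : ℂ) * Complex.exp (-(Complex.I * (π / 4))) := by
  have hp : 0 < π / t := by positivity
  have hpc : ((π / t : ℝ) : ℂ) ≠ 0 := by exact_mod_cast hp.ne'
  rw [pi_div_I_mul, Complex.cpow_def_of_ne_zero (by simpa using hpc),
    Complex.log_ofReal_mul hp (by simp), Complex.log_neg_I, sqrt_eq_rpow,
    rpow_def_of_pos hp, Complex.ofReal_exp, ← Complex.exp_add]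
  congr 1
  push_cast
  ring

lemma norm_integral_rpow_mul_exp_sub_le {t : ℝ} (ht : 0 < t) {x : ℝ} (hx : 0 < x) :
    ‖(∫ u in (0 : ℝ)..x, ((u ^ (-1 / 2 : ℝ) : ℝ) : ℂ) * Complex.exp (-(Complex.I * t * u)))
      - ((√(π / t) : ℝ) : ℂ) * Complex.exp (-(Complex.I * (π / 4)))‖
      ≤ 2 * x ^ (-1 / 2 : ℝ) / t := by
  rw [← pi_div_I_mul_cpow_half ht]
  let z : ℝ → ℂ := fun ε ↦ ε + Complex.I * t
  have hz0 : z 0 = Complex.I * t := by simp [z]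
  have hzt : ‖z 0‖ = t := by rw [hz0]; simp [abs_of_pos ht]
  have hzne : z 0 ≠ 0 := by rw [hz0]; simp [ht.ne']
  have hzc : Continuous z := by fun_prop
  have hre : ∀ ε, (z ε).re = ε := by intro ε; simp [z]
  rw [← hz0, ← hzt]
  refine le_of_tendsto_of_tendsto (b := nhdsWithin 0 (Set.Ioi 0))
    (f := fun ε ↦ ‖(∫ u in (0 : ℝ)..x, ((u ^ (-1 / 2 : ℝ) : ℝ) : ℂ) * Complex.exp (-(z ε * u)))
      - (π / z ε : ℂ) ^ (1 / 2 : ℂ)‖)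
    (g := fun ε ↦ 2 * x ^ (-1 / 2 : ℝ) / ‖z ε‖) ?_ ?_ ?_
  · refine (Filter.Tendsto.sub ?_ ?_).norm
    · refine continuousWithinAt_of_dominated_interval (bound := fun u ↦ u ^ (-1 / 2 : ℝ)) ?_ ?_
        (intervalIntegrable_rpow' (by norm_num)) ?_
      · exact Filter.Eventually.of_forall fun ε ↦
          (by fun_prop : Measurable fun u : ℝ ↦
            ((u ^ (-1 / 2 : ℝ) : ℝ) : ℂ) * Complex.exp (-(z ε * u))).aestronglyMeasurable
      · filter_upwards [self_mem_nhdsWithin] with ε hε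
        refine Filter.Eventually.of_forall fun u hu ↦ ?_
        rw [Set.uIoc_of_le hx.le] at hu
        have h0 := rpow_pos_of_pos hu.1 (-1 / 2 : ℝ)
        rw [norm_mul, Complex.norm_real, Real.norm_of_nonneg h0.le]
        refine mul_le_of_le_one_right h0.le ?_
        have := hu.1
        have hε : 0 < ε := hε
        rw [Complex.norm_exp]
        simp [hre]
        positivity
      · exact Filter.Eventually.of_forall fun u hu ↦ by fun_prop
    · refine ContinuousAt.continuousWithinAt ?_ |>.tendsto
      refine ContinuousAt.cpow (continuousAt_const.div hzc.continuousAt hzne)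
        continuousAt_const ?_
      rw [hz0, pi_div_I_mul]
      right
      simp [ht.ne', pi_ne_zero]
  · exact (ContinuousAt.continuousWithinAt
      (continuousAt_const.div hzc.norm.continuousAt (norm_ne_zero_iff.2 hzne))).tendsto
  · filter_upwards [self_mem_nhdsWithin] with ε hε
    exact norm_integral_rpow_mul_exp_sub_le_of_re_pos (by rw [hre]; exact hε) hx

lemma norm_integral_rpow_mul_exp_mul_sub_le {a : ℝ} (ha : 0 < a) {G : ℝ → ℝ}
    (hG : ∀ u ∈ Set.Icc 0 a, ContDiffAt ℝ 1 G u) :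
    ∃ C : ℝ, 0 ≤ C ∧ ∀ t : ℝ, 0 < t →
      ‖(∫ u in (0 : ℝ)..a, (G u : ℂ) *
          (((u ^ (-1 / 2 : ℝ) : ℝ) : ℂ) * Complex.exp (-(Complex.I * t * u))))
        - ((√(π / t) : ℝ) : ℂ) * Complex.exp (-(Complex.I * (π / 4))) * G 0‖ ≤ C / t := by
  have hGd : ∀ u ∈ Set.Icc 0 a, HasDerivAt (fun u ↦ (G u : ℂ)) ((deriv G u : ℝ) : ℂ) u :=
    fun u hu ↦ ((hG u hu).differentiableAt (by norm_num)).hasDerivAt.ofReal_comp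
  have hG' : ContinuousOn (deriv G) (Set.Icc 0 a) := fun u hu ↦
    ((hG u hu).derivWithin (m := 0) (by norm_num)).continuousAt.continuousWithinAt
  obtain ⟨M, hM⟩ := isCompact_Icc.exists_bound_of_continuousOn hG'
  have hM0 : 0 ≤ M := (norm_nonneg _).trans (hM 0 ⟨le_rfl, ha.le⟩)
  have hrp : IntervalIntegrable (fun u : ℝ ↦ u ^ (-1 / 2 : ℝ)) volume 0 a :=
    intervalIntegrable_rpow' (by norm_num)
  have hJ0 : 0 ≤ ∫ u in (0 : ℝ)..a, u ^ (-1 / 2 : ℝ) :=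
    integral_nonneg ha.le fun u hu ↦ rpow_nonneg hu.1 _
  refine ⟨|G a| * (2 * a ^ (-1 / 2 : ℝ)) + M * 2 * ∫ u in (0 : ℝ)..a, u ^ (-1 / 2 : ℝ),
    by positivity, fun t ht ↦ ?_⟩
  set S : ℂ := ((√(π / t) : ℝ) : ℂ) * Complex.exp (-(Complex.I * (π / 4)))
  set p : ℝ → ℂ := fun u ↦ ((u ^ (-1 / 2 : ℝ) : ℝ) : ℂ) * Complex.exp (-(Complex.I * t * u))
    with hp
  have hpi : ∀ x y, IntervalIntegrable p volume x y := intervalIntegrable_rpow_mul_exp _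
  set v : ℝ → ℂ := fun u ↦ (∫ w in (0 : ℝ)..u, p w) - S with hv
  have hvb : ∀ u, 0 < u → ‖v u‖ ≤ 2 * u ^ (-1 / 2 : ℝ) / t :=
    fun u hu ↦ norm_integral_rpow_mul_exp_sub_le ht hu
  have hvc : Continuous v := (continuous_primitive hpi 0).sub continuous_const
  have hpm : Measurable p := by fun_prop
  have hvd : ∀ u, 0 < u → HasDerivAt v (p u) u := by
    intro u hu
    refine (integral_hasDerivAt_right (hpi 0 u)
      hpm.stronglyMeasurable.stronglyMeasurableAtFilter ?_).sub_const S
    refine ContinuousAt.mul ?_ (by fun_prop)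
    exact Complex.continuous_ofReal.continuousAt.comp
      (continuousAt_rpow_const u _ (Or.inl hu.ne'))
  have hGc' : ContinuousOn (fun u ↦ ((deriv G u : ℝ) : ℂ)) (Set.uIcc 0 a) := by
    rw [Set.uIcc_of_le ha.le]
    exact Complex.continuous_ofReal.comp_continuousOn hG'
  have key := integral_mul_deriv_eq_deriv_mul_of_hasDerivAt (a := 0) (b := a)
    (u := fun u ↦ (G u : ℂ)) (v := v) (u' := fun u ↦ ((deriv G u : ℝ) : ℂ)) (v' := p)
    (by
      rw [Set.uIcc_of_le ha.le]
      exact fun u hu ↦ (hGd u hu).continuousAt.continuousWithinAt)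
    hvc.continuousOn
    (by
      rw [min_eq_left ha.le, max_eq_right ha.le]
      exact fun u hu ↦ hGd u (Set.Ioo_subset_Icc_self hu))
    (by
      rw [min_eq_left ha.le, max_eq_right ha.le]
      exact fun u hu ↦ hvd u hu.1)
    hGc'.intervalIntegrable (hpi 0 a)
  have hv0 : v 0 = -S := by simp [hv]
  have hint : ‖∫ u in (0 : ℝ)..a, ((deriv G u : ℝ) : ℂ) * v u‖
      ≤ ∫ u in (0 : ℝ)..a, M * 2 / t * u ^ (-1 / 2 : ℝ) := by
    refine norm_integral_le_of_norm_le ha.le (Filter.Eventually.of_forall fun u hu ↦ ?_)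
      (hrp.const_mul _)
    rw [norm_mul, Complex.norm_real]
    calc ‖deriv G u‖ * ‖v u‖ ≤ M * (2 * u ^ (-1 / 2 : ℝ) / t) :=
          mul_le_mul (hM u (Set.Ioc_subset_Icc_self hu)) (hvb u hu.1) (norm_nonneg _) hM0
      _ = _ := by ring
  rw [key, hv0]
  rw [intervalIntegral.integral_const_mul] at hint
  have hva := mul_le_mul_of_nonneg_left (hvb a ha) (abs_nonneg (G a))
  calc ‖(G a : ℂ) * v a - G 0 * -S - (∫ u in (0 : ℝ)..a, ((deriv G u : ℝ) : ℂ) * v u) - S * G 0‖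
      = ‖(G a : ℂ) * v a - ∫ u in (0 : ℝ)..a, ((deriv G u : ℝ) : ℂ) * v u‖ := by
        congr 1; ring
    _ ≤ |G a| * ‖v a‖ + ‖∫ u in (0 : ℝ)..a, ((deriv G u : ℝ) : ℂ) * v u‖ := by
        refine (norm_sub_le _ _).trans_eq ?_
        rw [norm_mul, Complex.norm_real, Real.norm_eq_abs]
    _ ≤ _ := (add_le_add hva hint).trans_eq (by ring)

/-- The regular factor of `Psi q` at the right endpoint `2√q`, in the variable `u = 2√q - λ`. -/
noncomputable def PsiFactor (q : ℕ) (u : ℝ) : ℝ :=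
  ((q : ℝ) + 1) * √(2 * (2 * √q) - u) / (2 * (((q : ℝ) + 1) ^ 2 - (2 * √q - u) ^ 2))

/-- The regular factor of the derivative of `Psi q` at the right endpoint. -/
noncomputable def PsiDerivFactor (q : ℕ) (u : ℝ) : ℝ :=
  -(PsiFactor q u / 2 + u * deriv (PsiFactor q) u)

lemma Psi_two_sqrt_sub (q : ℕ) {u : ℝ} (hu : 0 ≤ u) :
    Psi q (2 * √q - u) = √u * PsiFactor q u := by
  have h : 4 * (q : ℝ) - (2 * √q - u) ^ 2 = u * (2 * (2 * √q) - u) := by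
    nlinarith [sq_sqrt (Nat.cast_nonneg (α := ℝ) q)]
  rw [Psi, PsiFactor, h, sqrt_mul hu]
  ring

lemma two_sqrt_pos {q : ℕ} (hq : 2 ≤ q) : 0 < 2 * √(q : ℝ) := by
  have : (0 : ℝ) < q := by exact_mod_cast (by omega : 0 < q)
  positivity

lemma contDiffAt_PsiFactor {q : ℕ} (hq : 2 ≤ q) {u : ℝ} (hu : u ∈ Set.Icc 0 (2 * √(q : ℝ))) :
    ContDiffAt ℝ 2 (PsiFactor q) u := by
  have ha := two_sqrt_pos hq
  have hq' : (2 : ℝ) ≤ q := by exact_mod_cast hq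
  have hs := sq_sqrt (Nat.cast_nonneg (α := ℝ) q)
  have h1 : 2 * (2 * √(q : ℝ)) - u ≠ 0 := by linarith [hu.2]
  have h2 : 2 * (((q : ℝ) + 1) ^ 2 - (2 * √q - u) ^ 2) ≠ 0 := by
    have : (2 * √(q : ℝ) - u) ^ 2 ≤ (2 * √(q : ℝ)) ^ 2 :=
      pow_le_pow_left₀ (by linarith [hu.2]) (by linarith [hu.1]) 2
    nlinarith
  unfold PsiFactor
  exact ContDiffAt.div (contDiffAt_const.mul (ContDiffAt.sqrt (by fun_prop) h1))
    (by fun_prop) h2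

lemma contDiffAt_PsiDerivFactor {q : ℕ} (hq : 2 ≤ q) {u : ℝ}
    (hu : u ∈ Set.Icc 0 (2 * √(q : ℝ))) : ContDiffAt ℝ 1 (PsiDerivFactor q) u := by
  have h := contDiffAt_PsiFactor hq hu
  exact ((h.of_le (by norm_num)).div_const 2 |>.add
    (contDiffAt_id.mul (h.derivWithin (m := 1) (by norm_num)))).neg

lemma deriv_Psi_two_sqrt_sub {q : ℕ} (hq : 2 ≤ q) {u : ℝ}
    (hu : u ∈ Set.Ioc 0 (2 * √(q : ℝ))) :
    deriv (Psi q) (2 * √q - u) = u ^ (-1 / 2 : ℝ) * PsiDerivFactor q u := by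
  have hu0 := hu.1
  have h1 : (fun v ↦ Psi q (2 * √q - v)) =ᶠ[nhds u] fun v ↦ √v * PsiFactor q v := by
    filter_upwards [lt_mem_nhds hu0] with v hv using Psi_two_sqrt_sub q hv.le
  have h2 : HasDerivAt (fun v ↦ √v * PsiFactor q v)
      (1 / (2 * √u) * PsiFactor q u + √u * deriv (PsiFactor q) u) u :=
    (hasDerivAt_sqrt hu0.ne').mul
      ((contDiffAt_PsiFactor hq (Set.Ioc_subset_Icc_self hu)).differentiableAt
        (by norm_num)).hasDerivAt
  have h3 := h1.deriv_eq.trans h2.deriv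
  rw [deriv_comp_const_sub] at h3
  have h4 : u ^ (-1 / 2 : ℝ) = 1 / √u := by
    rw [sqrt_eq_rpow, one_div, ← rpow_neg hu0.le, neg_div]
  rw [neg_eq_iff_eq_neg] at h3
  rw [h3, h4, PsiDerivFactor]
  linear_combination deriv (PsiFactor q) u * div_sqrt (x := u)

lemma deriv_Psi_neg (q : ℕ) (l : ℝ) : deriv (Psi q) (-l) = -deriv (Psi q) l := by
  have h : (fun x ↦ Psi q (-x)) = Psi q := by
    ext x
    simp [Psi]
  rw [← neg_eq_iff_eq_neg, ← deriv_comp_neg, h]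

lemma exp_mul_deriv_Psi_two_sqrt_sub {q : ℕ} (hq : 2 ≤ q) (t : ℝ) {u : ℝ}
    (hu : u ∈ Set.Ioc 0 (2 * √(q : ℝ))) :
    Complex.exp (Complex.I * t * (2 * √q - u : ℝ)) * (deriv (Psi q) (2 * √q - u) : ℝ)
      = Complex.exp (Complex.I * t * (2 * √q : ℝ)) * ((PsiDerivFactor q u : ℂ) *
          (((u ^ (-1 / 2 : ℝ) : ℝ) : ℂ) * Complex.exp (-(Complex.I * t * u)))) := by
  rw [deriv_Psi_two_sqrt_sub hq hu,
    show Complex.I * t * ((2 * √q - u : ℝ) : ℂ)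
      = Complex.I * t * (2 * √q : ℝ) + -(Complex.I * t * u) by push_cast; ring, Complex.exp_add]
  push_cast
  ring

lemma intervalIntegrable_exp_mul_deriv_Psi {q : ℕ} (hq : 2 ≤ q) (t : ℝ) :
    IntervalIntegrable (fun l : ℝ ↦ Complex.exp (Complex.I * t * l) * (deriv (Psi q) l : ℝ))
      volume 0 (2 * √q) := by
  have ha := two_sqrt_pos hq
  have h : IntervalIntegrable (fun u : ℝ ↦ Complex.exp (Complex.I * t * (2 * √q - u : ℝ)) *
      (deriv (Psi q) (2 * √q - u) : ℝ)) volume 0 (2 * √q) := by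
    have hc : ContinuousOn (fun u ↦ (PsiDerivFactor q u : ℂ)) (Set.uIcc 0 (2 * √(q : ℝ))) := by
      rw [Set.uIcc_of_le ha.le]
      exact fun u hu ↦ (Complex.continuous_ofReal.continuousAt.comp
        (contDiffAt_PsiDerivFactor hq hu).continuousAt).continuousWithinAt
    refine (((intervalIntegrable_rpow_mul_exp (Complex.I * t) 0 _).continuousOn_mul hc).const_mul
      (Complex.exp (Complex.I * t * (2 * √q : ℝ)))).congr_ae ?_
    rw [Set.uIoc_of_le ha.le]
    filter_upwards [ae_restrict_mem measurableSet_Ioc] with u hu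
    exact (exp_mul_deriv_Psi_two_sqrt_sub hq t hu).symm
  have h' := (h.comp_sub_left (2 * √(q : ℝ))).symm
  simpa using h'

lemma integral_exp_mul_deriv_Psi_half {q : ℕ} (hq : 2 ≤ q) (t : ℝ) :
    ∫ l in (0 : ℝ)..(2 * √q), Complex.exp (Complex.I * t * l) * (deriv (Psi q) l : ℝ)
      = Complex.exp (Complex.I * t * (2 * √q : ℝ)) *
        ∫ u in (0 : ℝ)..(2 * √q), (PsiDerivFactor q u : ℂ) *
          (((u ^ (-1 / 2 : ℝ) : ℝ) : ℂ) * Complex.exp (-(Complex.I * t * u))) := by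
  have h := integral_comp_sub_left (a := 0) (b := 2 * √(q : ℝ))
    (fun l : ℝ ↦ Complex.exp (Complex.I * t * l) * (deriv (Psi q) l : ℝ)) (2 * √(q : ℝ))
  rw [sub_self, sub_zero] at h
  rw [← h, ← intervalIntegral.integral_const_mul]
  refine intervalIntegral.integral_congr_ae (Filter.Eventually.of_forall fun u hu ↦ ?_)
  rw [Set.uIoc_of_le (two_sqrt_pos hq).le] at hu
  exact exp_mul_deriv_Psi_two_sqrt_sub hq t hu

lemma integral_exp_mul_deriv_Psi {q : ℕ} (hq : 2 ≤ q) (t : ℝ) :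
    ∫ l in (-(2 * √q))..(2 * √q), Complex.exp (Complex.I * t * l) * (deriv (Psi q) l : ℝ)
      = (∫ l in (0 : ℝ)..(2 * √q), Complex.exp (Complex.I * t * l) * (deriv (Psi q) l : ℝ))
        - starRingEnd ℂ
          (∫ l in (0 : ℝ)..(2 * √q), Complex.exp (Complex.I * t * l) * (deriv (Psi q) l : ℝ)) := by
  have hconj : ∀ l : ℝ, Complex.exp (Complex.I * t * (-l : ℝ)) * (deriv (Psi q) (-l) : ℝ)
      = -starRingEnd ℂ (Complex.exp (Complex.I * t * l) * (deriv (Psi q) l : ℝ)) := by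
    intro l
    rw [map_mul, ← Complex.exp_conj, deriv_Psi_neg]
    simp
  have hi := intervalIntegrable_exp_mul_deriv_Psi hq t
  have hneg : IntervalIntegrable
      (fun l : ℝ ↦ Complex.exp (Complex.I * t * l) * (deriv (Psi q) l : ℝ))
      volume (-(2 * √q)) 0 := by
    rw [IntervalIntegrable.iff_comp_neg, neg_neg, neg_zero]
    convert! (intervalIntegrable_exp_mul_deriv_Psi hq (-t)).symm.neg using 1
    ext l
    simp [deriv_Psi_neg]
  rw [← integral_add_adjacent_intervals hneg hi]
  have h := integral_comp_neg (a := 0) (b := 2 * √(q : ℝ))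
    (fun l : ℝ ↦ Complex.exp (Complex.I * t * l) * (deriv (Psi q) l : ℝ))
  rw [neg_zero] at h
  rw [← h]
  simp_rw [hconj]
  rw [intervalIntegral.integral_neg, integral_of_le (two_sqrt_pos hq).le,
    integral_of_le (two_sqrt_pos hq).le, integral_conj]
  ring

lemma PsiDerivFactor_zero_mul {q : ℕ} (hq : 2 ≤ q) {t : ℝ} (ht : 0 < t) :
    2 * PsiDerivFactor q 0 * √(π / t)
      = (π / (√q * t)) ^ ((1 : ℝ) / 2) * (-√q * ((q : ℝ) + 1) / ((q : ℝ) - 1) ^ 2) := by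
  have hq' : (2 : ℝ) ≤ q := by exact_mod_cast hq
  have hs := sq_sqrt (Nat.cast_nonneg (α := ℝ) q)
  have hs0 : 0 < √(q : ℝ) := sqrt_pos.2 (by linarith)
  have hr := sq_sqrt hs0.le
  have hr0 : 0 < √√(q : ℝ) := sqrt_pos.2 hs0
  have h4 : √(2 * (2 * √(q : ℝ))) = 2 * √√(q : ℝ) := by
    rw [show 2 * (2 * √(q : ℝ)) = 2 ^ 2 * √(q : ℝ) by ring, sqrt_mul (by norm_num),
      sqrt_sq (by norm_num)]
  have h5 : (π / (√q * t)) ^ ((1 : ℝ) / 2) = √(π / t) / √√(q : ℝ) := by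
    rw [← sqrt_eq_rpow, ← sqrt_div (by positivity)]
    congr 1
    field_simp
  have hd : ((q : ℝ) + 1) ^ 2 - (2 * √(q : ℝ)) ^ 2 = ((q : ℝ) - 1) ^ 2 := by nlinarith
  have hq1 : (q : ℝ) - 1 ≠ 0 := by linarith
  rw [h5, PsiDerivFactor, PsiFactor]
  simp only [sub_zero, zero_mul, add_zero]
  rw [h4, hd]
  field_simp
  linear_combination -hr

/-- Stationary-phase asymptotics: as `t → ∞`,
`∫_{−2√q}^{2√q} e^{itλ} Ψ'(λ) dλ
  = i (π/(√q t))^{1/2} sin(2√q t − π/4) · (−√q(q+1)/(q−1)²) + O(t^{−1})`. -/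
theorem Psi_deriv_oscillatory_asymptotics (q : ℕ) (hq : 2 ≤ q) :
    ∃ C t₀ : ℝ, 0 < C ∧ 0 < t₀ ∧ ∀ t ≥ t₀,
      ‖(∫ l in (-(2*Real.sqrt q))..(2*Real.sqrt q),
          Complex.exp (Complex.I * t * l) * (Complex.ofReal (deriv (Psi q) l)))
        - Complex.I * (((Real.pi/(Real.sqrt q * t)) ^ ((1:ℝ)/2) *
            Real.sin (2*Real.sqrt q * t - Real.pi/4) *
            (-(Real.sqrt q) * ((q:ℝ)+1) / ((q:ℝ)-1)^2) : ℝ) : ℂ)‖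
        ≤ C / t := by
  have ha := two_sqrt_pos hq
  obtain ⟨C, hC0, hC⟩ := norm_integral_rpow_mul_exp_mul_sub_le ha
    fun u hu ↦ contDiffAt_PsiDerivFactor hq hu
  refine ⟨2 * C + 1, 1, by positivity, one_pos, fun t ht1 ↦ ?_⟩
  have ht : 0 < t := one_pos.trans_le ht1
  rw [integral_exp_mul_deriv_Psi hq, integral_exp_mul_deriv_Psi_half hq]
  have hb := hC t ht
  set J := ∫ u in (0 : ℝ)..(2 * √q), (PsiDerivFactor q u : ℂ) *
          (((u ^ (-1 / 2 : ℝ) : ℝ) : ℂ) * Complex.exp (-(Complex.I * t * u)))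
  set E := Complex.exp (Complex.I * t * (2 * √q : ℝ)) with hE
  set S := ((√(π / t) : ℝ) : ℂ) * Complex.exp (-(Complex.I * (π / 4))) * PsiDerivFactor q 0 with hS
  have hEn : ‖E‖ = 1 := by
    rw [hE, Complex.norm_exp]
    simp
  have hES : E * S = ((√(π / t) * PsiDerivFactor q 0 : ℝ) : ℂ) *
      Complex.exp ((2 * √q * t - π / 4 : ℝ) * Complex.I) := by
    rw [show ((2 * √q * t - π / 4 : ℝ) * Complex.I : ℂ)
      = Complex.I * t * (2 * √q : ℝ) + -(Complex.I * (π / 4)) by push_cast; ring,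
      Complex.exp_add, hE, hS]
    push_cast
    ring
  have hmain : Complex.I * (((π / (√q * t)) ^ ((1 : ℝ) / 2) * sin (2 * √q * t - π / 4) *
      (-√q * ((q : ℝ) + 1) / ((q : ℝ) - 1) ^ 2) : ℝ) : ℂ) = E * S - starRingEnd ℂ (E * S) := by
    rw [mul_right_comm, ← PsiDerivFactor_zero_mul hq ht, Complex.sub_conj, hES,
      Complex.im_ofReal_mul, Complex.exp_ofReal_mul_I_im]
    push_cast
    ring
  rw [hmain, show E * J - starRingEnd ℂ (E * J) - (E * S - starRingEnd ℂ (E * S))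
    = E * (J - S) - starRingEnd ℂ (E * (J - S)) by simp only [map_mul, map_sub]; ring]
  have hn : ‖E * (J - S)‖ ≤ C / t := by rwa [norm_mul, hEn, one_mul]
  calc ‖E * (J - S) - starRingEnd ℂ (E * (J - S))‖
      ≤ ‖E * (J - S)‖ + ‖starRingEnd ℂ (E * (J - S))‖ := norm_sub_le _ _
    _ = ‖E * (J - S)‖ + ‖E * (J - S)‖ := by rw [RCLike.norm_conj]
    _ ≤ C / t + C / t := add_le_add hn hn
    _ = 2 * C / t := by ring
    _ ≤ (2 * C + 1) / t := by gcongr; linarith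
end

section
/- Let a < b be reals, p : [a,b] → ℝ be three times continuously differentiable and real-analytic at a, and q : [a,b] → ℝ be continuously differentiable and real-analytic at a. Suppose p'(a) = 0, p''(a) ≠ 0, and p'(x) ≠ 0 for all x ∈ (a,b]. Set ε = sgn p''(a) and define Q_{1,1}(x) = q(x)/(ε p'(x)) − q(a)/(√(2ε p''(a)) √(ε(p(x) − p(a)))) for x ∈ (a,b], and let V = ∫_a^b |Q_{1,1}'(x)| dx. Then for every t > 0: |∫_a^b e^{i t p(x)} q(x) dx − e^{i t p(a)} e^{ε π i/4} √(π/(2|p''(a)| t)) · q(a)| ≤ (1/t) ( |q'(a)/p''(a) − q(a) p'''(a)/(3 p''(a)²)| + |q(b)/p'(b)| + V + 3|q(a)| / (√(2|p''(a)|) √(|p(b) − p(a)|)) ). -/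
open Set Real Filter MeasureTheory intervalIntegral

lemma integrableOn_rpow_mul_cexp {r : ℂ} (hr : 0 < r.re) :
    IntegrableOn (fun u : ℝ => ((u ^ (-1 / 2 : ℝ) : ℝ) : ℂ) * Complex.exp (-r * u)) (Ioi 0) := by
  have h := integrableOn_rpow_mul_exp_neg_mul_rpow (p := 1) (s := -1 / 2) (b := r.re)
    (by norm_num) one_pos hr
  refine Integrable.mono' h (Measurable.aestronglyMeasurable (by fun_prop)) ?_
  filter_upwards [ae_restrict_mem measurableSet_Ioi] with u hu
  rw [norm_mul, Complex.norm_exp, Complex.norm_real, norm_of_nonneg (rpow_nonneg (le_of_lt hu) _)]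
  simp

lemma integral_rpow_mul_cexp {r : ℂ} (hr : 0 < r.re) :
    ∫ u in Ioi (0 : ℝ), ((u ^ (-1 / 2 : ℝ) : ℝ) : ℂ) * Complex.exp (-r * u) =
      (π / r) ^ (1 / 2 : ℂ) := by
  have h := integral_comp_rpow_Ioi_of_pos (g := fun x : ℝ => Complex.exp (-r * (x : ℂ) ^ 2))
    (p := 1 / 2) (by norm_num)
  rw [integral_gaussian_complex_Ioi hr] at h
  have h2 : ∫ u in Ioi (0 : ℝ), ((u ^ (-1 / 2 : ℝ) : ℝ) : ℂ) * Complex.exp (-r * u) =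
      ∫ u in Ioi (0 : ℝ), (2 : ℂ) * (((1 / 2 : ℝ) * u ^ ((1 / 2 : ℝ) - 1)) •
        Complex.exp (-r * ((u ^ (1 / 2 : ℝ) : ℝ) : ℂ) ^ 2)) := by
    refine setIntegral_congr_fun measurableSet_Ioi fun u hu => ?_
    have hu' : (u ^ (1 / 2 : ℝ)) ^ 2 = u := by
      rw [← sqrt_eq_rpow, sq_sqrt (le_of_lt hu)]
    simp only [← Complex.ofReal_pow, hu', Complex.real_smul]
    norm_num
    ring
  rw [h2, MeasureTheory.integral_const_mul, h]
  ring

/-- Tail bound for `∫ u^(-1/2) e^(-ru) du`, by one integration by parts. -/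
lemma norm_integral_Ioi_rpow_mul_cexp_le {r : ℂ} (hr : 0 < r.re) {B : ℝ} (hB : 0 < B) :
    ‖∫ u in Ioi B, ((u ^ (-1 / 2 : ℝ) : ℝ) : ℂ) * Complex.exp (-r * u)‖ ≤ 2 / (‖r‖ * √B) := by
  have hr0 : r ≠ 0 := by rintro rfl; simp at hr
  have hr' : 0 < ‖r‖ := norm_pos_iff.2 hr0
  have hexp : ∀ u : ℝ, 0 < u → ‖Complex.exp (-r * u)‖ ≤ 1 := fun u hu => by
    rw [Complex.norm_exp, Real.exp_le_one_iff]
    simp only [Complex.re_mul_ofReal, Complex.neg_re]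
    nlinarith
  set g : ℝ → ℂ := fun u => ((1 / 2 * u ^ (-3 / 2 : ℝ) : ℝ) : ℂ) * Complex.exp (-r * u) / r with hg
  have hbound : IntegrableOn (fun u : ℝ => 1 / 2 * u ^ (-3 / 2 : ℝ) / ‖r‖) (Ioi B) :=
    ((integrableOn_Ioi_rpow_of_lt (by norm_num) hB).const_mul _).div_const _
  have hgle : ∀ᵐ u ∂(volume.restrict (Ioi B)), ‖g u‖ ≤ 1 / 2 * u ^ (-3 / 2 : ℝ) / ‖r‖ := by
    filter_upwards [ae_restrict_mem measurableSet_Ioi] with u hu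
    have hu0 : 0 < u := hB.trans hu
    rw [hg, norm_div, norm_mul, Complex.norm_real, norm_of_nonneg (by positivity)]
    exact div_le_div_of_nonneg_right (mul_le_of_le_one_right (by positivity) (hexp u hu0)) hr'.le
  have hgint : IntegrableOn g (Ioi B) :=
    Integrable.mono' hbound (Measurable.aestronglyMeasurable (by fun_prop)) hgle
  have hint := (integrableOn_rpow_mul_cexp hr).mono_set (Ioi_subset_Ioi hB.le)
  have hderiv : ∀ u ∈ Ici B, HasDerivAt
      (fun u : ℝ => -(((u ^ (-1 / 2 : ℝ) : ℝ) : ℂ) * Complex.exp (-r * u) / r))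
      (((u ^ (-1 / 2 : ℝ) : ℝ) : ℂ) * Complex.exp (-r * u) + g u) u := by
    intro u hu
    have hu0 : 0 < u := hB.trans_le hu
    have h1 := (hasDerivAt_rpow_const (x := u) (p := -1 / 2) (Or.inl hu0.ne')).ofReal_comp
    have h2 : HasDerivAt (fun u : ℝ => Complex.exp (-r * u)) (Complex.exp (-r * u) * (-r * 1)) u :=
      ((Complex.ofRealCLM.hasDerivAt (x := u)).const_mul (-r)).cexp
    refine ((h1.mul h2).div_const r).neg.congr_deriv ?_
    rw [show (-1 / 2 - 1 : ℝ) = -3 / 2 by norm_num, hg]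
    push_cast
    field_simp
    ring
  have hlim : Tendsto (fun u : ℝ => -(((u ^ (-1 / 2 : ℝ) : ℝ) : ℂ) * Complex.exp (-r * u) / r))
      atTop (nhds 0) := by
    have h0 : Tendsto (fun u : ℝ => u ^ (-1 / 2 : ℝ) / ‖r‖) atTop (nhds 0) := by
      have := (tendsto_rpow_neg_atTop (y := 1 / 2) (by norm_num)).div_const ‖r‖
      rw [zero_div] at this
      convert this using 3
      norm_num
    refine squeeze_zero_norm' ?_ h0
    filter_upwards [eventually_gt_atTop 0] with u hu
    rw [norm_neg, norm_div, norm_mul, Complex.norm_real, norm_of_nonneg (by positivity)]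
    gcongr
    exact mul_le_of_le_one_right (by positivity) (hexp u hu)
  have hmain := integral_Ioi_of_hasDerivAt_of_tendsto
    (hderiv B self_mem_Ici).continuousAt.continuousWithinAt
    (fun u hu => hderiv u (Ioi_subset_Ici_self hu)) (hint.add hgint) hlim
  rw [integral_add hint hgint, zero_sub, neg_neg] at hmain
  have hB' : B ^ (-1 / 2 : ℝ) = 1 / √B := by
    rw [sqrt_eq_rpow, show (-1 / 2 : ℝ) = -(1 / 2) by norm_num, rpow_neg hB.le, one_div (B ^ _)]
  have hgn : ‖∫ u in Ioi B, g u‖ ≤ 1 / √B / ‖r‖ := by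
    refine (MeasureTheory.norm_integral_le_of_norm_le hbound hgle).trans_eq ?_
    rw [MeasureTheory.integral_div, MeasureTheory.integral_const_mul,
      integral_Ioi_rpow_of_lt (by norm_num) hB, show (-3 / 2 + 1 : ℝ) = -1 / 2 by norm_num, hB']
    ring
  rw [eq_sub_of_add_eq hmain]
  refine (norm_sub_le _ _).trans ?_
  have hbd : ‖((B ^ (-1 / 2 : ℝ) : ℝ) : ℂ) * Complex.exp (-r * B) / r‖ ≤ 1 / √B / ‖r‖ := by
    rw [norm_div, norm_mul, Complex.norm_real, norm_of_nonneg (by positivity), hB']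
    gcongr
    exact mul_le_of_le_one_right (by positivity) (hexp B hB)
  refine (add_le_add hbd hgn).trans_eq ?_
  field_simp
  norm_num

lemma pi_div_cpow_half {ε t : ℝ} (hε : ε = 1 ∨ ε = -1) (ht : 0 < t) :
    ((π : ℂ) / (-(Complex.I * ε * t))) ^ (1 / 2 : ℂ) =
      Complex.exp (ε * π * Complex.I / 4) * ((√(π / t) : ℝ) : ℂ) := by
  have hpt : 0 < π / t := by positivity
  have hsq : ((√(π / t) : ℝ) : ℂ) = Complex.exp (Complex.log ((π / t : ℝ) : ℂ) * (1 / 2)) := by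
    rw [← Complex.cpow_def_of_ne_zero (by exact_mod_cast hpt.ne'), sqrt_eq_rpow,
      Complex.ofReal_cpow hpt.le]
    norm_num
  have ht' : (t : ℂ) ≠ 0 := by exact_mod_cast ht.ne'
  rw [hsq, ← Complex.exp_add]
  rcases hε with rfl | rfl
  · rw [show (π : ℂ) / (-(Complex.I * ((1 : ℝ) : ℂ) * t)) = ((π / t : ℝ) : ℂ) * Complex.I by
      push_cast; field_simp; simp,
      Complex.cpow_def_of_ne_zero (mul_ne_zero (by exact_mod_cast hpt.ne') Complex.I_ne_zero),
      Complex.log_ofReal_mul hpt Complex.I_ne_zero, Complex.log_I, Complex.ofReal_log hpt.le]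
    congr 1
    push_cast
    ring
  · rw [show (π : ℂ) / (-(Complex.I * ((-1 : ℝ) : ℂ) * t)) = ((π / t : ℝ) : ℂ) * (-Complex.I) by
      push_cast; field_simp; simp,
      Complex.cpow_def_of_ne_zero (mul_ne_zero (by exact_mod_cast hpt.ne')
        (neg_ne_zero.2 Complex.I_ne_zero)),
      Complex.log_ofReal_mul hpt (neg_ne_zero.2 Complex.I_ne_zero), Complex.log_neg_I,
      Complex.ofReal_log hpt.le]
    congr 1
    push_cast
    ring

/-- Truncated Fresnel integral with its endpoint error. -/
lemma norm_fresnel_sub_le_s10 {ε t B : ℝ} (hε : ε = 1 ∨ ε = -1) (ht : 0 < t) (hB : 0 < B) :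
    ‖(∫ u in (0 : ℝ)..B, ((u ^ (-1 / 2 : ℝ) : ℝ) : ℂ) * Complex.exp (Complex.I * ε * t * u)) -
      Complex.exp (ε * π * Complex.I / 4) * ((√(π / t) : ℝ) : ℂ)‖ ≤ 2 / (t * √B) := by
  have hε0 : ε ≠ 0 := by rcases hε with rfl | rfl <;> norm_num
  have hεabs : |ε| = 1 := by rcases hε with rfl | rfl <;> norm_num
  set r : ℝ → ℂ := fun δ => δ - Complex.I * ε * t with hr
  have hre : ∀ δ, (r δ).re = δ := fun δ => by simp [hr]
  have hcont : Continuous r := by fun_prop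
  have hr0 : r 0 = -(Complex.I * ε * t) := by simp [hr]
  have hnorm : ∀ δ, t ≤ ‖r δ‖ := fun δ => by
    have := Complex.abs_im_le_norm (r δ)
    simpa [hr, abs_mul, hεabs, abs_of_pos ht] using this
  have hbound : ∀ δ : ℝ, 0 < δ →
      ‖(∫ u in (0 : ℝ)..B, ((u ^ (-1 / 2 : ℝ) : ℝ) : ℂ) * Complex.exp (-r δ * u)) -
        (π / r δ) ^ (1 / 2 : ℂ)‖ ≤ 2 / (t * √B) := by
    intro δ hδ
    have hδ' : 0 < (r δ).re := by rwa [hre]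
    have hint := integrableOn_rpow_mul_cexp hδ'
    rw [← integral_rpow_mul_cexp hδ', ← integral_interval_add_Ioi hint
      (hint.mono_set (Ioi_subset_Ioi hB.le)), sub_add_cancel_left, norm_neg]
    refine (norm_integral_Ioi_rpow_mul_cexp_le hδ' hB).trans ?_
    gcongr
    exact hnorm δ
  have hlim₁ : Tendsto
      (fun δ => ∫ u in (0 : ℝ)..B, ((u ^ (-1 / 2 : ℝ) : ℝ) : ℂ) * Complex.exp (-r δ * u))
      (nhdsWithin 0 (Ioi 0))
      (nhds (∫ u in (0 : ℝ)..B, ((u ^ (-1 / 2 : ℝ) : ℝ) : ℂ) *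
        Complex.exp (Complex.I * ε * t * u))) := by
    refine tendsto_integral_filter_of_dominated_convergence (fun u => u ^ (-1 / 2 : ℝ))
      ?_ ?_ (intervalIntegrable_rpow' (by norm_num)) ?_
    · exact Eventually.of_forall fun δ => Measurable.aestronglyMeasurable (by fun_prop)
    · filter_upwards [self_mem_nhdsWithin] with δ hδ
      refine Eventually.of_forall fun u hu => ?_
      rw [uIoc_of_le hB.le] at hu
      have hu0 := hu.1
      rw [norm_mul, Complex.norm_real, norm_of_nonneg (by positivity), Complex.norm_exp]
      refine mul_le_of_le_one_right (by positivity) (Real.exp_le_one_iff.2 ?_)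
      simp only [Complex.re_mul_ofReal, Complex.neg_re, hre]
      have : 0 < δ := hδ
      nlinarith
    · refine Eventually.of_forall fun u _ => ?_
      have hc : Continuous fun δ => ((u ^ (-1 / 2 : ℝ) : ℝ) : ℂ) * Complex.exp (-r δ * u) := by
        fun_prop
      have := hc.tendsto 0
      rw [hr0, neg_neg] at this
      exact this.mono_left nhdsWithin_le_nhds
  have hslit : (π : ℂ) / r 0 ∈ Complex.slitPlane := by
    rw [hr0, Complex.mem_slitPlane_iff]
    right
    rcases hε with rfl | rfl <;>
      simp [Complex.div_im, pi_ne_zero, ht.ne']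
  have hlim₂ : Tendsto (fun δ => ((π : ℂ) / r δ) ^ (1 / 2 : ℂ)) (nhdsWithin 0 (Ioi 0))
      (nhds (Complex.exp (ε * π * Complex.I / 4) * ((√(π / t) : ℝ) : ℂ))) := by
    have hne : r 0 ≠ 0 := norm_pos_iff.1 (ht.trans_le (hnorm 0))
    have hc : ContinuousAt (fun δ => ((π : ℂ) / r δ) ^ (1 / 2 : ℂ)) 0 :=
      (continuousAt_const.div hcont.continuousAt hne).cpow continuousAt_const hslit
    rw [ContinuousAt, hr0, pi_div_cpow_half hε ht] at hc
    exact hc.mono_left nhdsWithin_le_nhds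
  refine le_of_tendsto (hlim₁.sub hlim₂).norm ?_
  filter_upwards [self_mem_nhdsWithin] with δ hδ using hbound δ hδ

/-- If `f` vanishes at `a` and `f' x / (x - a) ^ n` tends to `L` as `x → a+`, then
`f x / (x - a) ^ (n + 1)` tends to `L / (n + 1)`. -/
lemma tendsto_div_pow_succ_of_tendsto_deriv_div_pow {a b L : ℝ} (hab : a < b) {f f' : ℝ → ℝ}
    (n : ℕ) (hf : ∀ x ∈ Icc a b, HasDerivWithinAt f (f' x) (Icc a b) x) (hfa : f a = 0)
    (hL : Tendsto (fun x => f' x / (x - a) ^ n) (nhdsWithin a (Ioi a)) (nhds L)) :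
    Tendsto (fun x => f x / (x - a) ^ (n + 1)) (nhdsWithin a (Ioi a)) (nhds (L / (n + 1))) := by
  have hn : (n : ℝ) + 1 ≠ 0 := by positivity
  refine HasDerivAt.lhopital_zero_right_on_Ioo (f' := f')
    (g' := fun x => ((n : ℝ) + 1) * (x - a) ^ n) hab ?_ ?_ ?_ ?_ ?_ ?_
  · intro x hx
    exact (hf x (Ioo_subset_Icc_self hx)).hasDerivAt (Icc_mem_nhds hx.1 hx.2)
  · intro x _
    simpa using ((hasDerivAt_id x).sub_const a).fun_pow (n + 1)
  · intro x hx
    have : x - a ≠ 0 := (sub_pos.2 hx.1).ne'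
    positivity
  · have := (hf a (left_mem_Icc.2 hab.le)).continuousWithinAt
    rw [ContinuousWithinAt, hfa] at this
    exact this.mono_left (nhdsWithin_le_of_mem (Icc_mem_nhdsGT hab))
  · have : ContinuousAt (fun x : ℝ => (x - a) ^ (n + 1)) a := by fun_prop
    rw [ContinuousAt] at this
    simp only [sub_self, ne_eq, Nat.succ_ne_zero, not_false_eq_true, zero_pow] at this
    exact this.mono_left nhdsWithin_le_nhds
  · refine (hL.div_const ((n : ℝ) + 1)).congr fun x => ?_
    rw [div_div, mul_comm]

lemma tendsto_slope_nhdsGT {a b : ℝ} (hab : a < b) {f : ℝ → ℝ} {m : ℝ}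
    (hf : HasDerivWithinAt f m (Icc a b) a) :
    Tendsto (fun x => (f x - f a) / (x - a)) (nhdsWithin a (Ioi a)) (nhds m) := by
  have h : HasDerivWithinAt f m (Ioi a) a := hf.mono_of_mem_nhdsWithin (Icc_mem_nhdsGT hab)
  rw [hasDerivWithinAt_iff_tendsto_slope' (by simp)] at h
  refine h.congr fun x => ?_
  rw [slope_def_field]

/-- The amplitude remainder `q / p' - q(a) / (√(2 p''(a)) √(p - p(a)))` extends continuously to
a nondegenerate critical minimum `a` of `p`. -/
lemma tendsto_amplitude_remainder {a b : ℝ} (hab : a < b) {p p₁ p₂ q : ℝ → ℝ} {m d : ℝ}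
    (hp : ∀ x ∈ Icc a b, HasDerivWithinAt p (p₁ x) (Icc a b) x)
    (hp₁ : ∀ x ∈ Icc a b, HasDerivWithinAt p₁ (p₂ x) (Icc a b) x)
    (hp₂ : HasDerivWithinAt p₂ m (Icc a b) a) (hq : HasDerivWithinAt q d (Icc a b) a)
    (hcrit : p₁ a = 0) (hpos : 0 < p₂ a) :
    Tendsto (fun x => q x / p₁ x - q a / (√(2 * p₂ a) * √(p x - p a))) (nhdsWithin a (Ioi a))
      (nhds (d / p₂ a - q a * m / (3 * p₂ a ^ 2))) := by
  have hlin : ∀ x, HasDerivWithinAt (fun y : ℝ => y - a) 1 (Icc a b) x := fun x =>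
    ((hasDerivAt_id x).sub_const a).hasDerivWithinAt
  have hf₁ : ∀ x ∈ Icc a b, HasDerivWithinAt (fun y => p₁ y - p₂ a * (y - a))
      (p₂ x - p₂ a) (Icc a b) x := fun x hx => by
    simpa using (hp₁ x hx).fun_sub ((hlin x).const_mul (p₂ a))
  have hf₀ : ∀ x ∈ Icc a b, HasDerivWithinAt (fun y => p y - p a - p₂ a / 2 * (y - a) ^ 2)
      (p₁ x - p₂ a * (x - a)) (Icc a b) x := fun x hx => by
    refine (((hp x hx).sub_const (p a)).sub (((hlin x).pow 2).const_mul (p₂ a / 2))).congr_deriv ?_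
    norm_num
    ring
  have t₂ : Tendsto (fun x => (p₂ x - p₂ a) / (x - a) ^ 1) (nhdsWithin a (Ioi a)) (nhds m) := by
    simpa using tendsto_slope_nhdsGT hab hp₂
  have t₁ := tendsto_div_pow_succ_of_tendsto_deriv_div_pow hab 1 hf₁ (by simp [hcrit]) t₂
  have t₀ := tendsto_div_pow_succ_of_tendsto_deriv_div_pow hab 2 hf₀ (by simp) t₁
  have tq := tendsto_slope_nhdsGT hab hq
  have tA : Tendsto (fun x => p₁ x / (x - a)) (nhdsWithin a (Ioi a)) (nhds (p₂ a)) := by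
    simpa [hcrit] using tendsto_slope_nhdsGT hab (hp₁ a (left_mem_Icc.2 hab.le))
  have tS : Tendsto (fun x => (p x - p a) / (x - a) ^ 2) (nhdsWithin a (Ioi a))
      (nhds (p₂ a / 2)) := by
    have := tendsto_div_pow_succ_of_tendsto_deriv_div_pow hab (f := fun x => p x - p a) 1
      (fun x hx => (hp x hx).sub_const (p a)) (by simp) (L := p₂ a) (by simpa using tA)
    norm_num at this
    exact this
  have tR : Tendsto (fun x => √(2 * p₂ a * ((p x - p a) / (x - a) ^ 2))) (nhdsWithin a (Ioi a))
      (nhds (p₂ a)) := by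
    have := (tS.const_mul (2 * p₂ a)).sqrt
    rwa [show 2 * p₂ a * (p₂ a / 2) = p₂ a ^ 2 by ring, sqrt_sq hpos.le] at this
  have key := (tq.div tA hpos.ne').add (((((t₀.const_mul (2 * p₂ a)).div (tR.add_const (p₂ a))
    (by positivity)).sub t₁).const_mul (q a)).div (tA.mul tR) (by positivity))
  have hval : d / p₂ a + q a * (2 * p₂ a * (m / (((1 : ℕ) : ℝ) + 1) / (((2 : ℕ) : ℝ) + 1)) /
      (p₂ a + p₂ a) - m / (((1 : ℕ) : ℝ) + 1)) / (p₂ a * p₂ a) =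
      d / p₂ a - q a * m / (3 * p₂ a ^ 2) := by
    push_cast
    field_simp
    ring
  rw [hval] at key
  refine key.congr' ?_
  filter_upwards [self_mem_nhdsWithin, tA.eventually (lt_mem_nhds hpos),
    tS.eventually (lt_mem_nhds (half_pos hpos))] with x hx hA hS
  have hh : 0 < x - a := sub_pos.2 hx
  have hS' : 0 < p x - p a := by
    have := mul_pos hS (pow_pos hh 2)
    rwa [div_mul_cancel₀ _ (pow_pos hh 2).ne'] at this
  have hA' : 0 < p₁ x := by
    have := mul_pos hA hh
    rwa [div_mul_cancel₀ _ hh.ne'] at this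
  set R := √(2 * p₂ a * ((p x - p a) / (x - a) ^ 2)) with hR
  have hRpos : 0 < R := by positivity
  have hRsq : R ^ 2 * (x - a) ^ 2 = 2 * p₂ a * (p x - p a) := by
    rw [hR, sq_sqrt (by positivity)]
    field_simp
  have hRmul : √(2 * p₂ a) * √(p x - p a) = R * (x - a) := by
    rw [← sqrt_mul (by positivity), ← hRsq, ← mul_pow, sqrt_sq (by positivity)]
  have hdiff : 2 * p₂ a * ((p x - p a - p₂ a / 2 * (x - a) ^ 2) / (x - a) ^ (2 + 1)) / (R + p₂ a)
      = (R - p₂ a) / (x - a) := by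
    have : R + p₂ a ≠ 0 := by positivity
    field_simp
    linear_combination -(x - a) * hRsq
  simp only [Pi.div_apply]
  rw [hRmul, ← hR, hdiff]
  field_simp
  ring

lemma pos_of_ne_zero_of_hasDerivWithinAt_pos {a b m : ℝ} (hab : a < b) {f : ℝ → ℝ}
    (hf : ContinuousOn f (Icc a b)) (hne : ∀ x ∈ Ioc a b, f x ≠ 0)
    (hd : HasDerivWithinAt f m (Icc a b) a) (hfa : f a = 0) (hm : 0 < m) :
    ∀ x ∈ Ioc a b, 0 < f x := by
  intro x hx
  by_contra! hle
  have hlt := lt_of_le_of_ne hle (hne x hx)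
  obtain ⟨y, hy, hya, hyx⟩ := (((tendsto_slope_nhdsGT hab hd).eventually
    (lt_mem_nhds hm)).and (Ioo_mem_nhdsGT hx.1)).exists
  have hfy : 0 < f y := by
    rw [hfa, sub_zero] at hy
    have := mul_pos hy (sub_pos.2 hya)
    rwa [div_mul_cancel₀ _ (sub_pos.2 hya).ne'] at this
  obtain ⟨z, hz, hz0⟩ := intermediate_value_Icc' hyx.le
    (hf.mono (Icc_subset_Icc hya.le hx.2)) ⟨hlt.le, hfy.le⟩
  exact hne z ⟨hya.trans_le hz.1, hz.2.trans hx.2⟩ hz0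

/-- Explicit stationary-phase estimate with the unique critical point of the phase `p`
at the left endpoint `a`: for every `t > 0`,
`|∫_a^b e^{itp(x)} q(x) dx − e^{itp(a)} e^{επi/4} √(π/(2|p''(a)|t)) q(a)|
  ≤ (1/t)( |q'(a)/p''(a) − q(a)p'''(a)/(3p''(a)²)| + |q(b)/p'(b)| + V
      + 3|q(a)|/(√(2|p''(a)|)√(|p(b) − p(a)|)) )`,
where `V = ∫_a^b |Q_{1,1}'(x)| dx` is the total variation of
`Q_{1,1}(x) = q(x)/(εp'(x)) − q(a)/(√(2εp''(a))√(ε(p(x)−p(a))))` and `ε = sgn p''(a)`.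
`p` is `C³` on `[a,b]` (encoded through `p', p'', p'''`), `q` is `C¹` on `[a,b]`,
and both are real-analytic at `a`. -/
theorem stationary_phase_endpoint (a b : ℝ) (hab : a < b)
    (p p' p'' p''' q q' : ℝ → ℝ)
    (hp : ∀ x ∈ Icc a b, HasDerivWithinAt p (p' x) (Icc a b) x)
    (hp' : ∀ x ∈ Icc a b, HasDerivWithinAt p' (p'' x) (Icc a b) x)
    (hp'' : ∀ x ∈ Icc a b, HasDerivWithinAt p'' (p''' x) (Icc a b) x)
    (hp'''c : ContinuousOn p''' (Icc a b))
    (hq : ∀ x ∈ Icc a b, HasDerivWithinAt q (q' x) (Icc a b) x)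
    (hq'c : ContinuousOn q' (Icc a b))
    (hpa : AnalyticAt ℝ p a) (hqa : AnalyticAt ℝ q a)
    (hcrit : p' a = 0) (hnd : p'' a ≠ 0)
    (hp'ne : ∀ x ∈ Ioc a b, p' x ≠ 0)
    (ε : ℝ) (hε : ε = Real.sign (p'' a))
    (Q11 : ℝ → ℝ)
    (hQ11 : ∀ x, Q11 x =
      q x / (ε * p' x)
        - q a / (Real.sqrt (2 * (ε * p'' a)) * Real.sqrt (ε * (p x - p a))))
    (hV : IntervalIntegrable (fun x => |deriv Q11 x|) volume a b) :
    ∀ t : ℝ, 0 < t →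
      ‖(∫ x in a..b, Complex.exp (Complex.I * t * p x) * (q x : ℂ))
        - Complex.exp (Complex.I * t * p a) * Complex.exp (ε * Real.pi * Complex.I / 4) *
            Complex.ofReal (Real.sqrt (Real.pi / (2 * |p'' a| * t)) * q a)‖
      ≤ (1/t) * (|q' a / p'' a - q a * p''' a / (3 * (p'' a)^2)|
          + |q b / p' b|
          + (∫ x in a..b, |deriv Q11 x|)
          + 3 * |q a| / (Real.sqrt (2 * |p'' a|) * Real.sqrt (|p b - p a|))) := by
  have hε1 : ε = 1 ∨ ε = -1 := by
    rcases hnd.lt_or_gt with h | h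
    · exact Or.inr (by rw [hε, Real.sign_of_neg h])
    · exact Or.inl (by rw [hε, Real.sign_of_pos h])
  have hεp'' : ε * p'' a = |p'' a| := by
    rw [hε]
    rcases hnd.lt_or_gt with h | h
    · rw [Real.sign_of_neg h, abs_of_neg h, neg_one_mul]
    · rw [Real.sign_of_pos h, abs_of_pos h, one_mul]
  have hεsq : ε * ε = 1 := by rcases hε1 with h | h <;> rw [h] <;> norm_num
  have hεabs : |ε| = 1 := by rcases hε1 with h | h <;> rw [h] <;> norm_num
  have hpos : 0 < ε * p'' a := hεp'' ▸ abs_pos.2 hnd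
  have hp'c : ContinuousOn p' (Icc a b) := fun x hx => (hp' x hx).continuousWithinAt
  have hpc : ContinuousOn p (Icc a b) := fun x hx => (hp x hx).continuousWithinAt
  have hqc : ContinuousOn q (Icc a b) := fun x hx => (hq x hx).continuousWithinAt
  have hp'pos : ∀ x ∈ Ioc a b, 0 < ε * p' x := by
    refine pos_of_ne_zero_of_hasDerivWithinAt_pos hab ?_ (fun x hx => ?_) ?_ ?_ hpos
      (f := fun x => ε * p' x) (m := ε * p'' a)
    · exact hp'c.const_mul ε
    · exact mul_ne_zero (left_ne_zero_of_mul hpos.ne') (hp'ne x hx)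
    · exact (hp' a (left_mem_Icc.2 hab.le)).const_mul ε
    · simp [hcrit]
  have hψpos : ∀ x ∈ Ioc a b, 0 < ε * (p x - p a) := by
    have hmono : StrictMonoOn (fun x => ε * p x) (Icc a b) := by
      refine strictMonoOn_of_deriv_pos (convex_Icc a b) (hpc.const_mul ε) fun x hx => ?_
      rw [interior_Icc] at hx
      rw [(((hp x (Ioo_subset_Icc_self hx)).hasDerivAt
        (Icc_mem_nhds hx.1 hx.2)).const_mul ε).deriv]
      exact hp'pos x (Ioo_subset_Ioc_self hx)
    intro x hx
    have := hmono (left_mem_Icc.2 hab.le) (Ioc_subset_Icc_self hx) hx.1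
    simp only at this
    linarith
  intro t ht
  have hQ : Q11 = fun x => q x / (ε * p' x)
      - q a / (√(2 * (ε * p'' a)) * √(ε * (p x - p a))) := funext hQ11
  set L : ℝ := q' a / (ε * p'' a) - q a * (ε * p''' a) / (3 * (ε * p'' a) ^ 2) with hL
  have hQa : Tendsto Q11 (nhdsWithin a (Ioi a)) (nhds L) := by
    have := tendsto_amplitude_remainder (p := fun x => ε * p x) (p₁ := fun x => ε * p' x)
      (p₂ := fun x => ε * p'' x) hab (fun x hx => (hp x hx).const_mul ε)
      (fun x hx => (hp' x hx).const_mul ε) ((hp'' a (left_mem_Icc.2 hab.le)).const_mul ε)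
      (hq a (left_mem_Icc.2 hab.le)) (by simp [hcrit]) hpos
    simpa only [hQ, mul_sub] using this
  have hLabs : |L| = |q' a / p'' a - q a * p''' a / (3 * p'' a ^ 2)| := by
    have hε0 : ε ≠ 0 := left_ne_zero_of_mul hpos.ne'
    have : L = ε * (q' a / p'' a - q a * p''' a / (3 * p'' a ^ 2)) := by
      rw [hL]
      field_simp
      linear_combination -(3 * q' a * p'' a - q a * p''' a) * hεsq
    rw [this, abs_mul, hεabs, one_mul]
  have hQb : ContinuousWithinAt Q11 (Icc a b) b := by
    have hb : b ∈ Icc a b := right_mem_Icc.2 hab.le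
    have hb' : b ∈ Ioc a b := right_mem_Ioc.2 hab
    have hψb := hψpos b hb'
    rw [hQ]
    refine ((hqc b hb).div (continuousWithinAt_const.mul (hp'c b hb)) (hp'pos b hb').ne').sub
      (continuousWithinAt_const.div (continuousWithinAt_const.mul
        (continuousWithinAt_const.mul ((hpc b hb).sub continuousWithinAt_const)).sqrt) ?_)
    positivity
  have hQd : ∀ x ∈ Ioo a b, HasDerivAt Q11 (deriv Q11 x) x := by
    intro x hx
    have hx' := Ioo_subset_Ioc_self hx
    have hn := Icc_mem_nhds hx.1 hx.2
    have hxI := Ioo_subset_Icc_self hx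
    have hψx := hψpos x hx'
    refine DifferentiableAt.hasDerivAt ?_
    rw [hQ]
    refine (((hq x hxI).hasDerivAt hn).differentiableAt.div
      (((hp' x hxI).hasDerivAt hn).differentiableAt.const_mul ε) (hp'pos x hx').ne').sub
      ((differentiableAt_const _).div (((((hp x hxI).hasDerivAt
        hn).differentiableAt.sub_const _).const_mul ε).sqrt hψx.ne' |>.const_mul _) ?_)
    positivity
  set k : ℝ → ℂ := fun u => ((u ^ (-1 / 2 : ℝ) : ℝ) : ℂ) * Complex.exp (Complex.I * ε * t * u)
    with hk
  have hkint : ∀ x y : ℝ, IntervalIntegrable k volume x y := fun x y => by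
    have h : IntervalIntegrable (fun u : ℝ => u ^ (-1 / 2 : ℝ)) volume x y :=
      intervalIntegrable_rpow' (by norm_num)
    have hC : IntervalIntegrable (fun u : ℝ => ((u ^ (-1 / 2 : ℝ) : ℝ) : ℂ)) volume x y :=
      ⟨h.1.ofReal, h.2.ofReal⟩
    exact hC.mul_continuousOn (Continuous.continuousOn (by fun_prop))
  set F : ℝ → ℂ := fun y => ∫ u in (0 : ℝ)..y, k u with hF
  have hFc : Continuous F := continuous_primitive hkint 0
  have hFd : ∀ y, 0 < y → HasDerivAt F (k y) y := by
    intro y hy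
    refine integral_hasDerivAt_right (hkint 0 y)
      (Measurable.stronglyMeasurable (by fun_prop)).stronglyMeasurableAtFilter ?_
    exact (Complex.continuous_ofReal.continuousAt.comp
      (continuousAt_rpow_const y _ (Or.inl hy.ne'))).mul (by fun_prop)
  set c : ℝ := q a / √(2 * (ε * p'' a)) with hc
  set e : ℝ → ℂ := fun x => Complex.exp (Complex.I * t * p x) with he
  have hec : ContinuousOn e (Icc a b) := by fun_prop
  have henorm : ∀ x, ‖e x‖ = 1 := fun x => by
    rw [he, Complex.norm_exp]
    simp
  have hεC : (ε : ℂ) ≠ 0 := by exact_mod_cast left_ne_zero_of_mul hpos.ne'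
  have htC : (t : ℂ) ≠ 0 := by exact_mod_cast ht.ne'
  have hεsqC : (ε : ℂ) * ε = 1 := by exact_mod_cast hεsq
  set w : ℂ := Complex.I * t * ε with hw
  have hw0 : w ≠ 0 := by simp [hw, hεC, htC]
  have hwnorm : ‖w‖ = t := by simp [hw, hεabs, abs_of_pos ht]
  have hnorm : ∀ x y : ℝ, ‖e x * (y : ℂ) / w‖ = |y| / t := fun x y => by
    rw [norm_div, norm_mul, henorm, hwnorm, one_mul, Complex.norm_real, Real.norm_eq_abs]
  have hderiv : ∀ x ∈ Ioo a b, HasDerivAt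
      (fun x => e x * Q11 x / w + c * e a * F (ε * (p x - p a)))
      (e x * q x + e x * ((deriv Q11 x : ℝ) : ℂ) / w) x := by
    intro x hx
    have hx' := Ioo_subset_Ioc_self hx
    have hpx : HasDerivAt p (p' x) x :=
      (hp x (Ioo_subset_Icc_self hx)).hasDerivAt (Icc_mem_nhds hx.1 hx.2)
    have he' : HasDerivAt e (e x * (Complex.I * t * p' x)) x :=
      (hpx.ofReal_comp.const_mul (Complex.I * t)).cexp
    have hF' := (hFd _ (hψpos x hx')).scomp x ((hpx.sub_const (p a)).const_mul ε)
    refine (((he'.mul (hQd x hx).ofReal_comp).div_const w).add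
      (hF'.const_mul ((c : ℂ) * e a))).congr_deriv ?_
    have hshift : e a * Complex.exp (Complex.I * ε * t * ((ε * (p x - p a) : ℝ) : ℂ)) = e x := by
      rw [he, ← Complex.exp_add]
      congr 1
      push_cast
      linear_combination Complex.I * t * (p x - p a) * hεsqC
    have hrpow : (ε * (p x - p a)) ^ (-1 / 2 : ℝ) = 1 / √(ε * (p x - p a)) := by
      rw [sqrt_eq_rpow, show (-1 / 2 : ℝ) = -(1 / 2) by norm_num, rpow_neg (hψpos x hx').le,
        one_div (_ ^ _)]
    have hamp : ε * p' x * Q11 x + c * (ε * p' x) * (ε * (p x - p a)) ^ (-1 / 2 : ℝ) = q x := by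
      have h1 := hp'pos x hx'
      have h2 := hψpos x hx'
      have h3 : √(2 * (ε * p'' a)) ≠ 0 := by positivity
      have h4 : √(ε * (p x - p a)) ≠ 0 := by positivity
      have h5 : q x / (ε * p' x) * (ε * p' x) = q x := div_mul_cancel₀ _ h1.ne'
      rw [hrpow, hQ11, hc, mul_sub, mul_comm (ε * p' x), h5]
      field_simp
      ring
    have hampC : (ε : ℂ) * p' x * Q11 x +
        c * (ε * p' x) * (((ε * (p x - p a)) ^ (-1 / 2 : ℝ) : ℝ) : ℂ) = q x := by
      exact_mod_cast hamp
    have hdivw : e x * (Complex.I * t * p' x) * Q11 x / w = e x * (ε * p' x * Q11 x) := by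
      rw [div_eq_iff hw0, hw]
      linear_combination -(e x * Complex.I * t * p' x * Q11 x) * hεsqC
    rw [add_div, hdivw, ← hampC, ← hshift, hk, Complex.real_smul]
    push_cast
    ring
  have hdQ : IntervalIntegrable (deriv Q11) volume a b := by
    rw [intervalIntegrable_iff] at hV ⊢
    exact (integrable_norm_iff (measurable_deriv Q11).aestronglyMeasurable).1 hV
  have hint₁ : IntervalIntegrable (fun x => e x * (q x : ℂ)) volume a b := by
    refine ContinuousOn.intervalIntegrable ?_
    rw [uIcc_of_le hab.le]
    exact hec.mul (Complex.continuous_ofReal.comp_continuousOn hqc)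
  have hint₂ : IntervalIntegrable (fun x => e x * ((deriv Q11 x : ℝ) : ℂ) / w) volume a b := by
    have hdQC : IntervalIntegrable (fun x => ((deriv Q11 x : ℝ) : ℂ)) volume a b :=
      ⟨hdQ.1.ofReal, hdQ.2.ofReal⟩
    refine (hdQC.continuousOn_mul ?_).div_const w
    rwa [uIcc_of_le hab.le]
  have hlima : Tendsto (fun x => e x * Q11 x / w + c * e a * F (ε * (p x - p a)))
      (nhdsWithin a (Ioi a)) (nhds (e a * L / w)) := by
    have ha : nhdsWithin a (Ioi a) ≤ nhdsWithin a (Icc a b) :=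
      nhdsWithin_le_of_mem (Icc_mem_nhdsGT hab)
    have h1 : Tendsto e (nhdsWithin a (Ioi a)) (nhds (e a)) :=
      (hec a (left_mem_Icc.2 hab.le)).mono_left ha
    have h2 : Tendsto p (nhdsWithin a (Ioi a)) (nhds (p a)) :=
      (hpc a (left_mem_Icc.2 hab.le)).mono_left ha
    have h3 := (hFc.tendsto _).comp ((h2.sub_const (p a)).const_mul ε)
    have h4 := ((h1.mul ((Complex.continuous_ofReal.tendsto L).comp hQa)).div_const w).add
      (h3.const_mul ((c : ℂ) * e a))
    simpa [hF] using h4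
  have hlimb : Tendsto (fun x => e x * Q11 x / w + c * e a * F (ε * (p x - p a)))
      (nhdsWithin b (Iio b)) (nhds (e b * Q11 b / w + c * e a * F (ε * (p b - p a)))) := by
    have hb : nhdsWithin b (Iio b) ≤ nhdsWithin b (Icc a b) :=
      nhdsWithin_le_of_mem (Icc_mem_nhdsLT hab)
    have h1 : Tendsto e (nhdsWithin b (Iio b)) (nhds (e b)) :=
      (hec b (right_mem_Icc.2 hab.le)).mono_left hb
    have h2 : Tendsto p (nhdsWithin b (Iio b)) (nhds (p b)) :=
      (hpc b (right_mem_Icc.2 hab.le)).mono_left hb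
    have h3 := (hFc.tendsto _).comp ((h2.sub_const (p a)).const_mul ε)
    exact ((h1.mul ((Complex.continuous_ofReal.tendsto _).comp
      (hQb.tendsto.mono_left hb))).div_const w).add (h3.const_mul ((c : ℂ) * e a))
  have hFTC := integral_eq_sub_of_hasDerivAt_of_tendsto hab hderiv (hint₁.add hint₂) hlima hlimb
  rw [intervalIntegral.integral_add hint₁ hint₂] at hFTC
  have hψb := hψpos b (right_mem_Ioc.2 hab)
  have hψabs : ε * (p b - p a) = |p b - p a| := by
    rw [← abs_of_pos hψb, abs_mul, hεabs, one_mul]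
  have hfres := norm_fresnel_sub_le_s10 hε1 ht hψb
  have hconst : ((√(π / (2 * |p'' a| * t)) * q a : ℝ) : ℂ) = c * ((√(π / t) : ℝ) : ℂ) := by
    have : √(π / (2 * |p'' a| * t)) = √(π / t) / √(2 * |p'' a|) := by
      rw [← sqrt_div (by positivity), div_div, mul_comm t]
    rw [← Complex.ofReal_mul, hc, hεp'', this]
    congr 1
    ring
  set T : ℝ := |q a| / (√(2 * |p'' a|) * √|p b - p a|) with hT
  have hcT : |c| / √(ε * (p b - p a)) = T := by
    rw [hT, hc, hεp'', hψabs, abs_div, abs_of_nonneg (sqrt_nonneg _), div_div]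
  have hQbT : |Q11 b| ≤ |q b / p' b| + T := by
    rw [hQ11]
    refine (abs_sub _ _).trans_eq ?_
    rw [hT, hεp'', hψabs, abs_div (q a), abs_of_nonneg (by positivity : 0 ≤ √(2 * |p'' a|) * _),
      abs_div, abs_div, abs_mul, hεabs, one_mul]
  have hVbound : ‖∫ x in a..b, e x * ((deriv Q11 x : ℝ) : ℂ) / w‖ ≤
      (∫ x in a..b, |deriv Q11 x|) / t := by
    rw [← intervalIntegral.integral_div]
    exact intervalIntegral.norm_integral_le_of_norm_le hab.le
      (Eventually.of_forall fun x _ => (hnorm x _).le) (hV.div_const t)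
  have hdecomp : (∫ x in a..b, e x * (q x : ℂ)) - e a * Complex.exp (ε * π * Complex.I / 4) *
      ((√(π / (2 * |p'' a| * t)) * q a : ℝ) : ℂ) =
      e b * Q11 b / w - e a * L / w - (∫ x in a..b, e x * ((deriv Q11 x : ℝ) : ℂ) / w) +
        c * e a * (F (ε * (p b - p a)) -
          Complex.exp (ε * π * Complex.I / 4) * ((√(π / t) : ℝ) : ℂ)) := by
    rw [hconst, eq_sub_of_add_eq hFTC]
    ring
  rw [hdecomp]
  calc _ ≤ ‖e b * Q11 b / w‖ + ‖e a * L / w‖ + ‖∫ x in a..b, e x * ((deriv Q11 x : ℝ) : ℂ) / w‖ +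
        ‖c * e a * (F (ε * (p b - p a)) -
          Complex.exp (ε * π * Complex.I / 4) * ((√(π / t) : ℝ) : ℂ))‖ :=
        (norm_add_le _ _).trans (add_le_add_left ((norm_sub_le _ _).trans
          (add_le_add_left (norm_sub_le _ _) _)) _)
    _ ≤ (|q b / p' b| + T) / t + |L| / t + (∫ x in a..b, |deriv Q11 x|) / t +
        |c| * (2 / (t * √(ε * (p b - p a)))) := by
      rw [hnorm, hnorm, norm_mul, norm_mul, henorm, mul_one, Complex.norm_real, Real.norm_eq_abs]
      gcongr
    _ = _ := by
      have : |c| * (2 / (t * √(ε * (p b - p a)))) = 2 * T / t := by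
        rw [← hcT]
        ring
      rw [this, hLabs, mul_div_assoc 3, ← hT]
      ring
end
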